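/- Let α∈(0,1/2], let F satisfy the regular right tail condition (with exponent α) and the converging tail ratio condition, and let c∈(0,2α). Suppose ω(x)=O(x^c) as x→∞. If there exist T∈[0,∞) and s with c≤s<2α such that the set E_T={x≥0: ω(x)>T} has density O(x^{−c}) at scale x^s, then the SRT holds for F. -/

import Mathlib

open MeasureTheory Filter Set Real Asymptotics

attribute [local instance] Classical.propDecidable

noncomputable section

namespace SRT

/-- Convolution of two measures on `ℝ`. -/
def mconv (μ ν : Measure ℝ) : Measure ℝ := μ.bind fun x => ν.map fun y => x + y

/-- `n`-fold self-convolution of `μ`, with the 0-th power the unit mass at `0`. -/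
def convPow (μ : Measure ℝ) : ℕ → Measure ℝ
  | 0 => Measure.dirac 0
  | n + 1 => mconv (convPow μ n) μ

/-- The renewal measure `U = ∑ₙ F^{*n}`. -/
def renewal (μ : Measure ℝ) : Measure ℝ := Measure.sum fun n => convPow μ n

/-- Right tail `F̄(x) = μ((x,∞))`. -/
def rtail (μ : Measure ℝ) (x : ℝ) : ℝ := (μ (Set.Ioi x)).toReal

/-- `f` is strictly positive on `(0,∞)` and regularly varying at `∞` with exponent `β`. -/
def RegVary (f : ℝ → ℝ) (β : ℝ) : Prop :=
  (∀ x > 0, 0 < f x) ∧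
    ∀ c > 0, Tendsto (fun x => f (c * x) / f x) atTop (nhds (c ^ β))

/-- `f` is regularly varying at `∞` with some exponent. -/
def RegVaryAny (f : ℝ → ℝ) : Prop := ∃ β : ℝ, RegVary f β

/-- Regular right tail condition: `F̄(x) ∼ 1/ℓ(x)` as `x → ∞`. -/
def RightTail (μ : Measure ℝ) (ℓ : ℝ → ℝ) : Prop :=
  Tendsto (fun x => rtail μ x * ℓ x) atTop (nhds 1)

/-- Converging tail ratio condition: `F(-x)/F̄(x)` converges to a finite limit. -/
def TailRatio (μ : Measure ℝ) : Prop :=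
  ∃ p : ℝ, Tendsto (fun x => (μ (Set.Iic (-x))).toReal / rtail μ x) atTop (nhds p)

/-- `μ` is concentrated on `dℤ`. -/
def ConcOn (μ : Measure ℝ) (d : ℝ) : Prop := μ {x : ℝ | ∃ k : ℤ, x = k * d} = 1

/-- `μ` is arithmetic. -/
def Arith (μ : Measure ℝ) : Prop := ∃ d > 0, ConcOn μ d

/-- `h` is admissible: any positive number if `μ` is non-arithmetic, and
the span of `μ` if `μ` is arithmetic. -/
def SpanOK (μ : Measure ℝ) (h : ℝ) : Prop :=
  0 < h ∧ (¬ Arith μ ∨ (ConcOn μ h ∧ ∀ d > 0, ConcOn μ d → d ≤ h))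

/-- `μ` is concentrated on `a + dℤ`. -/
def ConcOnLat (μ : Measure ℝ) (a d : ℝ) : Prop :=
  μ {x : ℝ | ∃ k : ℤ, x = a + k * d} = 1

/-- `μ` is lattice. -/
def IsLattice (μ : Measure ℝ) : Prop := ∃ a d : ℝ, 0 ≤ a ∧ a < d ∧ ConcOnLat μ a d

/-- `h` is admissible: any positive number if `μ` is non-lattice, and
the span of `μ` if `μ` is lattice. -/
def LatSpanOK (μ : Measure ℝ) (h : ℝ) : Prop :=
  0 < h ∧ (¬ IsLattice μ ∨
    ((∃ a, 0 ≤ a ∧ a < h ∧ ConcOnLat μ a h) ∧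
      ∀ a d : ℝ, 0 ≤ a → a < d → ConcOnLat μ a d → d ≤ h))

/-- Generalized inverse `ℓ⁻(x) = inf {t ≥ 1 : ℓ(t) > x}`. -/
def linv (ℓ : ℝ → ℝ) (x : ℝ) : ℝ := sInf {t : ℝ | 1 ≤ t ∧ x < ℓ t}

/-- `ω(x) = x F((x,x+h]) / F̄(x)`. -/
def omegaFn (μ : Measure ℝ) (h x : ℝ) : ℝ :=
  x * (μ (Set.Ioc x (x + h))).toReal / rtail μ x

/-- `I_η(x,T) = ∫_{(1-η)x}^x (ω(y)-T)⁺ dy`. -/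
def Iof (μ : Measure ℝ) (h η x T : ℝ) : ℝ :=
  ∫ y in (1 - η) * x..x, max (omegaFn μ h y - T) 0

/-- `Î_{η,n,r}(x,T) = ∫_{(1-η)x}^x e^{-(x-y)/(r aₙ)} (ω(y)-T)⁺ dy`. -/
def IofHat (μ : Measure ℝ) (ℓ : ℝ → ℝ) (h η : ℝ) (n : ℕ) (r x T : ℝ) : ℝ :=
  ∫ y in (1 - η) * x..x,
    Real.exp (-(x - y) / (r * linv ℓ (n : ℝ))) * max (omegaFn μ h y - T) 0

/-- `Sₙ/aₙ` converges in distribution to a law with density `g`. -/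
def StableLimit (F : Measure ℝ) (ℓ : ℝ → ℝ) (g : ℝ → ℝ) : Prop :=
  ∀ f : BoundedContinuousFunction ℝ ℝ,
    Tendsto (fun n : ℕ =>
        ∫ x, f x ∂((convPow F n).map fun y => y / linv ℓ (n : ℝ))) atTop
      (nhds (∫ x, f x * g x))

/-- `Sₙ/aₙ` converges in distribution to the law `μζ`. -/
def WeakLimit (F : Measure ℝ) (ℓ : ℝ → ℝ) (μζ : Measure ℝ) : Prop :=
  ∀ f : BoundedContinuousFunction ℝ ℝ,
    Tendsto (fun n : ℕ =>
        ∫ x, f x ∂((convPow F n).map fun y => y / linv ℓ (n : ℝ))) atTop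
      (nhds (∫ x, f x ∂μζ))

/-- The law `μ` is stable: for each `n`, the `n`-fold convolution is the law of
`cₙ X + dₙ` for some `cₙ > 0`, `dₙ`. -/
def IsStable (μ : Measure ℝ) : Prop :=
  ∀ n : ℕ, 0 < n → ∃ c : ℝ, 0 < c ∧ ∃ d : ℝ, convPow μ n = μ.map fun x => c * x + d

/-- The strong renewal theorem:
`x F̄(x) U((x,x+h]) → α h ∫₀^∞ t^{-α} g(t) dt`. -/
def SRTholds (F : Measure ℝ) (h α : ℝ) (g : ℝ → ℝ) : Prop :=
  Tendsto (fun x : ℝ => x * rtail F x * ((renewal F) (Set.Ioc x (x + h))).toReal)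
    atTop (nhds (α * h * ∫ t in Set.Ioi (0:ℝ), t ^ (-α) * g t))

variable {Ω : Type*} [MeasurableSpace Ω]

/-- Partial sums `Sₙ = X₁ + ⋯ + Xₙ`. -/
def pSum (X : ℕ → Ω → ℝ) (n : ℕ) (ω : Ω) : ℝ := ∑ i ∈ Finset.range n, X i ω

/-- `X` is an i.i.d. sequence with common law `F` under `P`. -/
def IIDseq (P : Measure Ω) (F : Measure ℝ) (X : ℕ → Ω → ℝ) : Prop :=
  (∀ i, Measurable (X i)) ∧ (∀ i, P.map (X i) = F) ∧
    ProbabilityTheory.iIndepFun X P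

/-- `Nₙ = #{i ≤ n : Xᵢ > 0}`. -/
def Ncount (X : ℕ → Ω → ℝ) (n : ℕ) (ω : Ω) : ℕ :=
  ((Finset.range n).filter fun i => 0 < X i ω).card

/-- `Sₙ⁻ = ∑_{i ≤ n} Xᵢ⁻`. -/
def sMinus (X : ℕ → Ω → ℝ) (n : ℕ) (ω : Ω) : ℝ :=
  ∑ i ∈ Finset.range n, max (-(X i ω)) 0

/-- The quantity `R_{T,η,r,c₁,c₂}(x,δ)` of Theorem `t:sum-small-n`, with
`xₙ = x + Sₙ⁻` and `κ = ⌊1/α⌋`. -/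
def Rquant (F : Measure ℝ) (ℓ : ℝ → ℝ) (h α : ℝ) (P : Measure Ω) (X : ℕ → Ω → ℝ)
    (L : ℝ → ℝ) (T η r c₁ c₂ x δ : ℝ) : ℝ :=
  (x / ℓ x) * ∑ n ∈ Finset.Ico ⌈L x⌉₊ ⌈ℓ (δ * x)⌉₊,
    ∫ ω, ((Ncount X n ω : ℝ) / linv ℓ ((Ncount X n ω : ℕ) : ℝ)) *
        (rtail F (x + sMinus X n ω) / (x + sMinus X n ω)) *
        sSup ((fun t => IofHat F ℓ h η (Ncount X n ω) r t T) ''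
          Set.Icc (c₁ * (x + sMinus X n ω) / (⌊1/α⌋₊ : ℝ))
            (c₂ * (x + sMinus X n ω) + 2 * h)) ∂P

/-- Strict ascending ladder epochs. -/
def ladderTime (X : ℕ → Ω → ℝ) : ℕ → Ω → ℕ
  | 0 => fun _ => 0
  | k + 1 => fun ω =>
      sInf {n : ℕ | ladderTime X k ω < n ∧ pSum X (ladderTime X k ω) ω < pSum X n ω}

/-- Strict ascending ladder heights `H_k`. -/
def ladderHeight (X : ℕ → Ω → ℝ) (k : ℕ) (ω : Ω) : ℝ := pSum X (ladderTime X k ω) ω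

/-- Weak descending ladder epochs (weak ascending epochs of `-S`). -/
def wLadderTimeDesc (X : ℕ → Ω → ℝ) : ℕ → Ω → ℕ
  | 0 => fun _ => 0
  | k + 1 => fun ω =>
      sInf {n : ℕ | wLadderTimeDesc X k ω < n ∧
        pSum X n ω ≤ pSum X (wLadderTimeDesc X k ω) ω}

/-- Weak descending ladder heights (ladder heights of the walk `-S`). -/
def wLadderHeightDesc (X : ℕ → Ω → ℝ) (k : ℕ) (ω : Ω) : ℝ :=
  - pSum X (wLadderTimeDesc X k ω) ω

/-- `X_{n:k}`, the `k`-th largest among `X₁,…,Xₙ`; by convention `0` if `k > n`. -/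
def ordStat (X : ℕ → Ω → ℝ) (n k : ℕ) (ω : Ω) : ℝ :=
  sSup {t : ℝ | k ≤ ((Finset.range n).filter fun i => t ≤ X i ω).card}

/-- `S_{n:k} = X_{n:1} + ⋯ + X_{n:k}`. -/
def topSum (X : ℕ → Ω → ℝ) (n k : ℕ) (ω : Ω) : ℝ :=
  ∑ j ∈ Finset.Icc 1 k, ordStat X n j ω

/-- `ζ_{n,x} = aₙ^{1-γ} x^γ`. -/
def zetaCut (ℓ : ℝ → ℝ) (γ : ℝ) (n : ℕ) (x : ℝ) : ℝ :=
  (linv ℓ (n : ℝ)) ^ (1 - γ) * x ^ γ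

/-- The event `E_{n,k,x} = {Sₙ ∈ (x,x+h], X_{n:k} > ζ_{n,x} ≥ X_{n:k+1}}`,
with the convention `X_{n:0} = ∞`. -/
def Eevent (X : ℕ → Ω → ℝ) (ℓ : ℝ → ℝ) (h γ : ℝ) (n k : ℕ) (x : ℝ) : Set Ω :=
  {ω | pSum X n ω ∈ Set.Ioc x (x + h) ∧
    (k = 0 ∨ zetaCut ℓ γ n x < ordStat X n k ω) ∧
    ordStat X n (k + 1) ω ≤ zetaCut ℓ γ n x}

end SRT

open SRT

namespace SRT

/-- `E` has (asymptotic) density `O(x^{-c})` at scale `x^s`: for all large `x`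
and all `y ≥ x^s`, `|E ∩ (x,x+y)| = O(x^{-c} y)`. -/
def DensityAtScale (E : Set ℝ) (c s : ℝ) : Prop :=
  ∃ C x₀ : ℝ, ∀ x : ℝ, x₀ ≤ x → ∀ y : ℝ, x ^ s ≤ y →
    (volume (E ∩ Set.Ioo x (x + y))).toReal ≤ C * x ^ (-c) * y

end SRT

namespace SRT

open scoped Topology ENNReal

lemma conv_apply (μ ν : Measure ℝ) [SFinite ν] {s : Set ℝ} (hs : MeasurableSet s) :
    (μ ∗ ν) s = ∫⁻ x, ν ((fun y => x + y) ⁻¹' s) ∂μ := by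
  have h : Measurable fun p : ℝ × ℝ => p.1 + p.2 := by fun_prop
  rw [Measure.conv, Measure.map_apply h hs, Measure.prod_apply (h hs)]
  rfl

lemma mconv_eq_conv (μ ν : Measure ℝ) [SFinite ν] : mconv μ ν = μ ∗ ν := by
  ext s hs
  rw [conv_apply μ ν hs, mconv, Measure.bind_apply hs]
  · refine lintegral_congr fun x => ?_
    rw [Measure.map_apply (by fun_prop) hs]
  · have : (fun x : ℝ => ν.map fun y => x + y) =
        fun x => (ν.map (Prod.mk x)).map (fun p : ℝ × ℝ => p.1 + p.2) := by
      funext x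
      rw [Measure.map_map (by fun_prop) (by fun_prop)]
      rfl
    rw [this]
    exact ((Measure.measurable_map _ (by fun_prop)).comp
      Measurable.map_prodMk_left).aemeasurable

instance isFiniteMeasure_convPow (μ : Measure ℝ) [IsFiniteMeasure μ] (n : ℕ) :
    IsFiniteMeasure (convPow μ n) := by
  induction n with
  | zero => rw [convPow]; infer_instance
  | succ n ih => rw [convPow, mconv_eq_conv]; infer_instance

instance isProbabilityMeasure_convPow (μ : Measure ℝ) [IsProbabilityMeasure μ] (n : ℕ) :
    IsProbabilityMeasure (convPow μ n) := by
  induction n with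
  | zero => rw [convPow]; infer_instance
  | succ n ih => rw [convPow, mconv_eq_conv]; infer_instance

lemma convPow_succ (μ : Measure ℝ) [IsFiniteMeasure μ] (n : ℕ) :
    convPow μ (n + 1) = convPow μ n ∗ μ := by
  rw [convPow, mconv_eq_conv]

lemma convPow_add (μ : Measure ℝ) [IsFiniteMeasure μ] (m n : ℕ) :
    convPow μ (m + n) = convPow μ m ∗ convPow μ n := by
  induction n with
  | zero => simp [convPow]
  | succ n ih => rw [← add_assoc, convPow_succ, convPow_succ, ih, Measure.conv_assoc]

lemma charFun_convPow (μ : Measure ℝ) [IsFiniteMeasure μ] (n : ℕ) (t : ℝ) :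
    charFun (convPow μ n) t = charFun μ t ^ n := by
  induction n with
  | zero => simp [convPow, charFun_dirac]
  | succ n ih => rw [convPow_succ, charFun_conv, ih, pow_succ]

lemma conv_apply_Ioc (μ ν : Measure ℝ) [SFinite ν] (x h : ℝ) :
    (μ ∗ ν) (Ioc x (x + h)) = ∫⁻ y, ν (Ioc (x - y) (x - y + h)) ∂μ := by
  rw [conv_apply μ ν measurableSet_Ioc]
  refine lintegral_congr fun y => congrArg _ ?_
  ext z
  simp only [mem_preimage, mem_Ioc]
  constructor <;> rintro ⟨h1, h2⟩ <;> constructor <;> linarith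

lemma conv_mono {μ μ' ν ν' : Measure ℝ} [SFinite ν] [SFinite ν'] (h1 : μ ≤ μ') (h2 : ν ≤ ν') :
    μ ∗ ν ≤ μ' ∗ ν' := by
  refine Measure.le_iff.2 fun s hs => ?_
  rw [conv_apply _ _ hs, conv_apply _ _ hs]
  exact lintegral_mono' h1 fun x => h2 _

lemma convPow_mono {μ ν : Measure ℝ} [IsFiniteMeasure μ] [IsFiniteMeasure ν] (h : μ ≤ ν) (n : ℕ) :
    convPow μ n ≤ convPow ν n := by
  induction n with
  | zero => exact le_rfl
  | succ n ih => rw [convPow_succ, convPow_succ]; exact conv_mono ih h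

/-- Replacing one factor at a time: `(σ + β)^{*n} ≤ σ^{*n} + n β * (σ + β)^{*(n-1)}`. -/
lemma convPow_add_le (σ β : Measure ℝ) [IsFiniteMeasure σ] [IsFiniteMeasure β] (n : ℕ) :
    convPow (σ + β) n ≤
      convPow σ n + (n : ℝ≥0∞) • (β ∗ convPow (σ + β) (n - 1)) := by
  induction n with
  | zero => simp [convPow]
  | succ n ih =>
    rw [convPow_succ, Measure.conv_add]
    have h1 : convPow (σ + β) n ∗ σ ≤
        convPow σ (n + 1) + (n : ℝ≥0∞) • (β ∗ convPow (σ + β) n) := by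
      refine (conv_mono ih le_rfl).trans ?_
      rw [Measure.add_conv, ← convPow_succ]
      gcongr
      rw [Measure.conv_smul_left]
      rcases n with _ | n
      · simp
      · gcongr
        rw [Measure.conv_assoc]
        refine conv_mono le_rfl ?_
        rw [convPow_succ, Nat.add_sub_cancel]
        exact conv_mono le_rfl (Measure.le_add_right le_rfl)
    refine (add_le_add h1 le_rfl).trans ?_
    rw [Measure.conv_comm (convPow (σ + β) n) β, add_assoc, Nat.add_sub_cancel]
    push_cast
    rw [add_smul, one_smul]

lemma convPow_le_sum (σ β : Measure ℝ) [IsFiniteMeasure σ] [IsFiniteMeasure β] (n J : ℕ) :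
    convPow (σ + β) n ≤
      ∑ j ∈ Finset.range J, (n : ℝ≥0∞) ^ j • (convPow β j ∗ convPow σ (n - j)) +
        (n : ℝ≥0∞) ^ J • (convPow β J ∗ convPow (σ + β) (n - J)) := by
  induction J with
  | zero => simp [convPow]
  | succ J ih =>
    refine ih.trans ?_
    rw [Finset.sum_range_succ, add_assoc]
    gcongr
    have h1 : convPow β J ∗ convPow (σ + β) (n - J) ≤
        convPow β J ∗ convPow σ (n - J) +
          (n : ℝ≥0∞) • (convPow β (J + 1) ∗ convPow (σ + β) (n - (J + 1))) := by
      refine (conv_mono le_rfl (convPow_add_le σ β (n - J))).trans ?_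
      rw [Measure.conv_add, convPow_succ, Measure.conv_smul_right, Measure.conv_assoc,
        Nat.sub_sub]
      gcongr
      exact Nat.sub_le _ _
    calc (n : ℝ≥0∞) ^ J • (convPow β J ∗ convPow (σ + β) (n - J))
        ≤ (n : ℝ≥0∞) ^ J • (convPow β J ∗ convPow σ (n - J) +
          (n : ℝ≥0∞) • (convPow β (J + 1) ∗ convPow (σ + β) (n - (J + 1)))) := by gcongr
      _ = _ := by rw [smul_add, smul_smul, pow_succ]

lemma lintegral_exp_convPow (μ : Measure ℝ) [IsFiniteMeasure μ] (l : ℝ) (n : ℕ) :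
    ∫⁻ y, ENNReal.ofReal (exp (l * y)) ∂(convPow μ n) =
      (∫⁻ y, ENNReal.ofReal (exp (l * y)) ∂μ) ^ n := by
  induction n with
  | zero => simp [convPow]
  | succ n ih =>
    rw [convPow_succ, Measure.lintegral_conv (by fun_prop), pow_succ, ← ih]
    rw [← lintegral_mul_const _ (by fun_prop)]
    refine lintegral_congr fun x => ?_
    rw [← lintegral_const_mul _ (by fun_prop)]
    refine lintegral_congr fun y => ?_
    rw [mul_add, Real.exp_add, ENNReal.ofReal_mul (by positivity)]

lemma convPow_univ (μ : Measure ℝ) [IsFiniteMeasure μ] (n : ℕ) :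
    convPow μ n univ = (μ univ) ^ n := by
  simpa using lintegral_exp_convPow μ 0 n

/-- The right tail of `F` is positive and regularly varying with exponent `-α`, `α ∈ (0, 1/2]`,
and dominates the left tail. -/
structure RegTail (F : Measure ℝ) (α : ℝ) : Prop where
  α_pos : 0 < α
  α_le : α ≤ 1 / 2
  pos : ∀ x, 0 < rtail F x
  rv : ∀ l, 0 < l → Tendsto (fun x => rtail F (l * x) / rtail F x) atTop (𝓝 (l ^ (-α)))
  left : ∃ C, ∀ x, 0 ≤ x → (F (Iic (-x))).toReal ≤ C * rtail F x

/-- `a` is a norming sequence for the tail of `F`: `n F̄(l aₙ) → l^{-α}`. -/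
structure ScaleSeq (F : Measure ℝ) (α : ℝ) (a : ℕ → ℝ) : Prop where
  one_le : ∀ n, 1 ≤ a n
  mono : Monotone a
  tail : ∀ l, 0 < l → Tendsto (fun n : ℕ => n * rtail F (l * a n)) atTop (𝓝 (l ^ (-α)))

lemma rtail_antitone (F : Measure ℝ) [IsProbabilityMeasure F] : Antitone (rtail F) := by
  intro x y hxy
  exact ENNReal.toReal_mono (measure_ne_top _ _) (measure_mono (Ioi_subset_Ioi hxy))

lemma rtail_nonneg (F : Measure ℝ) (x : ℝ) : 0 ≤ rtail F x := ENNReal.toReal_nonneg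

lemma rtail_le_one (F : Measure ℝ) [IsProbabilityMeasure F] (x : ℝ) : rtail F x ≤ 1 :=
  ENNReal.toReal_le_of_le_ofReal zero_le_one (by simpa using prob_le_one)

lemma ofReal_rtail (F : Measure ℝ) [IsProbabilityMeasure F] (x : ℝ) :
    ENNReal.ofReal (rtail F x) = F (Ioi x) :=
  ENNReal.ofReal_toReal (measure_ne_top _ _)

lemma tendsto_rtail (F : Measure ℝ) [IsProbabilityMeasure F] :
    Tendsto (rtail F) atTop (𝓝 0) := by
  have h : Tendsto (fun x : ℝ => F (Ioi x)) atTop (𝓝 (F (⋂ x : ℝ, Ioi x))) :=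
    tendsto_measure_iInter_atTop (fun x => measurableSet_Ioi.nullMeasurableSet)
      (fun x y hxy => Ioi_subset_Ioi hxy) ⟨0, measure_ne_top _ _⟩
  have h0 : (⋂ x : ℝ, Ioi x) = ∅ := by
    ext y
    simp only [mem_iInter, mem_Ioi, mem_empty_iff_false, iff_false, not_forall, not_lt]
    exact ⟨y, le_rfl⟩
  rw [h0, measure_empty] at h
  exact (ENNReal.tendsto_toReal ENNReal.zero_ne_top).comp h

section Potter

variable {G : ℝ → ℝ} {α : ℝ}

lemma potter_upper (hanti : Antitone G) (hpos : ∀ x, 0 < G x)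
    (hrv : Tendsto (fun x => G (2 * x) / G x) atTop (𝓝 ((2:ℝ) ^ (-α)))) {β : ℝ} (hβ0 : 0 ≤ β)
    (hβ : β < α) :
    ∃ C > 0, ∀ x y, 1 ≤ x → x ≤ y → G y ≤ C * (y / x) ^ (-β) * G x := by
  have h1 : (2:ℝ) ^ (-α) < 2 ^ (-β) := Real.rpow_lt_rpow_of_exponent_lt one_lt_two (by linarith)
  obtain ⟨x₀, hx₀⟩ := eventually_atTop.1
    ((hrv.eventually (gt_mem_nhds h1)).and (eventually_ge_atTop 1))
  have hx1 : 1 ≤ x₀ := (hx₀ x₀ le_rfl).2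
  have hstep : ∀ x, x₀ ≤ x → G (2 * x) ≤ 2 ^ (-β) * G x := fun x hx => by
    have := (hx₀ x hx).1
    rw [div_lt_iff₀ (hpos x)] at this
    exact this.le
  have hiter : ∀ k : ℕ, ∀ x, x₀ ≤ x → G (2 ^ k * x) ≤ ((2:ℝ) ^ k) ^ (-β) * G x := by
    intro k
    induction k with
    | zero => intro x _; simp
    | succ k ih =>
      intro x hx
      have h2 : x₀ ≤ 2 ^ k * x :=
        hx.trans (le_mul_of_one_le_left (by linarith) (one_le_pow₀ one_le_two))
      calc G (2 ^ (k + 1) * x) = G (2 * (2 ^ k * x)) := by ring_nf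
        _ ≤ 2 ^ (-β) * G (2 ^ k * x) := hstep _ h2
        _ ≤ 2 ^ (-β) * (((2:ℝ) ^ k) ^ (-β) * G x) := by gcongr; exact ih x hx
        _ = _ := by
          rw [pow_succ, Real.mul_rpow (by positivity) (by positivity)]; ring
  have hbig : ∀ x y, x₀ ≤ x → x ≤ y → G y ≤ 2 ^ β * (y / x) ^ (-β) * G x := by
    intro x y hx hxy
    have hxp : 0 < x := by linarith
    obtain ⟨k, hk1, hk2⟩ := exists_nat_pow_near ((one_le_div hxp).2 hxy) one_lt_two
    have h3 : 2 ^ k * x ≤ y := by rwa [le_div_iff₀ hxp] at hk1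
    have hyx : 0 < y / x := div_pos (by linarith) hxp
    refine (hanti h3).trans ((hiter k x hx).trans ?_)
    refine mul_le_mul_of_nonneg_right ?_ (hpos x).le
    have h4 : ((2:ℝ) ^ k) ^ (-β) = 2 ^ β * ((2:ℝ) ^ (k + 1)) ^ (-β) := by
      rw [pow_succ, Real.mul_rpow (by positivity) (by positivity), mul_left_comm,
        ← Real.rpow_add two_pos]
      simp
    rw [h4]
    gcongr 2 ^ β * ?_
    exact Real.rpow_le_rpow_of_nonpos hyx hk2.le (by linarith)
  refine ⟨2 ^ β * x₀ ^ β, by positivity, fun x y hx hxy => ?_⟩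
  have hxp : 0 < x := by linarith
  have hyp : 0 < y := by linarith
  have h2β : (1:ℝ) ≤ 2 ^ β := Real.one_le_rpow one_le_two hβ0
  have hx₀β : (1:ℝ) ≤ x₀ ^ β := Real.one_le_rpow hx1 hβ0
  rcases le_total x₀ x with h | h
  · refine (hbig x y h hxy).trans ?_
    have : 0 ≤ (y / x) ^ (-β) * G x := mul_nonneg (by positivity) (hpos x).le
    nlinarith [mul_nonneg this (mul_nonneg (sub_nonneg.2 hx₀β) (by positivity : (0:ℝ) ≤ 2 ^ β))]
  rcases le_total x₀ y with h' | h'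
  · refine (hbig x₀ y le_rfl h').trans ?_
    have h5 : (y / x₀) ^ (-β) ≤ x₀ ^ β * (y / x) ^ (-β) := by
      have : y / x₀ = (x₀ / x)⁻¹ * (y / x) := by field_simp
      rw [this, Real.mul_rpow (by positivity) (by positivity), Real.inv_rpow (by positivity),
        Real.rpow_neg (by positivity), inv_inv]
      gcongr
      exact div_le_self (by linarith) hx
    calc 2 ^ β * (y / x₀) ^ (-β) * G x₀ ≤ 2 ^ β * (x₀ ^ β * (y / x) ^ (-β)) * G x :=
          mul_le_mul (by gcongr) (hanti h) (hpos _).le (by positivity)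
      _ = _ := by ring
  · refine (hanti hxy).trans ?_
    refine le_mul_of_one_le_left (hpos x).le ?_
    have h6 : y / x ≤ x₀ := (div_le_self hyp.le hx).trans h'
    have h7 : x₀ ^ (-β) ≤ (y / x) ^ (-β) :=
      Real.rpow_le_rpow_of_nonpos (by positivity) h6 (by linarith)
    have h8 : x₀ ^ β * x₀ ^ (-β) = 1 := by rw [← Real.rpow_add (by linarith)]; simp
    calc (1:ℝ) = x₀ ^ β * x₀ ^ (-β) := h8.symm
      _ ≤ x₀ ^ β * (y / x) ^ (-β) := by gcongr
      _ ≤ 2 ^ β * x₀ ^ β * (y / x) ^ (-β) := by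
        rw [mul_assoc]; exact le_mul_of_one_le_left (by positivity) h2β

lemma potter_lower (hanti : Antitone G) (hpos : ∀ x, 0 < G x)
    (hrv : Tendsto (fun x => G (2 * x) / G x) atTop (𝓝 ((2:ℝ) ^ (-α)))) {β : ℝ} (hβ0 : 0 ≤ β)
    (hβ : α < β) :
    ∃ C > 0, ∀ x y, 1 ≤ x → x ≤ y → G x ≤ C * (y / x) ^ β * G y := by
  have h1 : (2:ℝ) ^ (-β) < 2 ^ (-α) := Real.rpow_lt_rpow_of_exponent_lt one_lt_two (by linarith)
  obtain ⟨x₀, hx₀⟩ := eventually_atTop.1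
    ((hrv.eventually (lt_mem_nhds h1)).and (eventually_ge_atTop 1))
  have hx1 : 1 ≤ x₀ := (hx₀ x₀ le_rfl).2
  have hstep : ∀ x, x₀ ≤ x → G x ≤ 2 ^ β * G (2 * x) := fun x hx => by
    have := (hx₀ x hx).1
    rw [lt_div_iff₀ (hpos x), Real.rpow_neg two_pos.le, inv_mul_lt_iff₀ (by positivity)] at this
    exact this.le
  have hiter : ∀ k : ℕ, ∀ x, x₀ ≤ x → G x ≤ ((2:ℝ) ^ k) ^ β * G (2 ^ k * x) := by
    intro k
    induction k with
    | zero => intro x _; simp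
    | succ k ih =>
      intro x hx
      have h2 : x₀ ≤ 2 ^ k * x :=
        hx.trans (le_mul_of_one_le_left (by linarith) (one_le_pow₀ one_le_two))
      calc G x ≤ ((2:ℝ) ^ k) ^ β * G (2 ^ k * x) := ih x hx
        _ ≤ ((2:ℝ) ^ k) ^ β * (2 ^ β * G (2 * (2 ^ k * x))) := by gcongr; exact hstep _ h2
        _ = _ := by
          rw [pow_succ, Real.mul_rpow (by positivity) (by positivity)]; ring_nf
  have hbig : ∀ x y, x₀ ≤ x → x ≤ y → G x ≤ 2 ^ β * (y / x) ^ β * G y := by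
    intro x y hx hxy
    have hxp : 0 < x := by linarith
    obtain ⟨k, hk1, hk2⟩ := exists_nat_pow_near ((one_le_div hxp).2 hxy) one_lt_two
    have h3 : y ≤ 2 ^ (k + 1) * x := by
      have := hk2.le; rwa [div_le_iff₀ hxp] at this
    refine (hiter (k + 1) x hx).trans ?_
    have hyx : 0 < y / x := div_pos (by linarith) hxp
    refine mul_le_mul ?_ (hanti h3) (hpos _).le (by positivity)
    rw [pow_succ, Real.mul_rpow (by positivity) (by positivity), mul_comm]
    gcongr
  have hR : 1 ≤ G 1 / G x₀ := (one_le_div (hpos _)).2 (hanti hx1)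
  have h2β : (1:ℝ) ≤ 2 ^ β := Real.one_le_rpow one_le_two hβ0
  have hG1 := hpos 1
  have hG0 := hpos x₀
  refine ⟨2 ^ β * (G 1 / G x₀), by positivity, fun x y hx hxy => ?_⟩
  have hxp : 0 < x := by linarith
  have hyp : 0 < y := by linarith
  have hyx : 1 ≤ (y / x) ^ β := Real.one_le_rpow ((one_le_div hxp).2 hxy) hβ0
  have hGy := hpos y
  rcases le_total x₀ x with h | h
  · refine (hbig x y h hxy).trans ?_
    calc 2 ^ β * (y / x) ^ β * G y ≤ (2 ^ β * (y / x) ^ β * G y) * (G 1 / G x₀) :=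
          le_mul_of_one_le_right (by positivity) hR
      _ = _ := by ring
  rcases le_total x₀ y with h' | h'
  · calc G x ≤ G 1 := hanti hx
      _ = G 1 / G x₀ * G x₀ := by field_simp
      _ ≤ G 1 / G x₀ * (2 ^ β * (y / x₀) ^ β * G y) := by gcongr; exact hbig x₀ y le_rfl h'
      _ ≤ G 1 / G x₀ * (2 ^ β * (y / x) ^ β * G y) := by gcongr
      _ = _ := by ring
  · calc G x ≤ G 1 := hanti hx
      _ = G 1 / G x₀ * G x₀ := by field_simp
      _ ≤ G 1 / G x₀ * G y := by gcongr; exact hanti h'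
      _ ≤ (G 1 / G x₀ * G y) * (2 ^ β * (y / x) ^ β) :=
          le_mul_of_one_le_right (by positivity) (one_le_mul_of_one_le_of_one_le h2β hyx)
      _ = _ := by ring

end Potter

section Scale

variable {F : Measure ℝ} [IsProbabilityMeasure F] {α : ℝ} {a : ℕ → ℝ}

lemma RegTail.upper (hF : RegTail F α) {β : ℝ} (hβ0 : 0 ≤ β) (hβ : β < α) :
    ∃ C > 0, ∀ x y, 1 ≤ x → x ≤ y → rtail F y ≤ C * (y / x) ^ (-β) * rtail F x :=
  potter_upper (rtail_antitone F) hF.pos (hF.rv 2 two_pos) hβ0 hβ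

lemma RegTail.lower (hF : RegTail F α) {β : ℝ} (hβ : α < β) :
    ∃ C > 0, ∀ x y, 1 ≤ x → x ≤ y → rtail F x ≤ C * (y / x) ^ β * rtail F y :=
  potter_lower (rtail_antitone F) hF.pos (hF.rv 2 two_pos) (hF.α_pos.trans hβ).le hβ

lemma ScaleSeq.tail_bounds (hF : RegTail F α) (ha : ScaleSeq F α a) :
    ∃ C ≥ 1, ∀ n : ℕ, 1 ≤ n → 1 ≤ C * (n * rtail F (a n)) ∧ n * rtail F (a n) ≤ C := by
  have h := ha.tail 1 one_pos
  simp only [one_mul, Real.one_rpow] at h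
  obtain ⟨N, hN⟩ := eventually_atTop.1 ((h.eventually (lt_mem_nhds (by norm_num : (1/2:ℝ) < 1))).and
    (h.eventually (gt_mem_nhds (by norm_num : (1:ℝ) < 2))))
  have hp := hF.pos (a N)
  refine ⟨2 + N + (rtail F (a N))⁻¹, by have := inv_pos.2 hp; linarith [N.cast_nonneg (α := ℝ)],
    fun n hn => ?_⟩
  have hn1 : (1:ℝ) ≤ n := by exact_mod_cast hn
  have hpn := hF.pos (a n)
  have hinv := inv_pos.2 hp
  rcases le_total N n with hNn | hNn
  · obtain ⟨h1, h2⟩ := hN n hNn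
    have hN0 := N.cast_nonneg (α := ℝ)
    constructor
    · nlinarith
    · linarith
  · have h1 : rtail F (a N) ≤ rtail F (a n) := rtail_antitone F (ha.mono hNn)
    have hNn' : (n:ℝ) ≤ N := by exact_mod_cast hNn
    constructor
    · have h3 : rtail F (a N) ≤ n * rtail F (a n) := by nlinarith
      have h4 : 1 ≤ (rtail F (a N))⁻¹ * (n * rtail F (a n)) := by
        rw [inv_mul_eq_div]; exact (one_le_div hp).2 h3
      nlinarith [N.cast_nonneg (α := ℝ)]
    · have := rtail_le_one F (a n)
      nlinarith

lemma ScaleSeq.tendsto_atTop (hF : RegTail F α) (ha : ScaleSeq F α a) :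
    Tendsto a atTop atTop := by
  obtain ⟨C, hC, h⟩ := ha.tail_bounds hF
  refine tendsto_atTop_atTop.2 fun b => ?_
  obtain ⟨n, hn⟩ := exists_nat_gt (C / rtail F b + 1)
  have hb := hF.pos b
  refine ⟨n, fun m hm => ?_⟩
  have hm' : (n:ℝ) ≤ m := by exact_mod_cast hm
  have hpos : 0 < C / rtail F b := by positivity
  have hm1 : 1 ≤ m := by
    have : (1:ℝ) < m := by linarith
    exact_mod_cast this.le
  by_contra! hlt
  have h1 := (h m hm1).2
  have h2 := rtail_antitone F hlt.le
  have h3 : C / rtail F b < m := by linarith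
  rw [div_lt_iff₀ hb] at h3
  nlinarith

/-- Doubling: `aₙ` and `aₘ` are comparable when `n ≤ 2 m + J`. -/
lemma ScaleSeq.doubling (hF : RegTail F α) (ha : ScaleSeq F α a) (J : ℕ) :
    ∃ C ≥ 1, ∀ n m : ℕ, n ≤ 2 * m + J → a n ≤ C * a m := by
  obtain ⟨C, hC, h⟩ := ha.tail_bounds hF
  have hα := hF.α_pos
  obtain ⟨D, hD, hpot⟩ := hF.upper (β := α / 2) (by linarith) (by linarith)
  set q : ℕ := 2 + J with hq
  set E : ℝ := (D * C ^ 2 * q) ^ (α / 2)⁻¹ with hE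
  have hE0 : 0 ≤ E := by positivity
  refine ⟨a J + E, by linarith [ha.one_le J], fun n m hnm => ?_⟩
  have ham := ha.one_le m
  rcases Nat.eq_zero_or_pos m with rfl | hm
  · have : a n ≤ a J := ha.mono (by omega)
    nlinarith [ha.one_le J]
  have h1 : a n ≤ a (q * m) := ha.mono (by rw [hq]; nlinarith)
  have hmq : m ≤ q * m := Nat.le_mul_of_pos_left _ (by omega)
  have h2 := hpot (a m) (a (q * m)) ham (ha.mono hmq)
  have h3 := (h (q * m) (by omega)).1
  have h4 := (h m hm).2
  push_cast at h3
  have hm0 : (0:ℝ) < m := by exact_mod_cast hm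
  have hq0 : (0:ℝ) < q := by rw [hq]; push_cast; positivity
  have hr : 0 < a (q * m) / a m := div_pos (by linarith [ha.one_le (q * m)]) (by linarith)
  have hpos := hF.pos (a m)
  have h5 : (a (q * m) / a m) ^ (α / 2) ≤ D * C ^ 2 * q := by
    have h6 : 1 ≤ C * (q * m * (D * (a (q * m) / a m) ^ (-(α / 2)) * rtail F (a m))) :=
      h3.trans (by gcongr)
    rw [Real.rpow_neg hr.le] at h6
    have h7 : 0 < (a (q * m) / a m) ^ (α / 2) := by positivity
    have h8 : C * (q * m * (D * ((a (q * m) / a m) ^ (α / 2))⁻¹ * rtail F (a m))) =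
      (C * q * D * (m * rtail F (a m))) / (a (q * m) / a m) ^ (α / 2) := by
        field_simp
    rw [h8, one_le_div h7] at h6
    refine h6.trans ?_
    calc C * q * D * (m * rtail F (a m)) ≤ C * q * D * C := by gcongr
      _ = _ := by ring
  have h9 : a (q * m) / a m ≤ E := by
    rw [hE]
    calc a (q * m) / a m = ((a (q * m) / a m) ^ (α / 2)) ^ (α / 2)⁻¹ := by
          rw [← Real.rpow_mul hr.le, mul_inv_cancel₀ (by positivity), Real.rpow_one]
      _ ≤ _ := by gcongr
  rw [div_le_iff₀ (by linarith)] at h9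
  nlinarith [ha.one_le J]

/-- Comparison of `n F̄(x)` with powers of `aₙ / x` when `x ≤ aₙ`. -/
lemma ScaleSeq.le_of_le (hF : RegTail F α) (ha : ScaleSeq F α a) {β : ℝ} (hβ : α < β) :
    ∃ C > 0, ∀ (n : ℕ) x, 1 ≤ x → x ≤ a n → n * rtail F x ≤ C * (a n / x) ^ β := by
  obtain ⟨C, hC, h⟩ := ha.tail_bounds hF
  obtain ⟨D, hD, hpot⟩ := hF.lower hβ
  refine ⟨D * C, by positivity, fun n x hx hxa => ?_⟩
  have hxp : 0 < x := by linarith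
  have hap : 0 < a n := by linarith
  rcases Nat.eq_zero_or_pos n with rfl | hn
  · simp only [Nat.cast_zero, zero_mul]; positivity
  calc n * rtail F x ≤ n * (D * (a n / x) ^ β * rtail F (a n)) := by
        gcongr; exact hpot x (a n) hx hxa
    _ = D * (a n / x) ^ β * (n * rtail F (a n)) := by ring
    _ ≤ D * (a n / x) ^ β * C := by gcongr; exact (h n hn).2
    _ = _ := by ring

/-- Comparison of `n F̄(x)` with powers of `aₙ / x` when `aₙ ≤ x`. -/
lemma ScaleSeq.le_of_ge (hF : RegTail F α) (ha : ScaleSeq F α a) {β : ℝ} (hβ0 : 0 ≤ β)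
    (hβ : β < α) :
    ∃ C > 0, ∀ (n : ℕ) x, a n ≤ x → n * rtail F x ≤ C * (x / a n) ^ (-β) := by
  obtain ⟨C, hC, h⟩ := ha.tail_bounds hF
  obtain ⟨D, hD, hpot⟩ := hF.upper hβ0 hβ
  refine ⟨D * C, by positivity, fun n x hxa => ?_⟩
  have hap : 0 < a n := by linarith [ha.one_le n]
  have hxp : 0 < x := by linarith
  rcases Nat.eq_zero_or_pos n with rfl | hn
  · simp only [Nat.cast_zero, zero_mul]; positivity
  calc n * rtail F x ≤ n * (D * (x / a n) ^ (-β) * rtail F (a n)) := by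
        gcongr; exact hpot (a n) x (ha.one_le n) hxa
    _ = D * (x / a n) ^ (-β) * (n * rtail F (a n)) := by ring
    _ ≤ D * (x / a n) ^ (-β) * C := by gcongr; exact (h n hn).2
    _ = _ := by ring

lemma ScaleSeq.nat_le_rpow (hF : RegTail F α) (ha : ScaleSeq F α a) {β : ℝ} (hβ : α < β) :
    ∃ C > 0, ∀ n : ℕ, n ≤ C * a n ^ β := by
  obtain ⟨C, hC, h⟩ := ha.le_of_le hF hβ
  have h1 := hF.pos 1
  refine ⟨C / rtail F 1, by positivity, fun n => ?_⟩
  have := h n 1 le_rfl (ha.one_le n)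
  rw [div_one] at this
  rw [div_mul_eq_mul_div, le_div_iff₀ h1]
  exact this

/-- If `n F̄(x) → v` then `aₙ / x → v^{1/α}`, along any filter with `x → ∞`. -/
lemma ScaleSeq.tendsto_div (hF : RegTail F α) (ha : ScaleSeq F α a) {ι : Type*} {f : Filter ι}
    {n : ι → ℕ} {x : ι → ℝ} (hx : Tendsto x f atTop) (hn : Tendsto n f atTop) {v : ℝ}
    (hv : 0 < v) (hnx : Tendsto (fun i => n i * rtail F (x i)) f (𝓝 v)) :
    Tendsto (fun i => a (n i) / x i) f (𝓝 (v ^ α⁻¹)) := by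
  have hα := hF.α_pos
  have hv' : 0 < v ^ α⁻¹ := by positivity
  have hpow : ∀ b : ℝ, 0 < b → ((b⁻¹) ^ (-α)) = b ^ α := fun b hb => by
    rw [Real.rpow_neg (by positivity), Real.inv_rpow hb.le, inv_inv]
  have hvα : (v ^ α⁻¹) ^ α = v := by
    rw [← Real.rpow_mul hv.le, inv_mul_cancel₀ hα.ne', Real.rpow_one]
  refine tendsto_order.2 ⟨fun b hb => ?_, fun b hb => ?_⟩
  · rcases le_or_gt b 0 with hb0 | hb0
    · filter_upwards [hx.eventually_gt_atTop 0] with i hi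
      exact hb0.trans_lt (div_pos (by linarith [ha.one_le (n i)]) hi)
    · have h1 := (ha.tail b⁻¹ (by positivity)).comp hn
      rw [hpow b hb0] at h1
      have h2 : b ^ α < v := by
        rw [← hvα]; exact Real.rpow_lt_rpow hb0.le hb hα
      obtain ⟨m, hm1, hm2⟩ := exists_between h2
      filter_upwards [hx.eventually_gt_atTop 0, h1.eventually (gt_mem_nhds hm1),
        hnx.eventually (lt_mem_nhds hm2)] with i hi h3 h4
      by_contra! hle
      rw [div_le_iff₀ hi] at hle
      have h5 : b⁻¹ * a (n i) ≤ x i := by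
        rw [inv_mul_le_iff₀ hb0]; exact hle
      have h6 := mul_le_mul_of_nonneg_left (rtail_antitone F h5) (Nat.cast_nonneg (α := ℝ) (n i))
      simp only [Function.comp] at h3
      linarith
  · have hb0 : 0 < b := hv'.trans hb
    have h1 := (ha.tail b⁻¹ (by positivity)).comp hn
    rw [hpow b hb0] at h1
    have h2 : v < b ^ α := by
      rw [← hvα]; exact Real.rpow_lt_rpow hv'.le hb hα
    obtain ⟨m, hm1, hm2⟩ := exists_between h2
    filter_upwards [hx.eventually_gt_atTop 0, h1.eventually (lt_mem_nhds hm2),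
      hnx.eventually (gt_mem_nhds hm1)] with i hi h3 h4
    by_contra! hle
    rw [le_div_iff₀ hi] at hle
    have h5 : x i ≤ b⁻¹ * a (n i) := by
      rw [le_inv_mul_iff₀ hb0]; exact hle
    have h6 := mul_le_mul_of_nonneg_left (rtail_antitone F h5) (Nat.cast_nonneg (α := ℝ) (n i))
    simp only [Function.comp] at h3
    linarith

end Scale

section CharFun

variable {F : Measure ℝ} [IsProbabilityMeasure F] {α : ℝ} {a : ℕ → ℝ}

lemma integrable_cos (t θ : ℝ) : Integrable (fun x => cos (t * x - θ)) F :=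
  Integrable.of_bound (by fun_prop) 1 (ae_of_all _ fun x => abs_cos_le_one _)

lemma integral_cos_eq (t θ : ℝ) :
    ∫ x, cos (t * x - θ) ∂F = (charFun F t * Complex.exp (-(θ * Complex.I))).re := by
  rw [charFun_apply_real, ← integral_mul_const, ← RCLike.re_eq_complex_re, ← integral_re]
  · congr 1 with x
    rw [← Complex.exp_add, RCLike.re_eq_complex_re,
      show (t * x * Complex.I + -(θ * Complex.I) : ℂ) = ((t * x - θ : ℝ) : ℂ) * Complex.I by
        push_cast; ring, Complex.exp_ofReal_mul_I_re]
  · refine Integrable.of_bound (by fun_prop) 1 (ae_of_all _ fun x => ?_)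
    rw [← Complex.exp_add,
      show (t * x * Complex.I + -(θ * Complex.I) : ℂ) = ((t * x - θ : ℝ) : ℂ) * Complex.I by
        push_cast; ring, Complex.norm_exp_ofReal_mul_I]

lemma integral_cos_le (t θ : ℝ) : ∫ x, cos (t * x - θ) ∂F ≤ ‖charFun F t‖ := by
  rw [integral_cos_eq]
  refine (Complex.re_le_norm _).trans ?_
  rw [norm_mul, show (-(θ * Complex.I) : ℂ) = ((-θ : ℝ) : ℂ) * Complex.I by push_cast; ring,
    Complex.norm_exp_ofReal_mul_I, mul_one]

lemma integral_cos_arg (t : ℝ) :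
    ∫ x, cos (t * x - (charFun F t).arg) ∂F = ‖charFun F t‖ := by
  have h : charFun F t * Complex.exp (-((charFun F t).arg * Complex.I)) = ‖charFun F t‖ := by
    rw [Complex.exp_neg, ← div_eq_mul_inv, div_eq_iff (Complex.exp_ne_zero _),
      Complex.norm_mul_exp_arg_mul_I]
  rw [integral_cos_eq, h, Complex.ofReal_re]

lemma one_sub_norm_charFun_sub_le (t u : ℝ) :
    1 - ‖charFun F (t - u)‖ ≤ 2 * (1 - ‖charFun F t‖) + 2 * (1 - ‖charFun F u‖) := by
  set θ := (charFun F t).arg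
  set η := (charFun F u).arg
  have h1 : ∫ x, cos (t * x - θ) ∂F = ‖charFun F t‖ := integral_cos_arg t
  have h2 : ∫ x, cos (u * x - η) ∂F = ‖charFun F u‖ := integral_cos_arg u
  have h3 : ∫ x, cos ((t - u) * x - (θ - η)) ∂F ≤ ‖charFun F (t - u)‖ := integral_cos_le _ _
  have hi : Integrable (fun x => 2 * cos (t * x - θ) + 2 * cos (u * x - η)) F :=
    ((integrable_cos t θ).const_mul 2).add ((integrable_cos u η).const_mul 2)
  have h4 : ∫ x, (2 * cos (t * x - θ) + 2 * cos (u * x - η) - 3) ∂F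
      ≤ ∫ x, cos ((t - u) * x - (θ - η)) ∂F := by
    refine integral_mono (hi.sub (integrable_const 3)) (integrable_cos _ _) ?_
    intro x
    have : (t - u) * x - (θ - η) = (t * x - θ) - (u * x - η) := by ring
    simp only [this]
    generalize t * x - θ = p
    generalize u * x - η = q
    rw [cos_sub]
    nlinarith [sq_nonneg (2 - cos p - cos q), sq_nonneg (sin p + sin q), sin_sq_add_cos_sq p,
      sin_sq_add_cos_sq q]
  rw [integral_sub hi (integrable_const 3), integral_add
      ((integrable_cos t θ).const_mul 2) ((integrable_cos u η).const_mul 2),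
      integral_const_mul, integral_const_mul, h1, h2] at h4
  simp at h4
  linarith

lemma one_sub_cos_ge {y : ℝ} (h1 : 1 / 4 ≤ |y|) (h2 : |y| ≤ 2 * π - 1 / 4) :
    1 - cos (1 / 4) ≤ 1 - cos y := by
  rw [← cos_abs y]
  have hpi := pi_gt_three
  rcases le_total |y| π with h | h
  · linarith [cos_le_cos_of_nonneg_of_le_pi (by norm_num) h h1]
  · have : cos |y| = cos (2 * π - |y|) := by rw [cos_two_pi_sub]
    rw [this]
    linarith [cos_le_cos_of_nonneg_of_le_pi (x := 1 / 4) (y := 2 * π - |y|) (by norm_num)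
      (by linarith) (by linarith)]

lemma one_sub_cos_quarter_pos : 0 < 1 - cos (1 / 4) := by
  have := cos_lt_cos_of_nonneg_of_le_pi (x := 0) (y := 1 / 4) le_rfl
    (by linarith [pi_gt_three]) (by norm_num)
  rw [cos_zero] at this
  linarith

lemma one_sub_norm_charFun_ge_measure (t : ℝ) {s : Set ℝ} (hs : MeasurableSet s) {c : ℝ}
    (h : ∀ x ∈ s, c ≤ 1 - cos (t * x - (charFun F t).arg)) :
    c * F.real s ≤ 1 - ‖charFun F t‖ := by
  have h1 : 1 - ‖charFun F t‖ = ∫ x, (1 - cos (t * x - (charFun F t).arg)) ∂F := by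
    rw [integral_sub (integrable_const _) (integrable_cos _ _), integral_cos_arg]; simp
  have hi : Integrable (fun x => 1 - cos (t * x - (charFun F t).arg)) F :=
    (integrable_const _).sub (integrable_cos _ _)
  rw [h1]
  calc c * F.real s = ∫ x in s, c ∂F := by rw [setIntegral_const]; simp [mul_comm]
    _ ≤ ∫ x in s, (1 - cos (t * x - (charFun F t).arg)) ∂F :=
      setIntegral_mono_on (integrable_const _) hi.integrableOn hs h
    _ ≤ _ := setIntegral_le_integral hi (ae_of_all _ fun x => by
      simpa using cos_le_one _)

lemma RegTail.le_one_sub_norm_charFun (hF : RegTail F α) :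
    ∃ r > 0, r ≤ 1 ∧ ∃ c > 0, ∀ t, t ≠ 0 → |t| ≤ r →
      c * rtail F (1 / |t|) ≤ 1 - ‖charFun F t‖ := by
  have hα := hF.α_pos
  -- a bounded window carrying half of the mass
  obtain ⟨M, hM1, hM⟩ : ∃ M : ℝ, 1 ≤ M ∧ 1 / 2 ≤ F.real (Icc (-M) M) := by
    have h : Tendsto (fun n : ℕ => F (Icc (-(n:ℝ)) n)) atTop (𝓝 (F (⋃ n : ℕ, Icc (-(n:ℝ)) n))) :=
      tendsto_measure_iUnion_atTop (fun m n hmn => Icc_subset_Icc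
        (neg_le_neg (Nat.cast_le.2 hmn)) (Nat.cast_le.2 hmn))
    have h0 : (⋃ n : ℕ, Icc (-(n:ℝ)) n) = univ := by
      refine eq_univ_of_forall fun x => mem_iUnion.2 ?_
      obtain ⟨n, hn⟩ := exists_nat_ge |x|
      exact ⟨n, abs_le.1 hn⟩
    rw [h0, measure_univ] at h
    have h' := (ENNReal.tendsto_toReal ENNReal.one_ne_top).comp h
    obtain ⟨n, hn, hn1⟩ := ((h'.eventually (lt_mem_nhds
      (by norm_num : (1 / 2 : ℝ) < ENNReal.toReal 1))).and (eventually_ge_atTop 1)).exists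
    exact ⟨n, by exact_mod_cast hn1, hn.le⟩
  set d := (3 / 2 : ℝ) ^ (-α) - (5 / 2) ^ (-α) with hd
  have hd0 : 0 < d := sub_pos.2
    (Real.rpow_lt_rpow_of_neg (by norm_num) (by norm_num) (by linarith))
  have hlim := (hF.rv (3 / 2) (by norm_num)).sub (hF.rv (5 / 2) (by norm_num))
  obtain ⟨X, hX⟩ := eventually_atTop.1 (hlim.eventually (lt_mem_nhds (half_lt_self hd0)))
  set m := 1 - cos (1 / 4) with hm
  have hm0 : 0 < m := one_sub_cos_quarter_pos
  have hpi := pi_gt_three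
  refine ⟨1 / (4 * M + |X|), by positivity, ?_, min (m * (1 / 2)) (m * (d / 2)), by positivity, ?_⟩
  · rw [div_le_one (by positivity)]
    linarith [abs_nonneg X]
  intro t ht htr
  have ht0 : 0 < |t| := abs_pos.2 ht
  have htr' : 4 * M + |X| ≤ 1 / |t| := by
    rw [le_div_iff₀ ht0, mul_comm]
    rwa [le_div_iff₀ (by positivity)] at htr
  have hG0 := hF.pos (1 / |t|)
  have hG1 := rtail_le_one F (1 / |t|)
  set θ := (charFun F t).arg with hθ
  have hθpi : |θ| ≤ π := Complex.abs_arg_le_pi _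
  rcases le_total (1 / 2) |θ| with h | h
  · have h1 : m * F.real (Icc (-M) M) ≤ 1 - ‖charFun F t‖ := by
      refine one_sub_norm_charFun_ge_measure t measurableSet_Icc fun x hx => ?_
      have hx' : |x| ≤ M := abs_le.2 hx
      have htx : |t * x| ≤ 1 / 4 := by
        rw [abs_mul]
        have h5 : |t| * (4 * M) ≤ 1 := by
          rw [le_div_iff₀ ht0] at htr'
          nlinarith [abs_nonneg X]
        nlinarith
      have h6 := abs_sub_abs_le_abs_sub θ (t * x)
      have h7 := abs_sub (t * x) θ
      rw [abs_sub_comm] at h6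
      exact one_sub_cos_ge (by linarith) (by linarith)
    have h2 : m * (1 / 2) ≤ m * F.real (Icc (-M) M) := by gcongr
    calc _ ≤ m * (1 / 2) * rtail F (1 / |t|) := by gcongr; exact min_le_left _ _
      _ ≤ m * (1 / 2) * 1 := by gcongr
      _ ≤ _ := by linarith
  · have h1 : m * F.real (Ioc (3 / 2 * (1 / |t|)) (5 / 2 * (1 / |t|))) ≤ 1 - ‖charFun F t‖ := by
      refine one_sub_norm_charFun_ge_measure t measurableSet_Ioc fun x hx => ?_
      have hx0 : 0 < x := lt_trans (by positivity) hx.1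
      have h3 : |t * x| = |t| * x := by rw [abs_mul, abs_of_pos hx0]
      have h4 : 3 / 2 ≤ |t| * x := by
        have := hx.1
        rw [mul_one_div, div_lt_iff₀ ht0] at this
        linarith
      have h5 : |t| * x ≤ 5 / 2 := by
        have := hx.2
        rw [mul_one_div, le_div_iff₀ ht0] at this
        linarith
      have h6 := abs_sub_abs_le_abs_sub (t * x) θ
      have h7 := abs_sub (t * x) θ
      exact one_sub_cos_ge (by linarith) (by linarith)
    have h2 : F.real (Ioc (3 / 2 * (1 / |t|)) (5 / 2 * (1 / |t|))) =
        rtail F (3 / 2 * (1 / |t|)) - rtail F (5 / 2 * (1 / |t|)) := by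
      rw [← Ioi_sdiff_Ioi, measureReal_sdiff' measurableSet_Ioi]
      rw [union_eq_left.2 (Ioi_subset_Ioi (by gcongr; norm_num))]; rfl
    have h3 := hX (1 / |t|) ((le_abs_self X).trans (by linarith))
    rw [← sub_div, lt_div_iff₀ hG0] at h3
    calc _ ≤ m * (d / 2) * rtail F (1 / |t|) := by gcongr; exact min_le_right _ _
      _ = m * (d / 2 * rtail F (1 / |t|)) := by ring
      _ ≤ m * F.real (Ioc (3 / 2 * (1 / |t|)) (5 / 2 * (1 / |t|))) := by rw [h2]; gcongr
      _ ≤ _ := h1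

end CharFun

section CharFunPow

variable {F : Measure ℝ} [IsProbabilityMeasure F] {α : ℝ} {a : ℕ → ℝ}

lemma ScaleSeq.exp_neg_rtail_le (hF : RegTail F α) (ha : ScaleSeq F α a) {c : ℝ} (hc : 0 < c) :
    ∃ K > 0, ∃ κ > 0, ∀ n : ℕ, 1 ≤ n → ∀ t, |t| ≤ 1 →
      exp (-(c * (n * rtail F (1 / |t|)))) ≤ K * exp (-κ * |a n * t| ^ (α / 2)) := by
  have hα := hF.α_pos
  obtain ⟨C, hC, htb⟩ := ha.tail_bounds hF
  obtain ⟨D, hD, hpot⟩ := hF.upper (β := α / 2) (by linarith) (by linarith)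
  set κ := c / (C * D) with hκ
  have hκ0 : 0 < κ := by positivity
  refine ⟨exp κ, exp_pos _, κ, hκ0, fun n hn t ht => ?_⟩
  rw [← Real.exp_add, Real.exp_le_exp, abs_mul, abs_of_pos (lt_of_lt_of_le one_pos (ha.one_le n))]
  have hG := hF.pos (1 / |t|)
  have ha1 := ha.one_le n
  rcases le_total (a n * |t|) 1 with h | h
  · have h1 : (a n * |t|) ^ (α / 2) ≤ 1 := Real.rpow_le_one (by positivity) h (by linarith)
    have h2 : 0 ≤ c * (n * rtail F (1 / |t|)) := by positivity
    nlinarith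
  · have ht0 : 0 < |t| := by
      rcases (abs_nonneg t).eq_or_lt with h0 | h0
      · rw [← h0] at h; simp at h; linarith
      · exact h0
    have h1 : 1 / |t| ≤ a n := by rwa [div_le_iff₀ ht0]
    have h2 := hpot (1 / |t|) (a n) ((one_le_div ht0).2 ht) h1
    rw [div_div_eq_mul_div, div_one] at h2
    have h3 := (htb n hn).1
    set w := (a n * |t|) with hw
    have hw0 : 0 < w := by linarith
    have h4 : w ^ (α / 2) ≤ C * D * (n * rtail F (1 / |t|)) := by
      have h5 : 1 ≤ C * (n * (D * w ^ (-(α / 2)) * rtail F (1 / |t|))) := h3.trans (by gcongr)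
      rw [Real.rpow_neg hw0.le] at h5
      have h6 : 0 < w ^ (α / 2) := by positivity
      calc w ^ (α / 2) = w ^ (α / 2) * 1 := by ring
        _ ≤ w ^ (α / 2) * (C * (n * (D * (w ^ (α / 2))⁻¹ * rtail F (1 / |t|)))) := by gcongr
        _ = _ := by field_simp
    have h7 : κ * w ^ (α / 2) ≤ c * (n * rtail F (1 / |t|)) := by
      rw [hκ, div_mul_eq_mul_div, div_le_iff₀ (by positivity)]
      nlinarith
    nlinarith

lemma ScaleSeq.norm_charFun_pow_le (hF : RegTail F α) (ha : ScaleSeq F α a) :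
    ∃ r > 0, r ≤ 1 ∧ ∃ K > 0, ∃ κ > 0, ∀ n : ℕ, 1 ≤ n → ∀ t u, |t - u| ≤ r →
      ‖charFun F t‖ ≤ ‖charFun F u‖ →
        ‖charFun F t‖ ^ n ≤ K * exp (-κ * |a n * (t - u)| ^ (α / 2)) := by
  obtain ⟨r, hr, hr1, c, hc, hb⟩ := hF.le_one_sub_norm_charFun
  obtain ⟨K, hK, κ, hκ, hexp⟩ := ha.exp_neg_rtail_le hF (c := c / 4) (by positivity)
  refine ⟨r, hr, hr1, max K 1, by positivity, κ, hκ, fun n hn t u htu hle => ?_⟩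
  rcases eq_or_ne (t - u) 0 with h0 | h0
  · have hα := hF.α_pos
    rw [h0, mul_zero, abs_zero, Real.zero_rpow (by positivity), mul_zero, Real.exp_zero, mul_one]
    exact (pow_le_one₀ (norm_nonneg _) (norm_charFun_le_one _)).trans (le_max_right _ _)
  have h1 := hb _ h0 htu
  have h2 := one_sub_norm_charFun_sub_le (F := F) t u
  have h3 : ‖charFun F t‖ ≤ exp (-(c / 4 * rtail F (1 / |t - u|))) := by
    refine le_trans ?_ (Real.add_one_le_exp _)
    linarith
  calc ‖charFun F t‖ ^ n ≤ exp (-(c / 4 * rtail F (1 / |t - u|))) ^ n := by gcongr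
    _ = exp (-(c / 4 * (n * rtail F (1 / |t - u|)))) := by
      rw [← Real.exp_nat_mul]; ring_nf
    _ ≤ K * exp (-κ * |a n * (t - u)| ^ (α / 2)) := hexp n hn _ (htu.trans hr1)
    _ ≤ _ := by gcongr; exact le_max_left _ _

lemma integrable_exp_neg_abs_rpow {κ p : ℝ} (hκ : 0 < κ) (hp : 0 < p) :
    Integrable fun w : ℝ => exp (-κ * |w| ^ p) := by
  have h := integrableOn_rpow_mul_exp_neg_mul_rpow (s := 0) (by norm_num) hp hκ
  simp only [Real.rpow_zero, one_mul] at h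
  have h' : IntegrableOn (fun w : ℝ => exp (-κ * |w| ^ p)) (Ioi 0) :=
    h.congr_fun (fun x hx => by simp only [abs_of_pos (mem_Ioi.1 hx)]) measurableSet_Ioi
  have h'' : IntegrableOn (fun w : ℝ => exp (-κ * |w| ^ p)) (Iic 0) := by
    have h3 : IntegrableOn (fun w : ℝ => exp (-κ * |w| ^ p)) (Ici (-0)) := by
      rwa [neg_zero, integrableOn_Ici_iff_integrableOn_Ioi]
    simpa only [abs_neg] using h3.comp_neg_Iic
  rw [← integrableOn_univ, ← Iic_union_Ioi (a := (0:ℝ))]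
  exact h''.union h'

/-- Integrals of `|φ|^n` over windows of fixed length are `O(1 / aₙ)`, uniformly in the window. -/
lemma ScaleSeq.integral_norm_charFun_pow_le (hF : RegTail F α) (ha : ScaleSeq F α a) (L : ℝ) :
    ∃ C > 0, ∀ n : ℕ, 1 ≤ n → ∀ u, ∫ t in u..(u + L), ‖charFun F t‖ ^ n ≤ C / a n := by
  have hα := hF.α_pos
  obtain ⟨r, hr, -, K, hK, κ, hκ, hb⟩ := ha.norm_charFun_pow_le hF
  set S := ∫ w : ℝ, exp (-κ * |w| ^ (α / 2)) with hS
  have hS0 : 0 ≤ S := integral_nonneg fun w => (exp_pos _).le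
  have hInt := integrable_exp_neg_abs_rpow hκ (half_pos hα)
  have hcont : Continuous (charFun F) := continuous_charFun
  have hii : ∀ n u v, IntervalIntegrable (fun t => ‖charFun F t‖ ^ n) volume u v := fun n u v =>
    (hcont.norm.pow n).intervalIntegrable _ _
  have hone : ∀ n : ℕ, 1 ≤ n → ∀ u, ∫ t in u..(u + r), ‖charFun F t‖ ^ n ≤ K * S / a n := by
    intro n hn u
    have ha0 : 0 < a n := lt_of_lt_of_le one_pos (ha.one_le n)
    obtain ⟨m, hm, hmax⟩ := isCompact_Icc.exists_isMaxOn (nonempty_Icc.2 (by linarith : u ≤ u + r))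
      hcont.norm.continuousOn
    have hcomp : Integrable fun t : ℝ => exp (-κ * |a n * (t - m)| ^ (α / 2)) :=
      (hInt.comp_mul_left' ha0.ne').comp_sub_right m
    calc ∫ t in u..(u + r), ‖charFun F t‖ ^ n
        ≤ ∫ t in u..(u + r), K * exp (-κ * |a n * (t - m)| ^ (α / 2)) := by
          refine intervalIntegral.integral_mono_on (by linarith) (hii _ _ _)
            (hcomp.const_mul K).intervalIntegrable fun t ht => hb n hn t m ?_ (hmax ht)
          rw [abs_le]; constructor <;> linarith [hm.1, hm.2, ht.1, ht.2]
      _ ≤ ∫ t, K * exp (-κ * |a n * (t - m)| ^ (α / 2)) := by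
          rw [intervalIntegral.integral_of_le (by linarith)]
          exact setIntegral_le_integral (hcomp.const_mul K) (ae_of_all _ fun t => by positivity)
      _ = K * S / a n := by
          rw [integral_const_mul, integral_sub_right_eq_self
            (fun t => exp (-κ * |a n * t| ^ (α / 2))) m,
            Measure.integral_comp_mul_left (fun w => exp (-κ * |w| ^ (α / 2)))]
          rw [abs_of_pos (by positivity), smul_eq_mul, ← hS]; ring
  have hmany : ∀ n : ℕ, 1 ≤ n → ∀ k : ℕ, ∀ u,
      ∫ t in u..(u + k * r), ‖charFun F t‖ ^ n ≤ k * (K * S / a n) := by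
    intro n hn k
    induction k with
    | zero => intro u; simp
    | succ k ih =>
      intro u
      rw [← intervalIntegral.integral_add_adjacent_intervals (hii n u (u + k * r)) (hii n _ _)]
      have h1 := ih u
      have h2 := hone n hn (u + k * r)
      rw [show u + k * r + r = u + (k + 1 : ℕ) * r by push_cast; ring] at h2
      push_cast at *
      linarith
  obtain ⟨k, hk⟩ := exists_nat_ge (|L| / r)
  refine ⟨k * (K * S) + 1, by positivity, fun n hn u => ?_⟩
  have ha0 : 0 < a n := lt_of_lt_of_le one_pos (ha.one_le n)
  rw [div_le_iff₀ hr] at hk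
  have h1 := hmany n hn k u
  have h2 : ∫ t in u..(u + L), ‖charFun F t‖ ^ n ≤ ∫ t in u..(u + k * r), ‖charFun F t‖ ^ n := by
    rcases le_total 0 L with hL | hL
    · rw [abs_of_nonneg hL] at hk
      exact intervalIntegral.integral_mono_interval le_rfl (by linarith) (by linarith)
        (ae_of_all _ fun t => by positivity) (hii _ _ _)
    · have h3 : 0 ≤ ∫ t in (u + L)..u, ‖charFun F t‖ ^ n :=
        intervalIntegral.integral_nonneg (by linarith) fun t _ => by positivity
      rw [intervalIntegral.integral_symm]
      refine (neg_nonpos.2 h3).trans (intervalIntegral.integral_nonneg ?_ fun t _ => by positivity)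
      have : 0 ≤ k * r := by positivity
      linarith
  refine h2.trans (h1.trans ?_)
  rw [← mul_div_assoc]
  gcongr
  linarith

end CharFunPow

section Kernel

/-- The trigonometric transform `K(y) = ∫ k(t) e^{ity} dt`. -/
def kern (k : ℝ → ℂ) (y : ℝ) : ℂ := ∫ t, k t * Complex.exp (t * y * Complex.I)

lemma integral_kern {k : ℝ → ℂ} (hk : Integrable k) (μ : Measure ℝ) [IsFiniteMeasure μ] (z : ℝ) :
    ∫ y, kern k (y - z) ∂μ = ∫ t, k t * Complex.exp (-(t * z * Complex.I)) * charFun μ t := by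
  simp only [kern, charFun_apply_real]
  rw [integral_integral_swap]
  · congr 1 with t
    rw [← integral_const_mul]
    congr 1 with y
    rw [mul_assoc (k t), ← Complex.exp_add]
    push_cast
    ring_nf
  · have h1 : Integrable (fun p : ℝ × ℝ => k p.2) (μ.prod volume) := hk.comp_snd μ
    refine h1.mul_bdd (c := 1) (by fun_prop) (ae_of_all _ fun p => ?_)
    rw [← Complex.ofReal_mul, Complex.norm_exp_ofReal_mul_I]

/-- The triangular function supported by `[-B, B]`. -/
def tri (B t : ℝ) : ℝ := max (1 - |t| / B) 0

lemma continuous_tri (B : ℝ) : Continuous (tri B) := by unfold tri; fun_prop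

lemma tri_nonneg (B t : ℝ) : 0 ≤ tri B t := le_max_right _ _

lemma tri_le_one {B : ℝ} (hB : 0 < B) (t : ℝ) : tri B t ≤ 1 :=
  max_le (by have : 0 ≤ |t| / B := by positivity
             linarith) zero_le_one

lemma tri_eq_zero {B t : ℝ} (hB : 0 < B) (ht : B ≤ |t|) : tri B t = 0 := by
  unfold tri
  exact max_eq_right (sub_nonpos.2 ((one_le_div hB).2 ht))

lemma tri_of_abs_le {B t : ℝ} (hB : 0 < B) (ht : |t| ≤ B) : tri B t = 1 - |t| / B := by
  unfold tri
  exact max_eq_left (sub_nonneg.2 ((div_le_one hB).2 ht))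

lemma integrable_tri {B : ℝ} (hB : 0 < B) : Integrable (tri B) := by
  refine (continuous_tri B).integrable_of_hasCompactSupport
    (HasCompactSupport.intro (isCompact_Icc (a := -B) (b := B)) fun t ht => tri_eq_zero hB ?_)
  by_contra h
  exact ht (abs_le.1 (not_le.1 h).le)

/-- The Fejér kernel. -/
def fejer (B y : ℝ) : ℝ := ∫ t, tri B t * cos (t * y)

lemma kern_tri {B : ℝ} (hB : 0 < B) (y : ℝ) : kern (fun t => (tri B t : ℂ)) y = fejer B y := by
  have hInt : ∀ t, ‖(tri B t : ℂ) * Complex.exp (t * y * Complex.I)‖ ≤ tri B t := fun t => by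
    rw [norm_mul, ← Complex.ofReal_mul, Complex.norm_exp_ofReal_mul_I, mul_one,
      Complex.norm_real, Real.norm_of_nonneg (tri_nonneg _ _)]
  have hc := continuous_tri B
  have hi : Integrable fun t => (tri B t : ℂ) * Complex.exp (t * y * Complex.I) :=
    (integrable_tri hB).mono' (by fun_prop) (ae_of_all _ hInt)
  have hodd : ∫ t, tri B t * sin (t * y) = 0 := by
    have h := integral_neg_eq_self (fun t => tri B t * sin (t * y)) volume
    have h2 : (fun t => tri B (-t) * sin (-t * y)) = fun t => -(tri B t * sin (t * y)) := by
      ext t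
      simp [tri, neg_mul, sin_neg]
    rw [h2, integral_neg] at h
    linarith
  unfold kern fejer
  apply Complex.ext
  · rw [Complex.ofReal_re, ← RCLike.re_eq_complex_re, ← integral_re hi]
    congr 1 with t
    rw [RCLike.re_eq_complex_re, Complex.re_ofReal_mul, ← Complex.ofReal_mul,
      Complex.exp_ofReal_mul_I_re]
  · rw [Complex.ofReal_im, ← RCLike.im_eq_complex_im, ← integral_im hi, ← hodd]
    congr 1 with t
    rw [RCLike.im_eq_complex_im, Complex.im_ofReal_mul, ← Complex.ofReal_mul,
      Complex.exp_ofReal_mul_I_im]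

lemma fejer_eq {B : ℝ} (hB : 0 < B) {y : ℝ} (hy : y ≠ 0) :
    fejer B y = 2 * (1 - cos (B * y)) / (B * y ^ 2) := by
  have h0 : fejer B y = 2 * ∫ t in Ioi (0:ℝ), tri B t * cos (t * y) := by
    rw [fejer, ← integral_comp_abs (f := fun t => tri B t * cos (t * y))]
    congr 1 with t
    congr 1
    · simp [tri]
    · rcases abs_choice t with h | h <;> rw [h]
      rw [neg_mul, cos_neg]
  have h1 : ∫ t in Ioi (0:ℝ), tri B t * cos (t * y) = ∫ t in (0:ℝ)..B, (1 - t / B) * cos (t * y) := by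
    rw [intervalIntegral.integral_of_le hB.le, ← Ioc_union_Ioi_eq_Ioi hB.le,
      setIntegral_union (Ioc_disjoint_Ioi le_rfl) measurableSet_Ioi]
    · rw [setIntegral_eq_zero_of_forall_eq_zero (t := Ioi B), add_zero]
      · refine setIntegral_congr_fun measurableSet_Ioc fun t ht => ?_
        rw [tri_of_abs_le hB (by rw [abs_of_pos ht.1]; exact ht.2), abs_of_pos ht.1]
      · intro t ht
        rw [tri_eq_zero hB (by rw [abs_of_pos (hB.trans ht)]; exact (mem_Ioi.1 ht).le), zero_mul]
    all_goals
      refine Integrable.integrableOn ?_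
      exact (integrable_tri hB).mul_bdd (c := 1) (by fun_prop)
        (ae_of_all _ fun t => abs_cos_le_one _)
  have h2 : ∫ t in (0:ℝ)..B, (1 - t / B) * cos (t * y) =
      ((1 - B / B) * (sin (B * y) / y) - cos (B * y) / (B * y ^ 2)) -
      ((1 - 0 / B) * (sin (0 * y) / y) - cos (0 * y) / (B * y ^ 2)) := by
    refine intervalIntegral.integral_eq_sub_of_hasDerivAt
      (f := fun t => (1 - t / B) * (sin (t * y) / y) - cos (t * y) / (B * y ^ 2)) (fun t _ => ?_)
      (Continuous.intervalIntegrable (by fun_prop) _ _)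
    have d1 : HasDerivAt (fun t : ℝ => t * y) y t := by simpa using (hasDerivAt_id t).mul_const y
    have d2 : HasDerivAt (fun t : ℝ => 1 - t / B) (-(1 / B)) t := by
      simpa using ((hasDerivAt_id t).div_const B).const_sub 1
    have d3 := (d2.mul (d1.sin.div_const y)).sub (d1.cos.div_const (B * y ^ 2))
    refine d3.congr_deriv ?_
    field_simp
    ring
  rw [h0, h1, h2]
  field_simp
  simp
  ring

lemma fejer_nonneg {B : ℝ} (hB : 0 < B) (y : ℝ) : 0 ≤ fejer B y := by
  rcases eq_or_ne y 0 with rfl | hy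
  · exact integral_nonneg fun t => by simpa using tri_nonneg B t
  · rw [fejer_eq hB hy]
    have := cos_le_one (B * y)
    apply div_nonneg <;> [linarith; positivity]

lemma continuous_fejer {B : ℝ} (hB : 0 < B) : Continuous (fejer B) := by
  refine continuous_of_dominated (bound := tri B) (fun y => ?_) (fun y => ae_of_all _ fun t => ?_)
    (integrable_tri hB) (ae_of_all _ fun t => by fun_prop)
  · exact ((continuous_tri B).mul (by fun_prop)).aestronglyMeasurable
  · rw [norm_mul, Real.norm_of_nonneg (tri_nonneg _ _)]
    exact mul_le_of_le_one_right (tri_nonneg _ _) (abs_cos_le_one _)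

lemma le_fejer {B : ℝ} (hB : 0 < B) {y : ℝ} (hy : |B * y| ≤ π) : 4 * B / π ^ 2 ≤ fejer B y := by
  have key : ∀ y : ℝ, y ≠ 0 → |B * y| ≤ π → 4 * B / π ^ 2 ≤ fejer B y := by
    intro y h0 hy
    have hpi := pi_pos
    rw [fejer_eq hB h0, div_le_div_iff₀ (by positivity) (by positivity)]
    have h := cos_le_one_sub_mul_cos_sq hy
    have h3 : 2 / π ^ 2 * (B * y) ^ 2 * π ^ 2 = 2 * (B * y) ^ 2 := by field_simp
    nlinarith [sq_nonneg π]
  rcases eq_or_ne y 0 with rfl | h0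
  · refine ge_of_tendsto (x := 𝓝[≠] (0:ℝ)) ((continuous_fejer hB).tendsto 0 |>.mono_left
      nhdsWithin_le_nhds) ?_
    have h1 : ∀ᶠ y in 𝓝[≠] (0:ℝ), |B * y| < π := by
      refine eventually_nhdsWithin_of_eventually_nhds ?_
      have : Tendsto (fun y : ℝ => |B * y|) (𝓝 0) (𝓝 |B * 0|) :=
        (by fun_prop : Continuous fun y : ℝ => |B * y|).tendsto 0
      exact this.eventually (gt_mem_nhds (by simpa using pi_pos))
    filter_upwards [h1, self_mem_nhdsWithin] with y h2 h3 using key y h3 h2.le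
  · exact key y h0 hy

lemma integral_fejer {B : ℝ} (hB : 0 < B) (μ : Measure ℝ) [IsFiniteMeasure μ] (z : ℝ) :
    ((∫ y, fejer B (y - z) ∂μ : ℝ) : ℂ) =
      ∫ t, (tri B t : ℂ) * Complex.exp (-(t * z * Complex.I)) * charFun μ t := by
  have hi : Integrable fun t => (tri B t : ℂ) := (integrable_tri hB).ofReal
  rw [← integral_kern hi μ z, ← integral_complex_ofReal]
  congr 1 with y
  rw [kern_tri hB]

end Kernel

section Concentration

variable {F : Measure ℝ} [IsProbabilityMeasure F] {α : ℝ} {a : ℕ → ℝ}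

/-- Concentration function bound for the `n`-fold convolution. -/
lemma ScaleSeq.convPow_Ioc_le (hF : RegTail F α) (ha : ScaleSeq F α a) {h : ℝ} (hh : 0 < h) :
    ∃ C > 0, ∀ (n : ℕ) z, convPow F n (Ioc z (z + h)) ≤ ENNReal.ofReal (C / a n) := by
  set B := π / h with hBdef
  have hpi := pi_pos
  have hB : 0 < B := by positivity
  obtain ⟨C, hC, hCb'⟩ := ha.integral_norm_charFun_pow_le hF (2 * B)
  have hCb : ∀ n : ℕ, 1 ≤ n → ∫ t in (-B)..B, ‖charFun F t‖ ^ n ≤ C / a n := fun n hn => by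
    simpa [show -B + 2 * B = B by ring] using hCb' n hn (-B)
  refine ⟨max (C * (π ^ 2 / (4 * B))) (a 0), by positivity, fun n z => ?_⟩
  have ha0 : 0 < a n := lt_of_lt_of_le one_pos (ha.one_le n)
  rcases Nat.eq_zero_or_pos n with rfl | hn
  · refine prob_le_one.trans ?_
    rw [← ENNReal.ofReal_one]
    exact ENNReal.ofReal_le_ofReal ((one_le_div ha0).2 (le_max_right _ _))
  have hcont : Continuous (charFun F) := continuous_charFun
  have h1 : ∫ y, fejer B (y - z) ∂convPow F n ≤ C / a n := by
    refine le_trans ?_ (hCb n hn)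
    have h2 := integral_fejer hB (convPow F n) z
    have h3 : ‖((∫ y, fejer B (y - z) ∂convPow F n : ℝ) : ℂ)‖ ≤
        ∫ t in (-B)..B, ‖charFun F t‖ ^ n := by
      rw [h2]
      have h4 : ∀ t : ℝ, t ∉ Ioc (-B) B → (tri B t : ℂ) * Complex.exp (-(t * z * Complex.I)) *
          charFun (convPow F n) t = 0 := fun t ht => by
        rw [tri_eq_zero hB]
        · simp
        · by_contra hlt
          have := abs_lt.1 (not_le.1 hlt)
          exact ht ⟨this.1, this.2.le⟩
      rw [← setIntegral_eq_integral_of_forall_compl_eq_zero h4,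
        intervalIntegral.integral_of_le (by linarith)]
      refine norm_integral_le_of_norm_le ?_ (ae_of_all _ fun t => ?_)
      · exact ((hcont.norm.pow n).intervalIntegrable (-B) B).1
      · rw [norm_mul, norm_mul, charFun_convPow, norm_pow, Complex.norm_real,
          Real.norm_of_nonneg (tri_nonneg _ _),
          show (-(t * z * Complex.I) : ℂ) = ((-(t * z) : ℝ) : ℂ) * Complex.I by push_cast; ring,
          Complex.norm_exp_ofReal_mul_I, mul_one]
        exact mul_le_of_le_one_left (by positivity) (tri_le_one hB t)
    exact (le_abs_self _).trans (by rwa [Complex.norm_real] at h3)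
  have hbd : ∀ y, fejer B y ≤ fejer B 0 := fun y => by
    unfold fejer
    refine integral_mono ((integrable_tri hB).mul_bdd (c := 1) (by fun_prop)
      (ae_of_all _ fun t => abs_cos_le_one _)) ?_ fun t => ?_
    · simpa using integrable_tri hB
    · simpa using mul_le_of_le_one_right (tri_nonneg B t) (cos_le_one _)
  have hci := continuous_fejer hB
  have hInt : Integrable (fun y => fejer B (y - z)) (convPow F n) :=
    Integrable.of_bound (by fun_prop) (fejer B 0) (ae_of_all _ fun y => by
      rw [Real.norm_of_nonneg (fejer_nonneg hB _)]; exact hbd _)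
  have h5 : 4 * B / π ^ 2 * (convPow F n).real (Ioc z (z + h)) ≤ ∫ y, fejer B (y - z) ∂convPow F n := by
    calc _ = ∫ y in Ioc z (z + h), 4 * B / π ^ 2 ∂convPow F n := by
          rw [setIntegral_const]; simp [mul_comm]
      _ ≤ ∫ y in Ioc z (z + h), fejer B (y - z) ∂convPow F n := by
          refine setIntegral_mono_on (integrable_const _) hInt.integrableOn measurableSet_Ioc
            fun y hy => le_fejer hB ?_
          rw [abs_of_nonneg (mul_nonneg hB.le (by linarith [hy.1]))]
          calc B * (y - z) ≤ B * h := by gcongr; linarith [hy.2]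
            _ = π := by rw [hBdef]; field_simp
      _ ≤ _ := setIntegral_le_integral hInt (ae_of_all _ fun y => fejer_nonneg hB _)
  rw [← ENNReal.ofReal_toReal (measure_ne_top (convPow F n) _)]
  refine ENNReal.ofReal_le_ofReal ?_
  change (convPow F n).real _ ≤ _
  have h6 : (convPow F n).real (Ioc z (z + h)) ≤ C * (π ^ 2 / (4 * B)) / a n := by
    have h7 := h5.trans h1
    calc (convPow F n).real (Ioc z (z + h))
        = π ^ 2 / (4 * B) * (4 * B / π ^ 2 * (convPow F n).real (Ioc z (z + h))) := by field_simp
      _ ≤ π ^ 2 / (4 * B) * (C / a n) := by gcongr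
      _ = _ := by ring
  refine h6.trans ?_
  gcongr
  exact le_max_left _ _

end Concentration

section Density

variable {F : Measure ℝ} [IsProbabilityMeasure F] {α : ℝ}

lemma mul_measure_Ioc_le_lintegral (F : Measure ℝ) [IsProbabilityMeasure F] (h z L : ℝ) :
    ENNReal.ofReal h * F (Ioc z (z + L)) ≤
      ∫⁻ y in Ioo (z - h) (z + L), F (Ioc y (y + h)) := by
  have h1 : ∀ y, F (Ioc y (y + h)) = ∫⁻ u, (Ico (u - h) u).indicator 1 y ∂F := fun y => by
    rw [← lintegral_indicator_one measurableSet_Ioc]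
    congr 1 with u
    simp only [indicator, mem_Ioc, mem_Ico, sub_le_iff_le_add]
    congr 1
    exact propext and_comm
  have hm : Measurable (Function.uncurry fun y u : ℝ => (Ico (u - h) u).indicator (1 : ℝ → ℝ≥0∞) y) := by
    have : (Function.uncurry fun y u : ℝ => (Ico (u - h) u).indicator (1 : ℝ → ℝ≥0∞) y) =
        ({p : ℝ × ℝ | p.2 - h ≤ p.1} ∩ {p | p.1 < p.2}).indicator 1 := by
      ext p
      simp [Function.uncurry, indicator]
    rw [this]
    exact measurable_one.indicator ((measurableSet_le (by fun_prop) (by fun_prop)).inter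
      (measurableSet_lt (by fun_prop) (by fun_prop)))
  simp only [h1]
  rw [lintegral_lintegral_swap hm.aemeasurable]
  calc ENNReal.ofReal h * F (Ioc z (z + L)) = ∫⁻ u in Ioc z (z + L), ENNReal.ofReal h ∂F := by
        rw [setLIntegral_const]
    _ ≤ ∫⁻ u in Ioc z (z + L),
          ∫⁻ y in Ioo (z - h) (z + L), (Ico (u - h) u).indicator 1 y ∂volume ∂F := by
        refine setLIntegral_mono' measurableSet_Ioc fun u hu => ?_
        rw [lintegral_indicator_one measurableSet_Ico, Measure.restrict_apply measurableSet_Ico,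
          inter_eq_left.2, Real.volume_Ico]
        · simp
        · intro y hy
          exact ⟨by linarith [hy.1, hu.1], by linarith [hy.2, hu.2]⟩
    _ ≤ _ := setLIntegral_le_lintegral _ _

/-- The density condition on `{ω > T}` controls the mass of intervals of length at least `z^s`. -/
lemma RegTail.measure_Ioc_le (hF : RegTail F α) {h c s T : ℝ} (hh : 0 < h) (hc : 0 < c)
    (hcs : c ≤ s) (hT : 0 ≤ T)
    (hω : (fun x => omegaFn F h x) =O[atTop] fun x => x ^ c)
    (hE : DensityAtScale {x : ℝ | 0 ≤ x ∧ T < omegaFn F h x} c s) :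
    ∃ C > 0, ∃ x₀, 1 ≤ x₀ ∧ ∀ z, x₀ ≤ z → ∀ L,
      F.real (Ioc z (z + L)) ≤ C * max L (z ^ s) * (rtail F z / z) := by
  obtain ⟨K, hK, hb⟩ := hω.exists_pos
  obtain ⟨X, hX⟩ := eventually_atTop.1 hb.bound
  obtain ⟨D, x₁, hD⟩ := hE
  obtain ⟨P, hP, hpot⟩ := hF.lower (β := 1) (by linarith [hF.α_le])
  set E := {x : ℝ | 0 ≤ x ∧ T < omegaFn F h x} with hEdef
  set M := T + K * 4 ^ c * |D| with hM
  have hM0 : 0 ≤ M := by positivity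
  refine ⟨max 1 (4 * P * M * (1 + h) / h), by positivity, max (max (|X| + h) (|x₁| + h)) (2 + 2 * h),
    (by linarith : (1:ℝ) ≤ 2 + 2 * h).trans (le_max_right _ _), fun z hz L => ?_⟩
  have hz1 : |X| + h ≤ z := ((le_max_left _ _).trans (le_max_left _ _)).trans hz
  have hz2 : |x₁| + h ≤ z := ((le_max_right _ _).trans (le_max_left _ _)).trans hz
  have hz3 : 2 + 2 * h ≤ z := (le_max_right _ _).trans hz
  have hz0 : 0 < z := by linarith
  have hGz := hF.pos z
  set V := max L (z ^ s) with hV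
  have hzs : 1 ≤ z ^ s := Real.one_le_rpow (by linarith) (by linarith)
  have hV1 : 1 ≤ V := hzs.trans (le_max_right _ _)
  have hmono : F.real (Ioc z (z + L)) ≤ F.real (Ioc z (z + V)) :=
    measureReal_mono (Ioc_subset_Ioc_right (by linarith [le_max_left L (z ^ s)]))
  refine hmono.trans ?_
  rcases le_total z V with hzV | hVz
  · calc F.real (Ioc z (z + V)) ≤ rtail F z := measureReal_mono Ioc_subset_Ioi_self
      _ ≤ 1 * V * (rtail F z / z) := by
        rw [one_mul, mul_div_assoc', le_div_iff₀ hz0, mul_comm]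
        gcongr
      _ ≤ _ := by gcongr; exact le_max_left _ _
  set w := z - h with hw
  have hwz : z / 2 ≤ w := by linarith
  have hw0 : 1 ≤ w := by linarith
  have hXw : X ≤ w := by linarith [le_abs_self X]
  have hxw : x₁ ≤ w := by linarith [le_abs_self x₁]
  have hGw := hF.pos w
  set R := rtail F w / w with hR
  have hR0 : 0 < R := by positivity
  have hbound : ∀ y ∈ Ioo w (z + V), F (Ioc y (y + h)) ≤
      ENNReal.ofReal (R * T) + E.indicator (fun _ => ENNReal.ofReal (R * (K * 4 ^ c * w ^ c))) y := by
    intro y hy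
    have hy0 : 0 < y := by linarith [hy.1]
    have hGy := hF.pos y
    have hmeas : (F (Ioc y (y + h))).toReal = omegaFn F h y * (rtail F y / y) := by
      unfold omegaFn; field_simp
    have hRy : rtail F y / y ≤ R := by
      rw [hR]; gcongr
      · exact rtail_antitone F hy.1.le
      · exact hy.1.le
    rw [← ENNReal.ofReal_toReal (measure_ne_top F _), hmeas]
    by_cases hyE : y ∈ E
    · rw [indicator_of_mem hyE]
      refine le_trans (ENNReal.ofReal_le_ofReal ?_) le_add_self
      have h1 := hX y (hXw.trans hy.1.le)
      rw [Real.norm_eq_abs, Real.norm_of_nonneg (by positivity)] at h1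
      have h2 : y ^ c ≤ 4 ^ c * w ^ c := by
        rw [← Real.mul_rpow (by norm_num) (by linarith)]
        exact Real.rpow_le_rpow hy0.le (by linarith [hy.2]) hc.le
      calc omegaFn F h y * (rtail F y / y) ≤ (K * y ^ c) * R :=
            mul_le_mul ((le_abs_self _).trans h1) hRy (by positivity) (by positivity)
        _ ≤ (K * (4 ^ c * w ^ c)) * R := by gcongr
        _ = _ := by ring
    · rw [indicator_of_notMem hyE, add_zero]
      refine ENNReal.ofReal_le_ofReal ?_
      have h1 : omegaFn F h y ≤ T := by
        by_contra hcon
        exact hyE ⟨hy0.le, not_le.1 hcon⟩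
      rw [mul_comm]
      exact mul_le_mul hRy h1 (by unfold omegaFn; positivity) hR0.le
  have hden := hD w hxw (V + h) (by
    calc w ^ s ≤ z ^ s := Real.rpow_le_rpow (by linarith) (by linarith) (by linarith)
      _ ≤ V := le_max_right _ _
      _ ≤ V + h := by linarith)
  rw [show w + (V + h) = z + V by rw [hw]; ring] at hden
  have hfin : volume (E ∩ Ioo w (z + V)) ≠ ∞ :=
    ((measure_mono inter_subset_right).trans_lt (by simp)).ne
  have hmain : ENNReal.ofReal h * F (Ioc z (z + V)) ≤ ENNReal.ofReal (R * M * (V + h)) := by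
    calc ENNReal.ofReal h * F (Ioc z (z + V))
        ≤ ∫⁻ y in Ioo w (z + V), F (Ioc y (y + h)) := mul_measure_Ioc_le_lintegral F h z V
      _ ≤ ∫⁻ y in Ioo w (z + V), (ENNReal.ofReal (R * T) +
            E.indicator (fun _ => ENNReal.ofReal (R * (K * 4 ^ c * w ^ c))) y) :=
          setLIntegral_mono' measurableSet_Ioo hbound
      _ ≤ ENNReal.ofReal (R * T) * ENNReal.ofReal (V + h) +
            ENNReal.ofReal (R * (K * 4 ^ c * w ^ c)) * volume (E ∩ Ioo w (z + V)) := by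
          rw [lintegral_add_left measurable_const, setLIntegral_const, Real.volume_Ioo,
            show z + V - w = V + h by rw [hw]; ring]
          gcongr
          refine (lintegral_indicator_const_le _ _).trans ?_
          rw [Measure.restrict_apply' measurableSet_Ioo]
      _ ≤ ENNReal.ofReal (R * T) * ENNReal.ofReal (V + h) +
            ENNReal.ofReal (R * (K * 4 ^ c * w ^ c)) * ENNReal.ofReal (|D| * w ^ (-c) * (V + h)) := by
          gcongr
          rw [← ENNReal.ofReal_toReal hfin]
          refine ENNReal.ofReal_le_ofReal (hden.trans ?_)
          gcongr
          exact le_abs_self D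
      _ = _ := by
          rw [← ENNReal.ofReal_mul (by positivity), ← ENNReal.ofReal_mul (by positivity),
            ← ENNReal.ofReal_add (by positivity) (by positivity)]
          congr 1
          rw [Real.rpow_neg (by linarith), hM]
          have : w ^ c ≠ 0 := (Real.rpow_pos_of_pos (by linarith) _).ne'
          field_simp
  have hreal : h * F.real (Ioc z (z + V)) ≤ R * M * (V + h) := by
    have := ENNReal.toReal_mono ENNReal.ofReal_ne_top hmain
    rwa [ENNReal.toReal_mul, ENNReal.toReal_ofReal hh.le,
      ENNReal.toReal_ofReal (by positivity)] at this
  have hRz : R ≤ 4 * P * (rtail F z / z) := by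
    have h1 := hpot (z / 2) z (by linarith) (by linarith)
    rw [Real.rpow_one, show z / (z / 2) = 2 by field_simp] at h1
    calc R ≤ rtail F (z / 2) / (z / 2) := by
          exact div_le_div₀ (hF.pos _).le (rtail_antitone F hwz) (by linarith) hwz
      _ ≤ (P * 2 * rtail F z) / (z / 2) := by gcongr
      _ = _ := by field_simp; ring
  calc F.real (Ioc z (z + V)) = h * F.real (Ioc z (z + V)) / h := by field_simp
    _ ≤ R * M * (V + h) / h := by gcongr
    _ ≤ (4 * P * (rtail F z / z)) * M * (V * (1 + h)) / h := by
        gcongr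
        nlinarith
    _ = (4 * P * M * (1 + h) / h) * V * (rtail F z / z) := by ring
    _ ≤ _ := by gcongr; exact le_max_right _ _

end Density

section Convolution

lemma conv_apply_Ioc_le (μ ν : Measure ℝ) [SFinite ν] {h : ℝ} {Q : ℝ≥0∞}
    (hQ : ∀ z, ν (Ioc z (z + h)) ≤ Q) (w : ℝ) : (μ ∗ ν) (Ioc w (w + h)) ≤ Q * μ univ := by
  rw [conv_apply_Ioc, ← lintegral_const]
  exact lintegral_mono fun y => hQ _

lemma measure_le_abs_le (μ : Measure ℝ) {b : ℝ} (hb : 0 < b) (r : ℝ) :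
    μ {y | r ≤ |y|} ≤
      ENNReal.ofReal (exp (-r / b)) * ∫⁻ y, ENNReal.ofReal (exp (|y| / b)) ∂μ := by
  rw [← lintegral_const_mul _ (by fun_prop),
    ← lintegral_indicator_one (measurableSet_le (by fun_prop) (by fun_prop))]
  refine lintegral_mono fun y => ?_
  by_cases hy : r ≤ |y|
  · rw [indicator_of_mem (by exact hy), ← ENNReal.ofReal_mul (exp_pos _).le, ← Real.exp_add,
      Pi.one_apply, ← ENNReal.ofReal_one]
    refine ENNReal.ofReal_le_ofReal (Real.one_le_exp ?_)
    rw [← add_div]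
    exact div_nonneg (by linarith) hb.le
  · rw [indicator_of_notMem (by exact hy)]
    exact zero_le

/-- If one summand has a bounded concentration function and both have exponential moments, then
the sum of two independent variables has exponentially decaying local probabilities. -/
lemma conv_apply_Ioc_le_exp (μ ν : Measure ℝ) [IsFiniteMeasure μ] [IsFiniteMeasure ν] {h b : ℝ}
    (hh : 0 < h) (hb : 0 < b) {Q E : ℝ≥0∞} (hμ : ∀ z, μ (Ioc z (z + h)) ≤ Q)
    (hν : ∀ z, ν (Ioc z (z + h)) ≤ Q) (hEμ : ∫⁻ y, ENNReal.ofReal (exp (|y| / b)) ∂μ ≤ E)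
    (hEν : ∫⁻ y, ENNReal.ofReal (exp (|y| / b)) ∂ν ≤ E) (w : ℝ) :
    (μ ∗ ν) (Ioc w (w + h)) ≤ 2 * Q * E * ENNReal.ofReal (exp (h / (2 * b))) *
      ENNReal.ofReal (exp (-|w| / (2 * b))) := by
  set r := (|w| - h) / 2 with hr
  set A : Set ℝ := {y | r ≤ |y|} with hA
  have hAm : MeasurableSet A := measurableSet_le (by fun_prop) (by fun_prop)
  have hexp : ENNReal.ofReal (exp (-r / b)) =
      ENNReal.ofReal (exp (h / (2 * b))) * ENNReal.ofReal (exp (-|w| / (2 * b))) := by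
    rw [← ENNReal.ofReal_mul (exp_pos _).le, ← Real.exp_add]
    congr 2
    rw [hr]; field_simp; ring
  have hle : (μ ∗ ν) (Ioc w (w + h)) ≤
      Q * μ A + ((ν.restrict A) ∗ μ) (Ioc w (w + h)) := by
    rw [Measure.conv_comm (ν.restrict A), conv_apply_Ioc, conv_apply_Ioc,
      ← lintegral_indicator_const hAm, ← lintegral_add_left (measurable_const.indicator hAm)]
    refine lintegral_mono fun y => ?_
    by_cases hy : y ∈ A
    · rw [indicator_of_mem hy]
      exact (hν _).trans le_self_add
    · rw [indicator_of_notMem hy, zero_add, Measure.restrict_apply measurableSet_Ioc]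
      refine measure_mono (subset_inter subset_rfl fun z hz => ?_)
      simp only [hA, mem_ofPred_eq, not_le, hr, mem_Ioc] at hy hz ⊢
      rcases abs_cases w with hw | hw <;> rcases abs_cases y with hy' | hy' <;>
        rcases abs_cases z with hz' | hz' <;> linarith
  calc (μ ∗ ν) (Ioc w (w + h)) ≤ Q * μ A + Q * ν A := by
        refine hle.trans (add_le_add_right ?_ _)
        refine (conv_apply_Ioc_le _ _ hμ w).trans ?_
        rw [Measure.restrict_apply_univ]
    _ ≤ Q * (ENNReal.ofReal (exp (-r / b)) * E) + Q * (ENNReal.ofReal (exp (-r / b)) * E) := by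
        gcongr
        · exact (measure_le_abs_le μ hb r).trans (by gcongr)
        · exact (measure_le_abs_le ν hb r).trans (by gcongr)
    _ = _ := by rw [hexp]; ring

lemma exists_lintegral_exp_neg_abs_le : ∃ C > 0, ∀ (ν : Measure ℝ) (b : ℝ), 0 < b →
    ∀ Q : ℝ≥0∞, (∀ z, ν (Ioc z (z + b)) ≤ Q) → ∀ w,
      ∫⁻ y, ENNReal.ofReal (exp (-|w - y| / (2 * b))) ∂ν ≤ ENNReal.ofReal C * Q := by
  have hsum : Summable fun k : ℤ => exp ((1 - |(k:ℝ)|) / 2) := by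
    have h1 : Summable fun n : ℕ => exp ((1 - (n:ℝ)) / 2) := by
      have := (Real.summable_exp_nat_mul_iff (a := -1 / 2)).2 (by norm_num)
      refine (this.mul_left (exp (1 / 2))).congr fun n => ?_
      rw [← Real.exp_add]; congr 1; ring
    refine Summable.of_nat_of_neg ?_ ?_ <;> simpa using h1
  refine ⟨∑' k : ℤ, exp ((1 - |(k:ℝ)|) / 2), hsum.tsum_pos (fun k => (exp_pos _).le) 0 (exp_pos _),
    fun ν b hb Q hQ w => ?_⟩
  rw [ENNReal.ofReal_tsum_of_nonneg (fun k => (exp_pos _).le) hsum, ← ENNReal.tsum_mul_right]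
  rw [← setLIntegral_univ, ← iUnion_Ioc_add_zsmul hb w]
  refine (lintegral_iUnion_le _ _).trans (ENNReal.tsum_le_tsum fun k => ?_)
  calc ∫⁻ y in Ioc (w + k • b) (w + (k + 1) • b), ENNReal.ofReal (exp (-|w - y| / (2 * b))) ∂ν
      ≤ ∫⁻ y in Ioc (w + k • b) (w + (k + 1) • b), ENNReal.ofReal (exp ((1 - |(k:ℝ)|) / 2)) ∂ν := by
        refine setLIntegral_mono' measurableSet_Ioc fun y hy => ?_
        refine ENNReal.ofReal_le_ofReal (Real.exp_le_exp.2 ?_)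
        rw [div_le_div_iff₀ (by positivity) two_pos]
        simp only [zsmul_eq_mul, mem_Ioc, Int.cast_add, Int.cast_one] at hy
        have : (|(k:ℝ)| - 1) * b ≤ |w - y| := by
          rcases abs_cases (k:ℝ) with hk | hk <;> rcases abs_cases (w - y) with hw | hw <;>
            nlinarith
        linarith
    _ ≤ _ := by
        rw [setLIntegral_const]
        gcongr
        rw [add_smul, one_smul, ← add_assoc]
        exact hQ _

end Convolution

section Truncation

variable {F : Measure ℝ} [IsProbabilityMeasure F] {α : ℝ} {a : ℕ → ℝ}

lemma RegTail.measure_lt_abs_le (hF : RegTail F α) :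
    ∃ C > 0, ∀ x, 0 ≤ x → F {y | x < |y|} ≤ ENNReal.ofReal (C * rtail F x) := by
  obtain ⟨C, hC⟩ := hF.left
  refine ⟨1 + |C|, by positivity, fun x hx => ?_⟩
  have hsub : {y : ℝ | x < |y|} ⊆ Ioi x ∪ Iic (-x) := fun y hy => by
    rcases lt_abs.1 (show x < |y| from hy) with h | h
    · exact Or.inl h
    · exact Or.inr (show y ≤ -x by linarith)
  calc F {y | x < |y|} ≤ F (Ioi x) + F (Iic (-x)) :=
        (measure_mono hsub).trans (measure_union_le _ _)
    _ ≤ ENNReal.ofReal (rtail F x) + ENNReal.ofReal (|C| * rtail F x) := by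
        rw [ofReal_rtail, ← ENNReal.ofReal_toReal (measure_ne_top F (Iic (-x)))]
        gcongr
        refine (hC x hx).trans ?_
        gcongr
        · exact rtail_nonneg F x
        · exact le_abs_self C
    _ = _ := by
        rw [← ENNReal.ofReal_add (rtail_nonneg F x)
          (mul_nonneg (abs_nonneg _) (rtail_nonneg F x))]
        congr 1; ring

lemma RegTail.lintegral_abs_le (hF : RegTail F α) :
    ∃ C > 0, ∀ b, 1 ≤ b →
      ∫⁻ y in Icc (-b) b, ENNReal.ofReal |y| ∂F ≤ ENNReal.ofReal (C * (b * rtail F b)) := by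
  obtain ⟨C, hC, htail⟩ := hF.measure_lt_abs_le
  obtain ⟨D, hD, hpot⟩ := hF.lower (β := 3 / 4) (by linarith [hF.α_le])
  have hG1 := hF.pos 1
  have hG1' := rtail_le_one F 1
  have hD' : D ≤ D / rtail F 1 := by rw [le_div_iff₀ hG1]; nlinarith
  have hpot' : ∀ b t, 1 ≤ b → 0 < t → t ≤ b →
      rtail F t ≤ D / rtail F 1 * (b / t) ^ (3 / 4 : ℝ) * rtail F b := fun b t hb ht htb => by
    have hGb := hF.pos b
    rcases le_total 1 t with h1 | h1
    · refine (hpot t b h1 htb).trans ?_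
      gcongr
    · have h2 := hpot 1 b le_rfl hb
      calc rtail F t ≤ rtail F 1 / rtail F 1 := by
            rw [div_self hG1.ne']; exact rtail_le_one F t
        _ ≤ (D * (b / t) ^ (3 / 4 : ℝ) * rtail F b) / rtail F 1 := by
            gcongr
            refine h2.trans ?_
            gcongr
        _ = _ := by ring
  refine ⟨4 * (C * (D / rtail F 1)), by positivity, fun b hb => ?_⟩
  have hb0 : 0 < b := by linarith
  have hGb := hF.pos b
  set K := C * (D / rtail F 1) * (b ^ (3 / 4 : ℝ) * rtail F b) with hK
  have hK0 : 0 < K := by positivity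
  rw [lintegral_eq_lintegral_meas_lt _ (ae_of_all _ fun y => abs_nonneg y)
    (by fun_prop)]
  have hInt : IntegrableOn (fun t : ℝ => K * t ^ (-(3 / 4) : ℝ)) (Ioc 0 b) := by
    have := (intervalIntegral.intervalIntegrable_rpow' (a := 0) (b := b)
      (r := -(3 / 4)) (by norm_num)).const_mul K
    rwa [intervalIntegrable_iff_integrableOn_Ioc_of_le hb0.le] at this
  calc ∫⁻ t in Ioi 0, (F.restrict (Icc (-b) b)) {y | t < |y|}
      ≤ ∫⁻ t in Ioi 0, (Ioc 0 b).indicator (fun t => ENNReal.ofReal (K * t ^ (-(3 / 4) : ℝ))) t := by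
        refine setLIntegral_mono' measurableSet_Ioi fun t ht => ?_
        have ht0 : 0 < t := ht
        by_cases htb : t ≤ b
        · rw [indicator_of_mem (show t ∈ Ioc 0 b from ⟨ht0, htb⟩)]
          refine (Measure.restrict_apply_le _ _).trans ((htail t ht0.le).trans ?_)
          refine ENNReal.ofReal_le_ofReal ?_
          calc C * rtail F t ≤ C * (D / rtail F 1 * (b / t) ^ (3 / 4 : ℝ) * rtail F b) := by
                gcongr; exact hpot' b t hb ht0 htb
            _ = _ := by
                rw [hK, Real.rpow_neg ht0.le, Real.div_rpow hb0.le ht0.le]; ring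
        · rw [Measure.restrict_apply (measurableSet_lt measurable_const (by fun_prop))]
          refine (le_of_eq ?_).trans zero_le
          refine measure_mono_null (fun y hy => ?_) (measure_empty (μ := F))
          have h1 : t < |y| := hy.1
          have h2 : |y| ≤ b := abs_le.2 hy.2
          exact absurd (h1.le.trans h2) htb
    _ = ∫⁻ t in Ioc 0 b, ENNReal.ofReal (K * t ^ (-(3 / 4) : ℝ)) := by
        rw [setLIntegral_indicator measurableSet_Ioc, inter_eq_left.2 Ioc_subset_Ioi_self]
    _ = ENNReal.ofReal (∫ t in Ioc 0 b, K * t ^ (-(3 / 4) : ℝ)) := by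
        rw [ofReal_integral_eq_lintegral_ofReal hInt]
        exact (ae_restrict_mem measurableSet_Ioc).mono fun t ht => by
          have : 0 < t := ht.1
          positivity
    _ = _ := by
        congr 1
        rw [← intervalIntegral.integral_of_le hb0.le, intervalIntegral.integral_const_mul,
          integral_rpow (Or.inl (by norm_num)), Real.zero_rpow (by norm_num), hK]
        have : b ^ (3 / 4 : ℝ) * b ^ (-(3 / 4) + 1 : ℝ) = b := by
          rw [← Real.rpow_add hb0]; norm_num
        linear_combination (4 * C * (D / rtail F 1) * rtail F b) * this

lemma RegTail.lintegral_exp_le (hF : RegTail F α) :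
    ∃ C > 0, ∀ b, 1 ≤ b → ∀ l, |l| * b ≤ 1 →
      ∫⁻ y in Icc (-b) b, ENNReal.ofReal (exp (l * y)) ∂F ≤
        ENNReal.ofReal (exp (C * rtail F b)) := by
  obtain ⟨C, hC, hInt⟩ := hF.lintegral_abs_le
  refine ⟨2 * C, by positivity, fun b hb l hl => ?_⟩
  have hGb := hF.pos b
  calc ∫⁻ y in Icc (-b) b, ENNReal.ofReal (exp (l * y)) ∂F
      ≤ ∫⁻ y in Icc (-b) b, (1 + ENNReal.ofReal (2 * |l|) * ENNReal.ofReal |y|) ∂F := by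
        refine setLIntegral_mono' measurableSet_Icc fun y hy => ?_
        rw [← ENNReal.ofReal_mul (by positivity), ← ENNReal.ofReal_one,
          ← ENNReal.ofReal_add zero_le_one (by positivity)]
        refine ENNReal.ofReal_le_ofReal ?_
        have h1 : |l * y| ≤ 1 := by
          rw [abs_mul]
          refine le_trans ?_ hl
          gcongr
          exact abs_le.2 hy
        have h2 := (abs_le.1 (Real.abs_exp_sub_one_le h1)).2
        rw [abs_mul] at h2
        linarith
    _ ≤ 1 + ENNReal.ofReal (2 * |l|) * ENNReal.ofReal (C * (b * rtail F b)) := by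
        rw [lintegral_add_left measurable_const, lintegral_const_mul _ (by fun_prop), lintegral_one,
          Measure.restrict_apply_univ]
        gcongr
        · exact prob_le_one
        · exact hInt b hb
    _ ≤ _ := by
        rw [← ENNReal.ofReal_mul (by positivity), ← ENNReal.ofReal_one,
          ← ENNReal.ofReal_add zero_le_one (by positivity)]
        refine ENNReal.ofReal_le_ofReal ((?_ : _ ≤ 2 * C * rtail F b + 1).trans
          (Real.add_one_le_exp _))
        have : (|l| * b) * (C * rtail F b) ≤ 1 * (C * rtail F b) := by gcongr
        linarith

lemma ScaleSeq.lintegral_exp_abs_le (hF : RegTail F α) (ha : ScaleSeq F α a) :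
    ∃ C > 0, ∀ (n m : ℕ) b, a n ≤ b → m ≤ n →
      ∫⁻ y, ENNReal.ofReal (exp (|y| / b)) ∂(convPow (F.restrict (Icc (-b) b)) m) ≤
        ENNReal.ofReal C := by
  obtain ⟨C, hC, hexp⟩ := hF.lintegral_exp_le
  obtain ⟨D, hD, hn⟩ := ha.le_of_ge hF le_rfl hF.α_pos
  refine ⟨2 * exp (C * D), by positivity, fun n m b hb hmn => ?_⟩
  have hb1 : 1 ≤ b := (ha.one_le n).trans hb
  have hb0 : 0 < b := by linarith
  have hGb := hF.pos b
  have key : ∀ l, |l| * b ≤ 1 →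
      ∫⁻ y, ENNReal.ofReal (exp (l * y)) ∂(convPow (F.restrict (Icc (-b) b)) m) ≤
        ENNReal.ofReal (exp (C * D)) := fun l hl => by
    rw [lintegral_exp_convPow]
    calc _ ≤ ENNReal.ofReal (exp (C * rtail F b)) ^ m := by
          gcongr; exact hexp b hb1 l hl
      _ = ENNReal.ofReal (exp (C * (m * rtail F b))) := by
          rw [← ENNReal.ofReal_pow (exp_pos _).le, ← Real.exp_nat_mul]
          congr 2; ring
      _ ≤ _ := by
          gcongr
          have h1 := hn n b hb
          rw [neg_zero, Real.rpow_zero, mul_one] at h1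
          refine le_trans ?_ h1
          gcongr
  calc _ ≤ ∫⁻ y, (ENNReal.ofReal (exp (b⁻¹ * y)) + ENNReal.ofReal (exp (-b⁻¹ * y)))
          ∂(convPow (F.restrict (Icc (-b) b)) m) := by
        refine lintegral_mono fun y => ?_
        rw [← ENNReal.ofReal_add (exp_pos _).le (exp_pos _).le]
        refine ENNReal.ofReal_le_ofReal ?_
        rcases abs_cases y with h | h
        · rw [h.1, show y / b = b⁻¹ * y by field_simp]
          linarith [exp_pos (-b⁻¹ * y)]
        · rw [h.1, show -y / b = -b⁻¹ * y by field_simp]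
          linarith [exp_pos (b⁻¹ * y)]
    _ ≤ ENNReal.ofReal (exp (C * D)) + ENNReal.ofReal (exp (C * D)) := by
        rw [lintegral_add_left (by fun_prop)]
        have hbi : |b⁻¹| * b ≤ 1 := by
          rw [abs_of_pos (by positivity), inv_mul_cancel₀ hb0.ne']
        gcongr
        · exact key _ hbi
        · exact key _ (by rwa [abs_neg])
    _ = _ := by
        rw [← ENNReal.ofReal_add (exp_pos _).le (exp_pos _).le, two_mul]

/-- Local bound for sums of variables truncated at a level `b ≥ aₙ`. -/
lemma ScaleSeq.convPow_restrict_Ioc_le (hF : RegTail F α) (ha : ScaleSeq F α a) {h : ℝ}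
    (hh : 0 < h) :
    ∃ C > 0, ∀ (n m : ℕ) b, a n ≤ b → m ≤ n → ∀ w,
      convPow (F.restrict (Icc (-b) b)) m (Ioc w (w + h)) ≤
        ENNReal.ofReal (C / a m) * ENNReal.ofReal (exp (-|w| / (2 * b))) := by
  obtain ⟨E, hE, hexp⟩ := ha.lintegral_exp_abs_le hF
  obtain ⟨C, hC, hcon⟩ := ha.convPow_Ioc_le hF hh
  obtain ⟨D, hD, hdbl⟩ := ha.doubling hF 1
  refine ⟨2 * (C * D) * E * exp h, by positivity, fun n m b hb hmn w => ?_⟩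
  have hb1 : 1 ≤ b := (ha.one_le n).trans hb
  have ham : 0 < a m := by linarith [ha.one_le m]
  have hQ : ∀ k, m ≤ 2 * k + 1 → ∀ z, convPow (F.restrict (Icc (-b) b)) k (Ioc z (z + h)) ≤
      ENNReal.ofReal (C * D / a m) := fun k hk z => by
    refine (convPow_mono Measure.restrict_le_self k _).trans ((hcon k z).trans ?_)
    refine ENNReal.ofReal_le_ofReal ?_
    have hak : 0 < a k := by linarith [ha.one_le k]
    rw [div_le_div_iff₀ hak ham]
    nlinarith [hdbl m k hk]
  have hsplit : m = m / 2 + (m - m / 2) := by omega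
  conv_lhs => rw [hsplit]
  rw [convPow_add]
  refine (conv_apply_Ioc_le_exp _ _ hh (by linarith : 0 < b) (hQ _ (by omega)) (hQ _ (by omega))
    (hexp n _ b hb (by omega)) (hexp n _ b hb (by omega)) w).trans ?_
  gcongr
  have : (2 : ℝ≥0∞) = ENNReal.ofReal 2 := by simp
  rw [this, ← ENNReal.ofReal_mul (by positivity), ← ENNReal.ofReal_mul (by positivity),
    ← ENNReal.ofReal_mul (by positivity)]
  refine ENNReal.ofReal_le_ofReal ?_
  have : exp (h / (2 * b)) ≤ exp h := by
    gcongr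
    exact div_le_self hh.le (by linarith)
  calc 2 * (C * D / a m) * E * exp (h / (2 * b)) ≤ 2 * (C * D / a m) * E * exp h := by gcongr
    _ = _ := by ring

end Truncation

section LocalBound

lemma convPow_Ioi_eq_zero (μ : Measure ℝ) [IsFiniteMeasure μ] {q : ℝ} (hq : μ (Ioi q) = 0)
    (j : ℕ) : convPow μ j (Ioi (j * q)) = 0 := by
  induction j with
  | zero => simp [convPow]
  | succ j ih =>
    rw [convPow_succ, conv_apply _ _ measurableSet_Ioi, lintegral_eq_zero_iff' (by
      have : Measurable fun x : ℝ => μ ((fun y => x + y) ⁻¹' Ioi (((j + 1 : ℕ) : ℝ) * q)) := by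
        refine measurable_measure_prodMk_left
          (s := {p : ℝ × ℝ | ((j + 1 : ℕ) : ℝ) * q < p.1 + p.2}) ?_
        exact measurableSet_lt measurable_const (measurable_fst.add measurable_snd)
      exact this.aemeasurable)]
    have hae : ∀ᵐ y ∂convPow μ j, y ≤ j * q := by
      refine (measure_eq_zero_iff_ae_notMem.1 ih).mono fun y hy => not_lt.1 hy
    filter_upwards [hae] with y hy
    refine measure_mono_null (fun z hz => ?_) hq
    simp only [mem_preimage, mem_Ioi, Nat.cast_add, Nat.cast_one] at hz ⊢
    linarith

variable {F : Measure ℝ} [IsProbabilityMeasure F] {α : ℝ} {a : ℕ → ℝ}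

lemma RegTail.restrict_Ioi_Ioc_le (hF : RegTail F α) {h c s T : ℝ} (hh : 0 < h) (hc : 0 < c)
    (hcs : c ≤ s) (hs : s < 1) (hT : 0 ≤ T)
    (hω : (fun x => omegaFn F h x) =O[atTop] fun x => x ^ c)
    (hE : DensityAtScale {x : ℝ | 0 ≤ x ∧ T < omegaFn F h x} c s) {θ : ℝ} (hθ : 0 < θ)
    (hθ1 : θ ≤ 1) :
    ∃ C > 0, ∃ x₁, 1 ≤ x₁ ∧ ∀ x, x₁ ≤ x → ∀ b, x ^ s ≤ b → ∀ z,
      F.restrict (Ioi (θ * x)) (Ioc z (z + b)) ≤ ENNReal.ofReal (C * (b * (rtail F x / x))) := by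
  obtain ⟨C, hC, x₀, hx₀, hb⟩ := hF.measure_Ioc_le hh hc hcs hT hω hE
  obtain ⟨P, hP, hpot⟩ := hF.lower (β := 1) (by linarith [hF.α_le])
  refine ⟨C * (P / θ ^ 2), by positivity, x₀ / θ, by
    rw [le_div_iff₀ hθ]; nlinarith, fun x hx b hxb z => ?_⟩
  have hqx₀ : x₀ ≤ θ * x := by rw [div_le_iff₀ hθ] at hx; linarith
  have hq0 : 0 < θ * x := by linarith
  have hx0 : 0 < x := pos_of_mul_pos_right hq0 hθ.le
  set q := θ * x with hq
  have hqx : q ≤ x := by nlinarith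
  have hGx := hF.pos x
  have hGq := hF.pos q
  set y := max z q with hy
  have hqy : q ≤ y := le_max_right _ _
  have hy0 : 0 < y := by linarith
  have hGy := hF.pos y
  have hGyq : rtail F y ≤ rtail F q := rtail_antitone F hqy
  have hb0 : 0 < b := (Real.rpow_pos_of_pos hx0 s).trans_le hxb
  have hmax : max b (y ^ s) * (rtail F y / y) ≤ b * (rtail F q / q) := by
    rcases max_cases b (y ^ s) with hm | hm
    · rw [hm.1]; gcongr
    · rw [hm.1]
      have h1 : y ^ s / y ≤ q ^ s / q := by
        rw [← Real.rpow_sub_one hy0.ne', ← Real.rpow_sub_one hq0.ne']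
        exact Real.rpow_le_rpow_of_nonpos hq0 hqy (by linarith)
      calc y ^ s * (rtail F y / y) = (y ^ s / y) * rtail F y := by ring
        _ ≤ (q ^ s / q) * rtail F q := by gcongr
        _ ≤ (b / q) * rtail F q := by
            gcongr
            refine le_trans ?_ hxb
            gcongr
            exact hc.le.trans hcs
        _ = _ := by ring
  have hGqx : rtail F q / q ≤ P / θ ^ 2 * (rtail F x / x) := by
    have h1 := hpot q x (hx₀.trans hqx₀) hqx
    rw [Real.rpow_one] at h1
    calc rtail F q / q ≤ (P * (x / q) * rtail F x) / q := by gcongr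
      _ = _ := by rw [hq]; field_simp
  rw [Measure.restrict_apply measurableSet_Ioc]
  have hsub : Ioc z (z + b) ∩ Ioi q ⊆ Ioc y (y + b) := fun u hu =>
    ⟨max_lt hu.1.1 hu.2, by linarith [hu.1.2, le_max_left z q]⟩
  refine (measure_mono hsub).trans ?_
  rw [← ofReal_measureReal]
  refine ENNReal.ofReal_le_ofReal ((hb y (hqx₀.trans hqy) b).trans ?_)
  calc C * max b (y ^ s) * (rtail F y / y) = C * (max b (y ^ s) * (rtail F y / y)) := by ring
    _ ≤ C * (b * (P / θ ^ 2 * (rtail F x / x))) := by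
        refine mul_le_mul_of_nonneg_left (hmax.trans ?_) hC.le
        gcongr
    _ = _ := by ring

/-- Local large deviation bound, truncating the steps at level `b ≥ aₙ` and allowing fewer
than `J` steps larger than `b`. -/
lemma ScaleSeq.convPow_Ioc_le_of_truncation (hF : RegTail F α) (ha : ScaleSeq F α a) {h c s T : ℝ}
    (hh : 0 < h) (hc : 0 < c) (hcs : c ≤ s) (hs : s < 1) (hT : 0 ≤ T)
    (hω : (fun x => omegaFn F h x) =O[atTop] fun x => x ^ c)
    (hE : DensityAtScale {x : ℝ | 0 ≤ x ∧ T < omegaFn F h x} c s) {J : ℕ} (hJ : 1 ≤ J) :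
    ∃ C > 0, ∃ x₁, 1 ≤ x₁ ∧ ∀ (n : ℕ) x b, x₁ ≤ x → a n ≤ b →
      convPow F n (Ioc x (x + h)) ≤ ENNReal.ofReal (C *
        (exp (-x / (4 * b)) / a n + n / a n * (max b (x ^ s) * (rtail F x / x)) +
          (n * rtail F b) ^ J / a n)) := by
  obtain ⟨C₁, hC₁, htail⟩ := hF.measure_lt_abs_le
  obtain ⟨D, hD, hn⟩ := ha.le_of_ge hF le_rfl hF.α_pos
  obtain ⟨E, hE1, hdbl⟩ := ha.doubling hF (2 * J)
  obtain ⟨S, hS, hσ⟩ := ha.convPow_restrict_Ioc_le hF hh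
  obtain ⟨R, hR, hcon⟩ := ha.convPow_Ioc_le hF hh
  obtain ⟨C₀, hC₀, hexp⟩ := exists_lintegral_exp_neg_abs_le
  have hJ0 : (0:ℝ) < J := by exact_mod_cast hJ
  have hJ1 : (1:ℝ) ≤ J := by exact_mod_cast hJ
  obtain ⟨C₄, hC₄, x₁, hx₁, hjump⟩ := hF.restrict_Ioi_Ioc_le hh hc hcs hs hT hω hE
    (θ := 1 / (2 * J)) (by positivity) (by rw [div_le_one (by positivity)]; linarith)
  set M := max 1 (C₁ * D) with hM
  have hM1 : 1 ≤ M := le_max_left _ _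
  set K := J * (M ^ J * (S * E)) + J * (J * M ^ J * (S * E * (C₀ * C₄))) + C₁ ^ J * (R * E) with hK
  refine ⟨K, by positivity, x₁, hx₁, fun n x b hx hb => ?_⟩
  have hb1 : 1 ≤ b := (ha.one_le n).trans hb
  have hb0 : 0 < b := by linarith
  have hx0 : 0 < x := by linarith
  have han : 0 < a n := by linarith [ha.one_le n]
  have hGb := hF.pos b
  have hGx := hF.pos x
  set σ := F.restrict (Icc (-b) b) with hσdef
  set β := F.restrict (Icc (-b) b)ᶜ with hβdef
  have hσβ : σ + β = F := Measure.restrict_add_restrict_compl measurableSet_Icc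
  set q := 1 / (2 * J) * x with hq
  set B := C₁ * rtail F b with hB
  have hB0 : 0 < B := by positivity
  have hβu : β univ ≤ ENNReal.ofReal B := by
    rw [hβdef, Measure.restrict_apply_univ]
    refine (measure_mono fun y hy => ?_).trans (htail b hb0.le)
    by_contra hcon
    exact hy (abs_le.1 (not_lt.1 hcon))
  have hnB : n * B ≤ M := by
    have h1 := hn n b hb
    rw [neg_zero, Real.rpow_zero, mul_one] at h1
    calc n * B = C₁ * (n * rtail F b) := by rw [hB]; ring
      _ ≤ C₁ * D := by gcongr
      _ ≤ M := le_max_right _ _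
  have hpow : ∀ j, j ≤ J → (n * B) ^ j ≤ M ^ J := fun j hj =>
    (pow_le_pow_left₀ (by positivity) hnB j).trans (pow_le_pow_right₀ hM1 hj)
  have hnj : ∀ j, j ≤ J → ∀ L, 0 ≤ L → L / a (n - j) ≤ L * E / a n := fun j hj L hL => by
    have h1 := hdbl n (n - j) (by omega)
    have h2 : 0 < a (n - j) := by linarith [ha.one_le (n - j)]
    rw [div_le_div_iff₀ h2 han]
    nlinarith
  have hσj : ∀ j, j ≤ J → ∀ w, convPow σ (n - j) (Ioc w (w + h)) ≤
      ENNReal.ofReal (S * E / a n) * ENNReal.ofReal (exp (-|w| / (2 * b))) := fun j hj w => by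
    refine (hσ n (n - j) b hb (Nat.sub_le _ _) w).trans ?_
    gcongr ENNReal.ofReal ?_ * _
    exact hnj j hj S hS.le
  set V := max b (x ^ s) with hV
  have hV0 : 0 < V := hb0.trans_le (le_max_left _ _)
  set β₁ := β.restrict (Ioi q) with hβ₁
  set β₂ := β.restrict (Ioi q)ᶜ with hβ₂
  have hββ : β₂ + β₁ = β := by
    rw [add_comm]; exact Measure.restrict_add_restrict_compl measurableSet_Ioi
  have hβ₂q : β₂ (Ioi q) = 0 := by
    rw [hβ₂, Measure.restrict_apply measurableSet_Ioi, inter_compl_self, measure_empty]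
  have hβ₂u : β₂ univ ≤ ENNReal.ofReal B := (Measure.restrict_le_self _).trans hβu
  have hjump₁ : ∀ j, j ≤ J → ∀ z, (β₁ ∗ convPow σ (n - j)) (Ioc z (z + h)) ≤
      ENNReal.ofReal (S * E / a n * (C₀ * (C₄ * (V * (rtail F x / x))))) := fun j hj z => by
    rw [conv_apply_Ioc]
    calc _ ≤ ∫⁻ y, ENNReal.ofReal (S * E / a n) *
            ENNReal.ofReal (exp (-|z - y| / (2 * V))) ∂β₁ := by
          refine lintegral_mono fun y => (hσj j hj _).trans ?_
          gcongr 1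
          refine ENNReal.ofReal_le_ofReal (Real.exp_le_exp.2 ?_)
          rw [neg_div, neg_div, neg_le_neg_iff]
          gcongr
          exact le_max_left _ _
      _ = ENNReal.ofReal (S * E / a n) *
            ∫⁻ y, ENNReal.ofReal (exp (-|z - y| / (2 * V))) ∂β₁ :=
          lintegral_const_mul _ (by fun_prop)
      _ ≤ ENNReal.ofReal (S * E / a n) *
            (ENNReal.ofReal C₀ * ENNReal.ofReal (C₄ * (V * (rtail F x / x)))) := by
          gcongr
          refine hexp β₁ V hV0 _ (fun u => ?_) z
          refine le_trans ?_ (hjump x hx V (le_max_right _ _) u)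
          exact Measure.restrict_mono subset_rfl Measure.restrict_le_self _
      _ = _ := by
          rw [← ENNReal.ofReal_mul (by positivity), ← ENNReal.ofReal_mul (by positivity)]
  have hncast : (n : ℝ≥0∞) = ENNReal.ofReal n := (ENNReal.ofReal_natCast n).symm
  have hterm : ∀ j ∈ Finset.range J,
      ((n : ℝ≥0∞) ^ j • (convPow β j ∗ convPow σ (n - j))) (Ioc x (x + h)) ≤
        ENNReal.ofReal (M ^ J * (S * E) * (exp (-x / (4 * b)) / a n) +
          J * M ^ J * (S * E * (C₀ * C₄)) * (n / a n * (V * (rtail F x / x)))) := by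
    intro j hjJ
    have hj : j ≤ J := (Finset.mem_range.1 hjJ).le
    have hA : (convPow β₂ j ∗ convPow σ (n - j)) (Ioc x (x + h)) ≤
        ENNReal.ofReal (S * E / a n) * ENNReal.ofReal (exp (-x / (4 * b))) *
          ENNReal.ofReal B ^ j := by
      rw [conv_apply_Ioc]
      have hae : ∀ᵐ y ∂convPow β₂ j, y ≤ x / 2 := by
        refine (measure_eq_zero_iff_ae_notMem.1 (convPow_Ioi_eq_zero β₂ hβ₂q j)).mono
          fun y hy => (not_lt.1 hy).trans ?_
        have hjr : (j:ℝ) ≤ J := by exact_mod_cast hj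
        calc (j:ℝ) * q ≤ J * q := by gcongr
          _ = x / 2 := by rw [hq]; field_simp
      calc _ ≤ ∫⁻ y, ENNReal.ofReal (S * E / a n) * ENNReal.ofReal (exp (-x / (4 * b)))
              ∂convPow β₂ j := by
            refine lintegral_mono_ae (hae.mono fun y hy => (hσj j hj _).trans ?_)
            gcongr 1
            refine ENNReal.ofReal_le_ofReal (Real.exp_le_exp.2 ?_)
            rw [div_le_div_iff₀ (by positivity) (by positivity)]
            have : x / 2 ≤ |x - y| := (by linarith : x / 2 ≤ x - y).trans (le_abs_self _)
            nlinarith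
        _ = ENNReal.ofReal (S * E / a n) * ENNReal.ofReal (exp (-x / (4 * b))) * β₂ univ ^ j := by
            rw [lintegral_const, convPow_univ]
        _ ≤ _ := by gcongr
    have hBt : ((β₁ ∗ convPow β (j - 1)) ∗ convPow σ (n - j)) (Ioc x (x + h)) ≤
        ENNReal.ofReal (S * E / a n * (C₀ * (C₄ * (V * (rtail F x / x))))) *
          ENNReal.ofReal B ^ (j - 1) := by
      rw [Measure.conv_comm β₁, Measure.conv_assoc]
      refine (conv_apply_Ioc_le _ _ (hjump₁ j hj) x).trans ?_
      rw [convPow_univ]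
      gcongr
    have hsplit : convPow β j ∗ convPow σ (n - j) ≤ convPow β₂ j ∗ convPow σ (n - j) +
        (j : ℝ≥0∞) • ((β₁ ∗ convPow β (j - 1)) ∗ convPow σ (n - j)) := by
      have h1 := convPow_add_le β₂ β₁ j
      rw [hββ] at h1
      refine (conv_mono h1 le_rfl).trans_eq ?_
      rw [Measure.add_conv, Measure.conv_smul_left]
    rw [Measure.smul_apply, smul_eq_mul]
    calc _ ≤ (n : ℝ≥0∞) ^ j * (ENNReal.ofReal (S * E / a n) * ENNReal.ofReal (exp (-x / (4 * b))) *
            ENNReal.ofReal B ^ j + (j : ℝ≥0∞) *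
          (ENNReal.ofReal (S * E / a n * (C₀ * (C₄ * (V * (rtail F x / x))))) *
            ENNReal.ofReal B ^ (j - 1))) := by
          gcongr
          refine (hsplit _).trans ?_
          rw [Measure.add_apply, Measure.smul_apply, smul_eq_mul]
          gcongr
      _ = ENNReal.ofReal ((n * B) ^ j * (S * E) * (exp (-x / (4 * b)) / a n) +
            (n ^ j * j * B ^ (j - 1)) * (S * E * (C₀ * C₄)) * (1 / a n * (V * (rtail F x / x)))) := by
          rw [hncast, ← ENNReal.ofReal_natCast j]
          rw [← ENNReal.ofReal_pow (by positivity), ← ENNReal.ofReal_pow (by positivity),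
            ← ENNReal.ofReal_pow (by positivity), ← ENNReal.ofReal_mul (by positivity),
            ← ENNReal.ofReal_mul (by positivity), ← ENNReal.ofReal_mul (by positivity),
            ← ENNReal.ofReal_mul (by positivity), ← ENNReal.ofReal_add (by positivity)
              (by positivity), ← ENNReal.ofReal_mul (by positivity)]
          congr 1
          ring
      _ ≤ _ := by
          refine ENNReal.ofReal_le_ofReal (add_le_add ?_ ?_)
          · gcongr
            exact hpow j hj
          · have : (n:ℝ) ^ j * j * B ^ (j - 1) ≤ J * M ^ J * n := by
              rcases Nat.eq_zero_or_pos j with h0 | h0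
              · subst h0
                simp only [Nat.cast_zero, mul_zero, zero_mul]
                positivity
              · have hjr : (j:ℝ) ≤ J := by exact_mod_cast hj
                calc (n:ℝ) ^ j * j * B ^ (j - 1) = j * (n * B) ^ (j - 1) * n := by
                      obtain ⟨i, rfl⟩ : ∃ i, j = i + 1 := ⟨j - 1, by omega⟩
                      rw [Nat.add_sub_cancel]; ring
                  _ ≤ _ := by
                      gcongr
                      exact hpow _ (by omega)
            calc _ ≤ (J * M ^ J * n) * (S * E * (C₀ * C₄)) * (1 / a n * (V * (rtail F x / x))) := by
                  gcongr
              _ = _ := by ring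
  have hlast : ((n : ℝ≥0∞) ^ J • (convPow β J ∗ convPow F (n - J))) (Ioc x (x + h)) ≤
      ENNReal.ofReal (C₁ ^ J * (R * E) * ((n * rtail F b) ^ J / a n)) := by
    rw [Measure.smul_apply, smul_eq_mul]
    calc _ ≤ (n : ℝ≥0∞) ^ J * (ENNReal.ofReal (R * E / a n) * ENNReal.ofReal B ^ J) := by
          gcongr
          refine (conv_apply_Ioc_le _ _ (fun z => (hcon (n - J) z).trans
            (ENNReal.ofReal_le_ofReal (hnj J le_rfl R hR.le))) x).trans ?_
          rw [convPow_univ]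
          gcongr
      _ = _ := by
          rw [hncast, ← ENNReal.ofReal_pow (by positivity), ← ENNReal.ofReal_pow (by positivity),
            ← ENNReal.ofReal_mul (by positivity), ← ENNReal.ofReal_mul (by positivity)]
          congr 1
          rw [hB]; ring
  have hmain := convPow_le_sum σ β n J
  rw [hσβ] at hmain
  refine (hmain _).trans ?_
  rw [Measure.add_apply, Measure.finsetSum_apply]
  refine (add_le_add (Finset.sum_le_sum hterm) hlast).trans ?_
  rw [Finset.sum_const, Finset.card_range, nsmul_eq_mul, ← ENNReal.ofReal_natCast J,
    ← ENNReal.ofReal_mul (by positivity), ← ENNReal.ofReal_add (by positivity) (by positivity)]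
  refine ENNReal.ofReal_le_ofReal ?_
  have e1 : 0 ≤ exp (-x / (4 * b)) / a n := by positivity
  have e2 : 0 ≤ n / a n * (V * (rtail F x / x)) := by positivity
  have e3 : 0 ≤ (n * rtail F b) ^ J / a n := by positivity
  have k1 : J * (M ^ J * (S * E)) ≤ K := by
    rw [hK, add_assoc]; exact le_add_of_nonneg_right (by positivity)
  have k2 : J * (J * M ^ J * (S * E * (C₀ * C₄))) ≤ K := by
    rw [hK, add_right_comm]; exact le_add_of_nonneg_left (by positivity)
  have k3 : C₁ ^ J * (R * E) ≤ K := by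
    rw [hK]; exact le_add_of_nonneg_left (by positivity)
  calc _ = J * (M ^ J * (S * E)) * (exp (-x / (4 * b)) / a n) +
        J * (J * M ^ J * (S * E * (C₀ * C₄))) * (n / a n * (V * (rtail F x / x))) +
        C₁ ^ J * (R * E) * ((n * rtail F b) ^ J / a n) := by ring
    _ ≤ K * (exp (-x / (4 * b)) / a n) + K * (n / a n * (V * (rtail F x / x))) +
        K * ((n * rtail F b) ^ J / a n) := by gcongr
    _ = _ := by ring

end LocalBound

section SmallSum

variable {F : Measure ℝ} [IsProbabilityMeasure F] {α : ℝ} {a : ℕ → ℝ}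

lemma mul_exp_neg_sqrt_div_four_le {y : ℝ} (hy : 0 ≤ y) : y * exp (-√y / 4) ≤ 32 := by
  have h1 : (√y / 4) ^ 2 / 2 ≤ exp (√y / 4) := by
    have h0 : 0 ≤ √y / 4 := by positivity
    linarith [Real.quadratic_le_exp_of_nonneg h0]
  rw [div_pow, Real.sq_sqrt hy] at h1
  rw [neg_div, Real.exp_neg, ← div_eq_mul_inv, div_le_iff₀ (exp_pos _)]
  linarith

/-- Local bound for `P(Sₙ ∈ (x, x+h])` in the range `aₙ ≤ x`. -/
lemma ScaleSeq.convPow_Ioc_le_inv (hF : RegTail F α) (ha : ScaleSeq F α a) {h c s T : ℝ}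
    (hh : 0 < h) (hc : 0 < c) (hcs : c ≤ s) (hs : s < 1) (hT : 0 ≤ T)
    (hω : (fun x => omegaFn F h x) =O[atTop] fun x => x ^ c)
    (hE : DensityAtScale {x : ℝ | 0 ≤ x ∧ T < omegaFn F h x} c s) :
    ∃ C > 0, ∃ x₁, 1 ≤ x₁ ∧ ∀ (n : ℕ) x, x₁ ≤ x → a n ≤ x →
      (convPow F n).real (Ioc x (x + h)) ≤
        C * (1 / x + n / a n * (x ^ s * (rtail F x / x))) := by
  have hα := hF.α_pos
  have hα' := hF.α_le
  set γ := α / 4 with hγ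
  obtain ⟨J, hJ⟩ := exists_nat_ge (2 / (γ * α) + 1)
  have hγα : 0 < γ * α := by positivity
  have hJ1 : 1 ≤ J := by
    have : (1:ℝ) ≤ J := by linarith [show 0 < 2 / (γ * α) by positivity]
    exact_mod_cast this
  have hJ2 : 2 ≤ J * (γ * α) := by rw [← div_le_iff₀ hγα]; linarith
  obtain ⟨C, hC, x₁, hx₁, hbd⟩ :=
    ha.convPow_Ioc_le_of_truncation hF hh hc hcs hs hT hω hE hJ1
  obtain ⟨D, hD, hge⟩ := ha.le_of_ge hF (β := α / 2) (by positivity) (by linarith)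
  refine ⟨C * (32 + D + D ^ J + 1), by positivity, x₁, hx₁, fun n x hx hax => ?_⟩
  have han : 0 < a n := by linarith [ha.one_le n]
  have hx0 : 0 < x := by linarith
  have hGx := hF.pos x
  set y := x / a n with hy
  have hy1 : 1 ≤ y := by rw [hy, le_div_iff₀ han]; linarith
  have hy0 : 0 < y := by linarith
  have hxy : x = a n * y := by rw [hy]; field_simp
  set b := a n * y ^ γ with hb
  have hyγ : 1 ≤ y ^ γ := Real.one_le_rpow hy1 (by positivity)
  have hab : a n ≤ b := by rw [hb]; nlinarith
  have hb0 : 0 < b := by linarith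
  have hGb := hF.pos b
  have t1 : exp (-x / (4 * b)) / a n ≤ 32 * (1 / x) := by
    have h1 : √y ≤ x / b := by
      rw [hxy, hb, mul_div_mul_left _ _ han.ne', ← Real.rpow_one_sub' hy0.le (by linarith),
        Real.sqrt_eq_rpow]
      exact Real.rpow_le_rpow_of_exponent_le hy1 (by linarith)
    have h2 : exp (-x / (4 * b)) ≤ exp (-√y / 4) := by
      refine Real.exp_le_exp.2 ?_
      rw [show -x / (4 * b) = -(x / b) / 4 by field_simp]
      linarith
    calc exp (-x / (4 * b)) / a n ≤ exp (-√y / 4) / a n := by gcongr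
      _ = y * exp (-√y / 4) * (1 / x) := by rw [hxy]; field_simp
      _ ≤ _ := by
        gcongr
        exact mul_exp_neg_sqrt_div_four_le hy0.le
  have t2 : n / a n * (max b (x ^ s) * (rtail F x / x)) ≤
      D * (1 / x) + n / a n * (x ^ s * (rtail F x / x)) := by
    have h1 : n * rtail F x ≤ D * y ^ (-(α / 2)) := hge n x hax
    have h2 : y ^ (-(α / 2)) * y ^ γ ≤ 1 := by
      rw [← Real.rpow_add hy0]
      exact Real.rpow_le_one_of_one_le_of_nonpos hy1 (by linarith)
    calc n / a n * (max b (x ^ s) * (rtail F x / x))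
        ≤ n / a n * ((b + x ^ s) * (rtail F x / x)) := by
          gcongr
          exact max_le_add_of_nonneg hb0.le (by positivity)
      _ = (n * rtail F x) * y ^ γ * (1 / x) + n / a n * (x ^ s * (rtail F x / x)) := by
          rw [hb]; field_simp
      _ ≤ (D * y ^ (-(α / 2))) * y ^ γ * (1 / x) + n / a n * (x ^ s * (rtail F x / x)) := by gcongr
      _ = D * (y ^ (-(α / 2)) * y ^ γ) * (1 / x) + n / a n * (x ^ s * (rtail F x / x)) := by ring
      _ ≤ D * 1 * (1 / x) + n / a n * (x ^ s * (rtail F x / x)) := by gcongr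
      _ = _ := by ring
  have t3 : (n * rtail F b) ^ J / a n ≤ D ^ J * (1 / x) := by
    have h1 : n * rtail F b ≤ D * (y ^ γ) ^ (-(α / 2)) := by
      have := hge n b hab
      rwa [show b / a n = y ^ γ by rw [hb]; field_simp] at this
    have h2 : ((y ^ γ) ^ (-(α / 2))) ^ J ≤ y ^ (-1 : ℝ) := by
      rw [← Real.rpow_mul hy0.le, ← Real.rpow_mul_natCast hy0.le]
      exact Real.rpow_le_rpow_of_exponent_le hy1 (by nlinarith)
    calc (n * rtail F b) ^ J / a n ≤ (D * (y ^ γ) ^ (-(α / 2))) ^ J / a n := by gcongr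
      _ = D ^ J * ((y ^ γ) ^ (-(α / 2))) ^ J / a n := by rw [mul_pow]
      _ ≤ D ^ J * y ^ (-1 : ℝ) / a n := by gcongr
      _ = _ := by rw [Real.rpow_neg_one, hxy]; field_simp
  have h0 := ENNReal.toReal_mono ENNReal.ofReal_ne_top (hbd n x b hx hab)
  rw [ENNReal.toReal_ofReal (by positivity)] at h0
  refine h0.trans ?_
  have e1 : 0 < 1 / x := by positivity
  have e2 : 0 ≤ n / a n * (x ^ s * (rtail F x / x)) := by positivity
  calc _ ≤ C * (32 * (1 / x) + (D * (1 / x) + n / a n * (x ^ s * (rtail F x / x))) +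
        D ^ J * (1 / x)) := by gcongr
    _ ≤ C * ((32 + D + D ^ J + 1) * (1 / x) +
        (32 + D + D ^ J + 1) * (n / a n * (x ^ s * (rtail F x / x)))) := by
        refine mul_le_mul_of_nonneg_left ?_ hC.le
        have : 0 ≤ (31 + D + D ^ J + 1) * (n / a n * (x ^ s * (rtail F x / x))) := by positivity
        linarith
    _ = _ := by ring

lemma ScaleSeq.exists_nat_div_le (hF : RegTail F α) (ha : ScaleSeq F α a) {τ : ℝ} (hτ : 0 < τ)
    (hτ1 : τ < 1) :
    ∃ C > 0, ∀ n : ℕ, 1 ≤ n → n / a n ≤ C * (n : ℝ) ^ (τ - 1) := by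
  have hβ : α < 1 / (2 - τ) := by
    refine hF.α_le.trans_lt ?_
    rw [div_lt_div_iff₀ two_pos (by linarith)]; linarith
  obtain ⟨C, hC, hle⟩ := ha.nat_le_rpow hF hβ
  refine ⟨C ^ (2 - τ), by positivity, fun n hn => ?_⟩
  have han : 0 < a n := by linarith [ha.one_le n]
  have hn0 : (0:ℝ) < n := by exact_mod_cast hn
  have h1 : (n:ℝ) ^ (2 - τ) ≤ C ^ (2 - τ) * a n := by
    have := Real.rpow_le_rpow hn0.le (hle n) (by linarith : 0 ≤ 2 - τ)
    rwa [Real.mul_rpow hC.le (by positivity), ← Real.rpow_mul han.le,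
      one_div_mul_cancel (by linarith), Real.rpow_one] at this
  rw [div_le_iff₀ han]
  calc (n:ℝ) = n ^ (2 - τ) * n ^ (τ - 1) := by
        rw [← Real.rpow_add hn0]; norm_num
    _ ≤ (C ^ (2 - τ) * a n) * n ^ (τ - 1) := by gcongr
    _ = _ := by ring

/-- The contribution of the small indices `n < δ / F̄(x)` to the renewal measure of `(x, x+h]`. -/
lemma ScaleSeq.sum_small_le (hF : RegTail F α) (ha : ScaleSeq F α a) {h c s T : ℝ}
    (hh : 0 < h) (hc : 0 < c) (hcs : c ≤ s) (hs : s < 2 * α) (hT : 0 ≤ T)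
    (hω : (fun x => omegaFn F h x) =O[atTop] fun x => x ^ c)
    (hE : DensityAtScale {x : ℝ | 0 ≤ x ∧ T < omegaFn F h x} c s) :
    ∃ C > 0, ∃ δ₀ > 0, ∀ δ, 0 < δ → δ ≤ δ₀ → ∀ᶠ x in atTop,
      x * rtail F x * ∑ n ∈ Finset.Ico 1 ⌈δ / rtail F x⌉₊, (convPow F n).real (Ioc x (x + h)) ≤
        C * δ := by
  have hα := hF.α_pos
  have hα' := hF.α_le
  obtain ⟨C, hC, x₁, hx₁, hloc⟩ :=
    ha.convPow_Ioc_le_inv hF hh hc hcs (by linarith) hT hω hE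
  obtain ⟨B, hB, htb⟩ := ha.tail_bounds hF
  set τ := (1 - s / (2 * α)) / 4 with hτ
  have hsα : s / (2 * α) < 1 := by rw [div_lt_one (by positivity)]; exact hs
  have hsα0 : 0 < s / (2 * α) := by have := hc.trans_le hcs; positivity
  have hτ0 : 0 < τ := by rw [hτ]; linarith
  have hτ1 : τ < 1 / 4 := by rw [hτ]; linarith
  obtain ⟨P, hP, hna⟩ := ha.exists_nat_div_le hF hτ0 (by linarith)
  have hsum : Summable fun n : ℕ => (n : ℝ) ^ (-(1 + τ)) := by
    rw [Real.summable_nat_rpow]; linarith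
  set S := ∑' n : ℕ, (n : ℝ) ^ (-(1 + τ)) with hS
  have hlim : Tendsto (fun x => P * S * (x ^ s * rtail F x ^ (2 - 2 * τ))) atTop (𝓝 0) := by
    obtain ⟨D, hD, hup⟩ := hF.upper (β := α * (1 - τ)) (by nlinarith) (by nlinarith)
    have hG1 := hF.pos 1
    have he : 0 < α * (1 - τ) * (2 - 2 * τ) - s := by
      have hs' : s = 2 * α * (1 - 4 * τ) := by rw [hτ]; field_simp; ring
      rw [hs']
      nlinarith [mul_pos hα hτ0, sq_nonneg τ]
    have h1 := (tendsto_rpow_neg_atTop he).const_mul (P * S * (D * rtail F 1) ^ (2 - 2 * τ))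
    rw [mul_zero] at h1
    have hS0 : 0 ≤ S := tsum_nonneg fun n => by positivity
    refine squeeze_zero' ?_ ?_ h1
    · filter_upwards [eventually_ge_atTop 1] with x hx
      have := hF.pos x
      have : 0 < x := by linarith
      positivity
    · filter_upwards [eventually_ge_atTop 1] with x hx
      have hGx := hF.pos x
      have hx0 : 0 < x := by linarith
      have h2 := hup 1 x le_rfl hx
      rw [div_one] at h2
      have h3 : rtail F x ^ (2 - 2 * τ) ≤
          (D * rtail F 1) ^ (2 - 2 * τ) * x ^ (-(α * (1 - τ) * (2 - 2 * τ))) := by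
        calc _ ≤ (D * x ^ (-(α * (1 - τ))) * rtail F 1) ^ (2 - 2 * τ) :=
              Real.rpow_le_rpow hGx.le h2 (by linarith)
          _ = ((D * rtail F 1) * x ^ (-(α * (1 - τ)))) ^ (2 - 2 * τ) := by ring_nf
          _ = _ := by
              rw [Real.mul_rpow (by positivity) (by positivity), ← Real.rpow_mul hx0.le]
              congr 2; ring
      calc _ ≤ P * S * (x ^ s * ((D * rtail F 1) ^ (2 - 2 * τ) *
            x ^ (-(α * (1 - τ) * (2 - 2 * τ))))) := by gcongr
        _ = P * S * (D * rtail F 1) ^ (2 - 2 * τ) *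
            (x ^ s * x ^ (-(α * (1 - τ) * (2 - 2 * τ)))) := by ring
        _ = _ := by
            rw [← Real.rpow_add hx0]
            congr 2; ring
  refine ⟨2 * C, by positivity, 1 / B, by positivity, fun δ hδ hδ₀ => ?_⟩
  have hδ1 : δ ≤ 1 := hδ₀.trans (by rw [div_le_one (by linarith)]; exact hB)
  filter_upwards [eventually_ge_atTop x₁, hlim.eventually (ge_mem_nhds hδ)] with x hx hxl
  have hGx := hF.pos x
  have hx0 : 0 < x := by linarith
  set N := ⌈δ / rtail F x⌉₊ with hN
  have hnN : ∀ n ∈ Finset.Ico 1 N, 1 ≤ n ∧ n < δ / rtail F x := fun n hn => by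
    rw [Finset.mem_Ico] at hn
    exact ⟨hn.1, Nat.lt_ceil.1 hn.2⟩
  have hcard : ((Finset.Ico 1 N).card : ℝ) ≤ δ / rtail F x := by
    rw [Nat.card_Ico]
    have h1 : (N:ℝ) < δ / rtail F x + 1 := Nat.ceil_lt_add_one (by positivity)
    have h2 : 1 ≤ N := Nat.one_le_ceil_iff.2 (by positivity)
    rw [Nat.cast_sub h2, Nat.cast_one]
    linarith
  have hterm : ∀ n ∈ Finset.Ico 1 N, (convPow F n).real (Ioc x (x + h)) ≤
      C * (1 / x) + C * (x ^ s * (rtail F x / x)) * (P * ((1 / rtail F x) ^ (2 * τ) *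
        (n:ℝ) ^ (-(1 + τ)))) := fun n hn => by
    obtain ⟨hn1, hn2⟩ := hnN n hn
    have hn0 : (0:ℝ) < n := by exact_mod_cast hn1
    have hax : a n ≤ x := by
      by_contra hcon
      have h1 := (htb n hn1).1
      have h2 := rtail_antitone F (not_le.1 hcon).le
      rw [lt_div_iff₀ hGx] at hn2
      have h3 : B * (n * rtail F (a n)) ≤ B * (n * rtail F x) := by gcongr
      have h4 : B * (n * rtail F x) < B * (1 / B) := by
        gcongr
        linarith
      rw [mul_one_div_cancel (by linarith)] at h4
      linarith
    have h5 : (n:ℝ) / a n ≤ P * ((1 / rtail F x) ^ (2 * τ) * (n:ℝ) ^ (-(1 + τ))) := by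
      refine (hna n hn1).trans ?_
      gcongr
      calc (n:ℝ) ^ (τ - 1) = (n:ℝ) ^ (2 * τ) * (n:ℝ) ^ (-(1 + τ)) := by
            rw [← Real.rpow_add hn0]; congr 1; ring
        _ ≤ _ := by
            gcongr
            exact hn2.le.trans (by gcongr)
    calc _ ≤ C * (1 / x + n / a n * (x ^ s * (rtail F x / x))) := hloc n x hx hax
      _ = C * (1 / x) + C * (x ^ s * (rtail F x / x)) * (n / a n) := by ring
      _ ≤ _ := by gcongr
  have hsumle : ∑ n ∈ Finset.Ico 1 N, (n:ℝ) ^ (-(1 + τ)) ≤ S :=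
    hsum.sum_le_tsum _ fun n _ => by positivity
  have hG2 : rtail F x ^ (2 - 2 * τ) = rtail F x ^ 2 * (1 / rtail F x) ^ (2 * τ) := by
    rw [Real.rpow_sub hGx, one_div, Real.inv_rpow hGx.le, div_eq_mul_inv, Real.rpow_two]
  calc _ ≤ x * rtail F x * ∑ n ∈ Finset.Ico 1 N, (C * (1 / x) +
        C * (x ^ s * (rtail F x / x)) * (P * ((1 / rtail F x) ^ (2 * τ) *
        (n:ℝ) ^ (-(1 + τ))))) := by
        gcongr with n hn
        exact hterm n hn
    _ = C * (rtail F x * (Finset.Ico 1 N).card) + C * (P * (∑ n ∈ Finset.Ico 1 N,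
        (n:ℝ) ^ (-(1 + τ))) * (x ^ s * rtail F x ^ (2 - 2 * τ))) := by
        rw [Finset.sum_add_distrib, Finset.sum_const, nsmul_eq_mul, ← Finset.mul_sum,
          ← Finset.mul_sum, ← Finset.mul_sum, hG2]
        field_simp
    _ ≤ C * (rtail F x * (δ / rtail F x)) + C * (P * S * (x ^ s * rtail F x ^ (2 - 2 * τ))) := by
        gcongr
    _ ≤ C * δ + C * δ := by
        rw [mul_div_cancel₀ _ hGx.ne']
        gcongr
    _ = _ := by ring

end SmallSum

section Weight

lemma lintegral_mul_le_of_window {f w : ℝ → ℝ≥0∞} (hf : Measurable f) (hw : Measurable w)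
    {K D : ℝ≥0∞} (hwK : ∀ t u, u ≤ t → t ≤ u + 1 → w t ≤ K * w u)
    (hD : ∀ u, ∫⁻ t in Ioc u (u + 1), f t ≤ D) :
    ∫⁻ t, w t * f t ≤ K * D * ∫⁻ u, w u := by
  have hS : MeasurableSet {p : ℝ × ℝ | p.2 < p.1 ∧ p.1 ≤ p.2 + 1} :=
    (measurableSet_lt measurable_snd measurable_fst).inter
      (measurableSet_le measurable_fst (measurable_snd.add_const 1))
  have hmeas : Measurable fun p : ℝ × ℝ => K * w p.2 * (Ioc p.2 (p.2 + 1)).indicator f p.1 :=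
    ((hw.comp measurable_snd).const_mul K).mul ((hf.comp measurable_fst).indicator hS)
  calc ∫⁻ t, w t * f t
      ≤ ∫⁻ t, ∫⁻ u, K * w u * (Ioc u (u + 1)).indicator f t := by
        refine lintegral_mono fun t => ?_
        calc w t * f t = ∫⁻ u in Ico (t - 1) t, w t * f t := by simp
          _ ≤ ∫⁻ u in Ico (t - 1) t, K * w u * (Ioc u (u + 1)).indicator f t := by
              refine setLIntegral_mono' measurableSet_Ico fun u hu => ?_
              have h1 : t ∈ Ioc u (u + 1) := ⟨hu.2, by linarith [hu.1]⟩
              rw [indicator_of_mem h1]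
              gcongr
              exact hwK t u hu.2.le h1.2
          _ ≤ _ := setLIntegral_le_lintegral _ _
    _ = ∫⁻ u, ∫⁻ t, K * w u * (Ioc u (u + 1)).indicator f t :=
        lintegral_lintegral_swap hmeas.aemeasurable
    _ ≤ ∫⁻ u, K * w u * D := by
        refine lintegral_mono fun u => ?_
        rw [lintegral_const_mul _ (hf.indicator measurableSet_Ioc),
          lintegral_indicator measurableSet_Ioc]
        gcongr
        exact hD u
    _ = _ := by
        rw [lintegral_mul_const _ (hw.const_mul K), lintegral_const_mul _ hw]
        ring

/-- The weight `(1 + t²)^{-3/4}`. -/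
def weight (t : ℝ) : ℝ := (1 + t ^ 2) ^ (-(3 / 4) : ℝ)

lemma weight_pos (t : ℝ) : 0 < weight t := by unfold weight; positivity

lemma continuous_weight : Continuous weight := by
  unfold weight
  exact Continuous.rpow_const (by fun_prop) fun t => Or.inl (by positivity)

lemma integrable_weight : Integrable weight := by
  have := integrable_rpow_neg_one_add_norm_sq (E := ℝ) (r := 3 / 2) (μ := volume)
    (by norm_num)
  change Integrable fun t : ℝ => (1 + t ^ 2) ^ (-(3 / 4) : ℝ)
  simpa [show (-(3 / 2) / 2 : ℝ) = -(3 / 4) by norm_num] using this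

lemma weight_le_mul_weight {t u : ℝ} (h1 : u ≤ t) (h2 : t ≤ u + 1) : weight t ≤ 3 * weight u := by
  unfold weight
  have h3 : (1 + u ^ 2) ≤ 3 * (1 + t ^ 2) := by nlinarith [sq_nonneg (2 * t - u), sq_nonneg t]
  have h4 : (3 * (1 + t ^ 2)) ^ (-(3 / 4) : ℝ) ≤ (1 + u ^ 2) ^ (-(3 / 4) : ℝ) :=
    Real.rpow_le_rpow_of_nonpos (by positivity) h3 (by norm_num)
  rw [Real.mul_rpow (by norm_num) (by positivity)] at h4
  have h5 : (3:ℝ)⁻¹ ≤ 3 ^ (-(3 / 4) : ℝ) := by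
    rw [← Real.rpow_neg_one]
    exact Real.rpow_le_rpow_of_exponent_le (by norm_num) (by norm_num)
  have h6 : 0 < (1 + t ^ 2) ^ (-(3 / 4) : ℝ) := by positivity
  nlinarith

variable {F : Measure ℝ} [IsProbabilityMeasure F] {α : ℝ} {a : ℕ → ℝ}

lemma integrable_weight_mul_norm_charFun_pow (n : ℕ) :
    Integrable fun t => weight t * ‖charFun F t‖ ^ n := by
  have hcont : Continuous (charFun F) := continuous_charFun
  refine integrable_weight.mul_bdd (c := 1) (by fun_prop) (ae_of_all _ fun t => ?_)
  rw [norm_pow, norm_norm]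
  exact pow_le_one₀ (norm_nonneg _) (norm_charFun_le_one t)

lemma ScaleSeq.integral_weight_le (hF : RegTail F α) (ha : ScaleSeq F α a) :
    ∃ C > 0, ∀ n : ℕ, 1 ≤ n → ∫ t, weight t * ‖charFun F t‖ ^ n ≤ C / a n := by
  obtain ⟨D, hD, hDb⟩ := ha.integral_norm_charFun_pow_le hF 1
  have hW : 0 < ∫ t, weight t := by
    rw [integral_pos_iff_support_of_nonneg (fun t => (weight_pos t).le) integrable_weight]
    have : Function.support weight = univ := by ext t; simp [(weight_pos t).ne']
    simp [this]
  have hcont : Continuous (charFun F) := continuous_charFun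
  refine ⟨3 * D * ∫ t, weight t, by positivity, fun n hn => ?_⟩
  have ha0 : 0 < a n := lt_of_lt_of_le one_pos (ha.one_le n)
  have key := lintegral_mul_le_of_window (f := fun t => ENNReal.ofReal (‖charFun F t‖ ^ n))
    (w := fun t => ENNReal.ofReal (weight t)) (K := 3) (D := ENNReal.ofReal (D / a n))
    (by fun_prop) (continuous_weight.measurable.ennreal_ofReal) (fun t u h1 h2 => by
      rw [show (3:ℝ≥0∞) = ENNReal.ofReal 3 by simp, ← ENNReal.ofReal_mul (by norm_num)]
      exact ENNReal.ofReal_le_ofReal (weight_le_mul_weight h1 h2)) (fun u => by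
      have hi : IntervalIntegrable (fun t => ‖charFun F t‖ ^ n) volume u (u + 1) :=
        (hcont.norm.pow n).intervalIntegrable _ _
      rw [← ofReal_integral_eq_lintegral_ofReal hi.1 (ae_of_all _ fun t => by positivity),
        ← intervalIntegral.integral_of_le (by linarith)]
      exact ENNReal.ofReal_le_ofReal (hDb n hn u))
  rw [← ofReal_integral_eq_lintegral_ofReal integrable_weight
    (ae_of_all _ fun t => (weight_pos t).le)] at key
  simp only [← ENNReal.ofReal_mul (weight_pos _).le] at key
  rw [← ofReal_integral_eq_lintegral_ofReal (integrable_weight_mul_norm_charFun_pow n)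
    (ae_of_all _ fun t => mul_nonneg (weight_pos t).le (by positivity)),
    show (3:ℝ≥0∞) = ENNReal.ofReal 3 by simp, ← ENNReal.ofReal_mul (by norm_num),
    ← ENNReal.ofReal_mul (by positivity), ENNReal.ofReal_le_ofReal_iff (by positivity)] at key
  refine key.trans (le_of_eq ?_)
  ring

end Weight

section Ceil

lemma mul_tsum_eq_integral_ceil {f : ℕ → ℂ} {M : ℕ} {b : ℝ} (hb : 0 < b)
    (hf : Summable fun m => ‖f (M + 1 + m)‖) :
    b * ∑' m, f (M + 1 + m) = ∫ v in Ioi (M * b), f ⌈v / b⌉₊ := by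
  set s : ℕ → Set ℝ := fun m => Ioc ((M + m : ℕ) * b) ((M + 1 + m : ℕ) * b) with hs
  have hceil : ∀ m v, v ∈ s m ↔ ⌈v / b⌉₊ = M + 1 + m := fun m v => by
    rw [Nat.ceil_eq_iff (by omega), lt_div_iff₀ hb, div_le_iff₀ hb,
      show M + 1 + m - 1 = M + m by omega]
    rfl
  have hU : (⋃ m, s m) = Ioi (M * b) := by
    ext v
    simp only [mem_iUnion, hceil, mem_Ioi]
    rw [← lt_div_iff₀ hb, ← Nat.lt_ceil]
    constructor
    · rintro ⟨m, hm⟩; omega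
    · intro h; exact ⟨⌈v / b⌉₊ - (M + 1), by omega⟩
  have hsm : ∀ m, MeasurableSet (s m) := fun m => measurableSet_Ioc
  have hdisj : Pairwise (Function.onFun Disjoint s) := fun i j hij =>
    Set.disjoint_left.2 fun v h1 h2 => hij (by
      have h3 := (hceil _ _).1 h1
      have h4 := (hceil _ _).1 h2
      omega)
  have hvol : ∀ m, volume.real (s m) = b := fun m => by
    rw [hs]
    simp only [measureReal_def, Real.volume_Ioc]
    rw [ENNReal.toReal_ofReal]
    · push_cast; ring
    · push_cast; nlinarith
  have hfin : ∀ m, volume (s m) ≠ ∞ := fun m => by simp [hs]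
  have hInt : ∀ m, IntegrableOn (fun v => f ⌈v / b⌉₊) (s m) := fun m => by
    have h1 : IntegrableOn (fun _ : ℝ => f (M + 1 + m)) (s m) := integrableOn_const (hfin m)
    exact h1.congr_fun (fun v hv => by simp only [(hceil m v).1 hv]) (hsm m)
  have hnorm : ∀ m, ∫ v in s m, ‖f ⌈v / b⌉₊‖ = b * ‖f (M + 1 + m)‖ := fun m => by
    rw [setIntegral_congr_fun (hsm m) (g := fun _ => ‖f (M + 1 + m)‖)
      (fun v hv => by simp only [(hceil m v).1 hv]), setIntegral_const, hvol, smul_eq_mul]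
  have hIU : IntegrableOn (fun v => f ⌈v / b⌉₊) (⋃ m, s m) :=
    integrableOn_iUnion_of_summable_integral_norm hInt (by
      simp only [hnorm]; exact hf.mul_left b)
  rw [← hU, ← (hasSum_integral_iUnion hsm hdisj hIU).tsum_eq, ← tsum_mul_left]
  congr 1 with m
  rw [setIntegral_congr_fun (hsm m) (g := fun _ => f (M + 1 + m))
      (fun v hv => by simp only [(hceil m v).1 hv]), setIntegral_const, hvol]
  simp

end Ceil

section ScaledSum

variable {F : Measure ℝ} [IsProbabilityMeasure F] {α : ℝ} {a : ℕ → ℝ}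

lemma le_rpow_of_le_mul_rpow_neg {C v q p : ℝ} (hC : 0 < C) (hv : 0 < v) (hq : 0 < q) (hp : 0 < p)
    (h : v ≤ C * q ^ (-p)) : q ≤ C ^ p⁻¹ * v ^ (-p⁻¹) := by
  have h1 : q ^ p ≤ C * v⁻¹ := by
    rw [Real.rpow_neg hq.le] at h
    have : 0 < q ^ p := by positivity
    field_simp at h ⊢
    linarith
  have h2 := Real.rpow_le_rpow (by positivity) h1 (inv_nonneg.2 hp.le)
  rwa [← Real.rpow_mul hq.le, mul_inv_cancel₀ hp.ne', Real.rpow_one,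
    Real.mul_rpow hC.le (by positivity), Real.inv_rpow hv.le, ← Real.rpow_neg hv.le] at h2

lemma ScaleSeq.summable_inv (hF : RegTail F α) (ha : ScaleSeq F α a) :
    Summable fun n => (a n)⁻¹ := by
  obtain ⟨C, hC, h⟩ := ha.nat_le_rpow hF (β := 3 / 4) (by linarith [hF.α_le])
  have hs : Summable fun n : ℕ => C ^ (3 / 4 : ℝ)⁻¹ * (n:ℝ) ^ (-(3 / 4 : ℝ)⁻¹) :=
    (Real.summable_nat_rpow.2 (by norm_num)).mul_left _
  refine Summable.of_norm_bounded_eventually_nat hs ?_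
  filter_upwards [eventually_ge_atTop 1] with n hn
  have ha0 : 0 < a n := lt_of_lt_of_le one_pos (ha.one_le n)
  have hn0 : (0:ℝ) < n := by exact_mod_cast hn
  rw [Real.norm_of_nonneg (by positivity)]
  refine le_rpow_of_le_mul_rpow_neg hC hn0 (by positivity) (by norm_num) ?_
  rw [Real.inv_rpow ha0.le, Real.rpow_neg ha0.le, inv_inv]
  exact h n

lemma ScaleSeq.div_le (hF : RegTail F α) (ha : ScaleSeq F α a) :
    ∃ C > 0, ∀ x v, 1 ≤ x → 0 < v →
      x / a ⌈v / rtail F x⌉₊ ≤ C * (v ^ (-(3 / 4 : ℝ)⁻¹) + v ^ (-(α / 2)⁻¹)) := by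
  have hα := hF.α_pos
  obtain ⟨C, hC, h1⟩ := ha.le_of_le hF (β := 3 / 4) (by linarith [hF.α_le])
  obtain ⟨D, hD, h2⟩ := ha.le_of_ge hF (β := α / 2) (by linarith) (by linarith)
  refine ⟨C ^ (3 / 4 : ℝ)⁻¹ + D ^ (α / 2)⁻¹, by positivity, fun x v hx hv => ?_⟩
  have hG := hF.pos x
  set n := ⌈v / rtail F x⌉₊
  have hn : v ≤ n * rtail F x := (div_le_iff₀ hG).1 (Nat.le_ceil _)
  have ha0 : 0 < a n := lt_of_lt_of_le one_pos (ha.one_le n)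
  have hx0 : 0 < x := by linarith
  have hp1 : 0 < v ^ (-(3 / 4 : ℝ)⁻¹) := by positivity
  have hp2 : 0 < v ^ (-(α / 2)⁻¹) := by positivity
  have hp3 : 0 < C ^ (3 / 4 : ℝ)⁻¹ := by positivity
  have hp4 : 0 < D ^ (α / 2)⁻¹ := by positivity
  rcases le_total x (a n) with hle | hle
  · have := le_rpow_of_le_mul_rpow_neg hC hv (q := x / a n) (by positivity) (p := 3 / 4)
      (by norm_num) (by
        rw [Real.rpow_neg (by positivity), ← Real.inv_rpow (by positivity), inv_div]
        exact hn.trans (h1 n x hx hle))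
    nlinarith
  · have := le_rpow_of_le_mul_rpow_neg hD hv (q := x / a n) (by positivity) (p := α / 2)
      (by positivity) (hn.trans (h2 n x hle))
    nlinarith

lemma RegTail.tendsto_ceil_mul (hF : RegTail F α) {v : ℝ} (hv : 0 < v) :
    Tendsto (fun x => ⌈v / rtail F x⌉₊ * rtail F x) atTop (𝓝 v) := by
  have h0 := (tendsto_rtail F).const_add v
  rw [add_zero] at h0
  refine tendsto_of_tendsto_of_tendsto_of_le_of_le tendsto_const_nhds h0 (fun x => ?_) fun x => ?_
  · exact (div_le_iff₀ (hF.pos x)).1 (Nat.le_ceil _)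
  · have h1 := Nat.ceil_lt_add_one (div_pos hv (hF.pos x)).le
    have hG := hF.pos x
    calc ⌈v / rtail F x⌉₊ * rtail F x ≤ (v / rtail F x + 1) * rtail F x := by gcongr
      _ = v + rtail F x := by field_simp

lemma RegTail.tendsto_ceil_atTop (hF : RegTail F α) {v : ℝ} (hv : 0 < v) :
    Tendsto (fun x => ⌈v / rtail F x⌉₊) atTop atTop := by
  refine tendsto_nat_ceil_atTop.comp ?_
  have h : Tendsto (rtail F) atTop (𝓝[>] 0) :=
    tendsto_nhdsWithin_iff.2 ⟨tendsto_rtail F, Eventually.of_forall hF.pos⟩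
  exact (h.inv_tendsto_nhdsGT_zero).const_mul_atTop hv

lemma ScaleSeq.tendsto_div_ceil (hF : RegTail F α) (ha : ScaleSeq F α a) {v : ℝ} (hv : 0 < v) :
    Tendsto (fun x => x / a ⌈v / rtail F x⌉₊) atTop (𝓝 (v ^ (-α⁻¹))) := by
  have h := ha.tendsto_div hF tendsto_id (hF.tendsto_ceil_atTop hv) hv (hF.tendsto_ceil_mul hv)
  have h1 := h.inv₀ (by positivity)
  rw [← Real.rpow_neg hv.le] at h1
  simpa only [inv_div, id] using h1

/-- Riemann-sum limit for sums over `n ≥ δ / F̄(x)` of quantities of order `1 / aₙ`. -/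
lemma ScaleSeq.tendsto_mul_tsum (hF : RegTail F α) (ha : ScaleSeq F α a) {f : ℕ → ℝ → ℂ} {K : ℝ}
    (hf : ∀ n, 1 ≤ n → ∀ x, ‖f n x‖ ≤ K / a n) {Φ : ℝ → ℂ}
    (hΦ : ∀ v, 0 < v → Tendsto (fun x => a ⌈v / rtail F x⌉₊ * f ⌈v / rtail F x⌉₊ x) atTop (𝓝 (Φ v)))
    {δ : ℝ} (hδ : 0 < δ) :
    Tendsto (fun x => ((x * rtail F x : ℝ) : ℂ) * ∑' m, f (⌈δ / rtail F x⌉₊ + m) x) atTop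
      (𝓝 (∫ v in Ioi δ, ((v ^ (-α⁻¹) : ℝ) : ℂ) * Φ v)) := by
  have hα := hF.α_pos
  have hapos : ∀ n, 0 < a n := fun n => lt_of_lt_of_le one_pos (ha.one_le n)
  obtain ⟨C, hC, hdiv⟩ := ha.div_le hF
  have hK : 0 ≤ K := by
    have h1 := (norm_nonneg _).trans (hf 1 le_rfl 0)
    by_contra! h2
    exact absurd h1 (not_le.2 (div_neg_of_neg_of_pos h2 (hapos 1)))
  have hN : ∀ x, ∃ M : ℕ, ⌈δ / rtail F x⌉₊ = M + 1 := fun x =>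
    ⟨⌈δ / rtail F x⌉₊ - 1, by have := Nat.ceil_pos.2 (div_pos hδ (hF.pos x)); omega⟩
  choose M hM using hN
  have hMG : ∀ x, M x * rtail F x < δ := fun x => by
    have h1 : M x < ⌈δ / rtail F x⌉₊ := by rw [hM]; omega
    exact (lt_div_iff₀ (hF.pos x)).1 (Nat.lt_ceil.1 h1)
  have hMG' : Tendsto (fun x => M x * rtail F x) atTop (𝓝 δ) := by
    have h1 := (hF.tendsto_ceil_mul hδ).sub (tendsto_rtail F)
    rw [sub_zero] at h1
    refine h1.congr fun x => ?_
    rw [hM]; push_cast; ring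
  have hsum : ∀ x, Summable fun m => ‖f (M x + 1 + m) x‖ := fun x => by
    have h1 : Summable fun m => K * (a (m + (M x + 1)))⁻¹ :=
      ((summable_nat_add_iff (M x + 1)).2 (ha.summable_inv hF)).mul_left K
    refine Summable.of_nonneg_of_le (fun m => norm_nonneg _) (fun m => ?_) h1
    rw [add_comm m, ← div_eq_mul_inv]
    exact hf _ (by omega) x
  have hMlarge : ∀ᶠ x in atTop, δ / 2 < M x * rtail F x :=
    hMG'.eventually (lt_mem_nhds (by linarith))
  have hrep : (fun x => ∫ v in Ioi (δ / 2), (Ioi (M x * rtail F x)).indicator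
        (fun v => (x : ℂ) * f ⌈v / rtail F x⌉₊ x) v) =ᶠ[atTop]
      fun x => ((x * rtail F x : ℝ) : ℂ) * ∑' m, f (⌈δ / rtail F x⌉₊ + m) x := by
    filter_upwards [hMlarge] with x hx
    have hsub : Ioi (M x * rtail F x) ⊆ Ioi (δ / 2) := Ioi_subset_Ioi hx.le
    have h1 := mul_tsum_eq_integral_ceil (f := fun n => f n x) (hF.pos x) (hsum x)
    rw [setIntegral_indicator measurableSet_Ioi, inter_eq_self_of_subset_right hsub,
      integral_const_mul, ← h1, hM]
    push_cast
    ring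
  have hlim : ∫ v in Ioi δ, ((v ^ (-α⁻¹) : ℝ) : ℂ) * Φ v =
      ∫ v in Ioi (δ / 2), (Ioi δ).indicator (fun v => ((v ^ (-α⁻¹) : ℝ) : ℂ) * Φ v) v := by
    have hsub : Ioi δ ⊆ Ioi (δ / 2) := Ioi_subset_Ioi (by linarith)
    rw [setIntegral_indicator measurableSet_Ioi, inter_eq_self_of_subset_right hsub]
  rw [hlim]
  refine Tendsto.congr' hrep ?_
  refine tendsto_integral_filter_of_dominated_convergence
    (fun v => K * (C * (v ^ (-(3 / 4 : ℝ)⁻¹) + v ^ (-(α / 2)⁻¹)))) ?_ ?_ ?_ ?_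
  · refine Eventually.of_forall fun x => Measurable.aestronglyMeasurable ?_
    refine Measurable.indicator ?_ measurableSet_Ioi
    refine Measurable.const_mul ?_ _
    exact (measurable_from_top (f := fun n : ℕ => f n x)).comp
      (Nat.measurable_ceil.comp (measurable_id.div_const _))
  · filter_upwards [eventually_ge_atTop 1] with x hx
    refine (ae_restrict_iff' measurableSet_Ioi).2 (ae_of_all _ fun v hv => ?_)
    have hv0 : 0 < v := (half_pos hδ).trans hv
    refine (norm_indicator_le_norm_self _ _).trans ?_
    rw [norm_mul, Complex.norm_real, Real.norm_of_nonneg (by linarith)]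
    have hn : 1 ≤ ⌈v / rtail F x⌉₊ := Nat.ceil_pos.2 (div_pos hv0 (hF.pos x))
    calc x * ‖f ⌈v / rtail F x⌉₊ x‖ ≤ x * (K / a ⌈v / rtail F x⌉₊) := by gcongr; exact hf _ hn x
      _ = K * (x / a ⌈v / rtail F x⌉₊) := by ring
      _ ≤ _ := by gcongr; exact hdiv x v hx hv0
  · refine Integrable.const_mul (Integrable.const_mul (Integrable.add ?_ ?_) _) _
    · exact integrableOn_Ioi_rpow_of_lt (by norm_num) (half_pos hδ)
    · refine integrableOn_Ioi_rpow_of_lt ?_ (half_pos hδ)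
      rw [neg_lt_neg_iff, one_lt_inv₀ (by linarith)]
      linarith [hF.α_le]
  · refine (ae_restrict_iff' measurableSet_Ioi).2 ?_
    have hne : ∀ᵐ v : ℝ, v ≠ δ := by simp [ae_iff, measure_singleton]
    filter_upwards [hne] with v hvδ hv
    have hv0 : 0 < v := (half_pos hδ).trans hv
    rcases lt_or_gt_of_ne hvδ with hlt | hlt
    · rw [indicator_of_notMem (by simpa using hlt.le)]
      refine tendsto_const_nhds.congr' ?_
      filter_upwards [hMG'.eventually (lt_mem_nhds hlt)] with x hx
      rw [indicator_of_notMem (by simpa using hx.le)]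
    · rw [indicator_of_mem (by simpa using hlt)]
      have h1 : Tendsto (fun x : ℝ => ((x / a ⌈v / rtail F x⌉₊ : ℝ) : ℂ)) atTop
          (𝓝 ((v ^ (-α⁻¹) : ℝ) : ℂ)) :=
        (Complex.continuous_ofReal.tendsto _).comp (ha.tendsto_div_ceil hF hv0)
      refine (h1.mul (hΦ v hv0)).congr fun x => ?_
      rw [indicator_of_mem (by simpa using (hMG x).trans hlt)]
      have : (a ⌈v / rtail F x⌉₊ : ℂ) ≠ 0 := by exact_mod_cast (hapos ⌈v / rtail F x⌉₊).ne'
      push_cast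
      field_simp

end ScaledSum

section Near

variable {F : Measure ℝ} [IsProbabilityMeasure F] {α : ℝ} {a : ℕ → ℝ}

/-- The Fourier coefficient `∫ k(t) e^{-itz} φ(t)^n dt`. -/
def fcoef (F : Measure ℝ) (k : ℝ → ℂ) (n : ℕ) (z : ℝ) : ℂ :=
  ∫ t, k t * Complex.exp (-(t * z * Complex.I)) * charFun F t ^ n

lemma norm_exp_neg_mul_I (t z : ℝ) : ‖Complex.exp (-(t * z * Complex.I))‖ = 1 := by
  rw [show (-(t * z * Complex.I) : ℂ) = ((-(t * z) : ℝ) : ℂ) * Complex.I by push_cast; ring,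
    Complex.norm_exp_ofReal_mul_I]

lemma integrable_fcoef {k : ℝ → ℂ} (hk : Integrable k) (n : ℕ) (z : ℝ) :
    Integrable fun t => k t * Complex.exp (-(t * z * Complex.I)) * charFun F t ^ n := by
  have hcont : Continuous (charFun F) := continuous_charFun
  refine (hk.mul_bdd (c := 1) (by fun_prop) (ae_of_all _ fun t => ?_)).mul_bdd (c := 1) (by fun_prop)
    (ae_of_all _ fun t => ?_)
  · rw [norm_exp_neg_mul_I]
  · rw [norm_pow]
    exact pow_le_one₀ (norm_nonneg _) (norm_charFun_le_one t)

lemma ScaleSeq.norm_fcoef_le (hF : RegTail F α) (ha : ScaleSeq F α a) :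
    ∃ C > 0, ∀ (k : ℝ → ℂ) (M : ℝ), (∀ t, ‖k t‖ ≤ M * weight t) → ∀ n : ℕ, 1 ≤ n → ∀ z,
      ‖fcoef F k n z‖ ≤ C * M / a n := by
  obtain ⟨C, hC, h⟩ := ha.integral_weight_le hF
  refine ⟨C, hC, fun k M hk n hn z => ?_⟩
  have hM : 0 ≤ M := by
    have := (norm_nonneg _).trans (hk 0)
    exact nonneg_of_mul_nonneg_left this (weight_pos 0)
  calc ‖fcoef F k n z‖ ≤ ∫ t, M * (weight t * ‖charFun F t‖ ^ n) := by
        refine norm_integral_le_of_norm_le ((integrable_weight_mul_norm_charFun_pow n).const_mul M)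
          (ae_of_all _ fun t => ?_)
        rw [norm_mul, norm_mul, norm_exp_neg_mul_I, mul_one, norm_pow, ← mul_assoc]
        gcongr
        exact hk t
    _ ≤ M * (C / a n) := by
        rw [integral_const_mul]
        gcongr
        exact h n hn
    _ = _ := by ring

lemma ScaleSeq.tendsto_fcoef (hF : RegTail F α) (ha : ScaleSeq F α a) :
    ∃ r > 0, ∀ (k : ℝ → ℂ), Measurable k → (∀ t, r < |t| → k t = 0) → ∀ M, (∀ t, ‖k t‖ ≤ M) →
      ContinuousAt k 0 → ∀ ψ : ℝ → ℂ,
      (∀ w, Tendsto (fun n : ℕ => charFun F (w / a n) ^ n) atTop (𝓝 (ψ w))) →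
      ∀ y : ℝ → ℝ, Tendsto (fun x => y x / x) atTop (𝓝 1) → ∀ v, 0 < v →
      Tendsto (fun x => a ⌈v / rtail F x⌉₊ * fcoef F k ⌈v / rtail F x⌉₊ (y x)) atTop
        (𝓝 (k 0 * ∫ w, ψ w * Complex.exp (-(w * (v ^ (-α⁻¹) : ℝ) * Complex.I)))) := by
  have hα := hF.α_pos
  obtain ⟨r, hr, -, K, hK, κ, hκ, hb⟩ := ha.norm_charFun_pow_le hF
  have hcont : Continuous (charFun F) := continuous_charFun
  have hapos : ∀ n, 0 < a n := fun n => lt_of_lt_of_le one_pos (ha.one_le n)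
  refine ⟨r, hr, fun k hkm hks M hkM hk0 ψ hψ y hy v hv => ?_⟩
  have hM : 0 ≤ M := (norm_nonneg _).trans (hkM 0)
  have hn := hF.tendsto_ceil_atTop hv
  have han : Tendsto (fun x => a ⌈v / rtail F x⌉₊) atTop atTop := (ha.tendsto_atTop hF).comp hn
  have hyn : Tendsto (fun x => y x / a ⌈v / rtail F x⌉₊) atTop (𝓝 (v ^ (-α⁻¹))) := by
    have h1 := hy.mul (ha.tendsto_div_ceil hF hv)
    rw [one_mul] at h1
    refine h1.congr' ?_
    filter_upwards [eventually_gt_atTop 0] with x hx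
    field_simp
  have hrep : ∀ x, a ⌈v / rtail F x⌉₊ * fcoef F k ⌈v / rtail F x⌉₊ (y x) =
      ∫ w, k (w / a ⌈v / rtail F x⌉₊) *
        Complex.exp (-(w * (y x / a ⌈v / rtail F x⌉₊ : ℝ) * Complex.I)) *
        charFun F (w / a ⌈v / rtail F x⌉₊) ^ ⌈v / rtail F x⌉₊ := fun x => by
    have h1 := Measure.integral_comp_div (fun t => k t * Complex.exp (-(t * y x * Complex.I)) *
      charFun F t ^ ⌈v / rtail F x⌉₊) (a ⌈v / rtail F x⌉₊)
    rw [abs_of_pos (hapos _), Complex.real_smul] at h1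
    rw [fcoef, ← h1]
    congr 1 with w
    push_cast
    ring_nf
  simp only [hrep]
  rw [← integral_const_mul]
  refine tendsto_integral_filter_of_dominated_convergence
    (fun w => M * (K * exp (-κ * |w| ^ (α / 2)))) ?_ ?_ ?_ ?_
  · refine Eventually.of_forall fun x => Measurable.aestronglyMeasurable ?_
    exact ((hkm.comp (measurable_id.div_const _)).mul (by fun_prop)).mul (by fun_prop)
  · filter_upwards [hn.eventually_ge_atTop 1] with x hx
    refine ae_of_all _ fun w => ?_
    have h1 := hapos ⌈v / rtail F x⌉₊
    rw [norm_mul, norm_mul, norm_exp_neg_mul_I, mul_one, norm_pow]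
    by_cases hw : r < |w / a ⌈v / rtail F x⌉₊|
    · rw [hks _ hw, norm_zero, zero_mul]; positivity
    · have h2 := hb _ hx (w / a ⌈v / rtail F x⌉₊) 0 (by simpa using hw)
        (by simpa using norm_charFun_le_one _)
      rw [sub_zero, mul_div_cancel₀ _ h1.ne'] at h2
      gcongr
      exact hkM _
  · exact ((integrable_exp_neg_abs_rpow hκ (half_pos hα)).const_mul K).const_mul M
  · refine ae_of_all _ fun w => ?_
    have h1 : Tendsto (fun x => w / a ⌈v / rtail F x⌉₊) atTop (𝓝 0) :=
      tendsto_const_nhds.div_atTop han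
    have h2 : Tendsto (fun x => k (w / a ⌈v / rtail F x⌉₊)) atTop (𝓝 (k 0)) := hk0.tendsto.comp h1
    have h3 := (hψ w).comp hn
    have h4 : Tendsto (fun x => Complex.exp (-(w * (y x / a ⌈v / rtail F x⌉₊ : ℝ) * Complex.I))) atTop
        (𝓝 (Complex.exp (-(w * (v ^ (-α⁻¹) : ℝ) * Complex.I)))) := by
      have : Continuous fun q : ℝ => Complex.exp (-(w * (q : ℂ) * Complex.I)) := by fun_prop
      exact (this.tendsto _).comp hyn
    have h5 := (h2.mul h4).mul h3
    rw [mul_assoc, mul_comm (Complex.exp _)] at h5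
    exact h5

end Near

section FourierSum

variable {F : Measure ℝ} [IsProbabilityMeasure F] {α : ℝ} {a : ℕ → ℝ}

lemma fcoef_add {k₁ k₂ : ℝ → ℂ} (h₁ : Integrable k₁) (h₂ : Integrable k₂) (n : ℕ) (z : ℝ) :
    fcoef F (fun t => k₁ t + k₂ t) n z = fcoef F k₁ n z + fcoef F k₂ n z := by
  unfold fcoef
  rw [← integral_add (integrable_fcoef h₁ n z) (integrable_fcoef h₂ n z)]
  congr 1 with t
  ring

lemma integrable_of_le_weight {k : ℝ → ℂ} (hk : Measurable k) {M : ℝ}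
    (h : ∀ t, ‖k t‖ ≤ M * weight t) : Integrable k :=
  (integrable_weight.const_mul M).mono' hk.aestronglyMeasurable (ae_of_all _ h)

lemma ScaleSeq.summable_norm_fcoef (hF : RegTail F α) (ha : ScaleSeq F α a) {k : ℝ → ℂ} {M : ℝ}
    (h : ∀ t, ‖k t‖ ≤ M * weight t) {N : ℕ} (hN : 1 ≤ N) (z : ℝ) :
    Summable fun m => ‖fcoef F k (N + m) z‖ := by
  obtain ⟨C, hC, hb⟩ := ha.norm_fcoef_le hF
  have h1 : Summable fun m => C * M * (a (m + N))⁻¹ :=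
    ((summable_nat_add_iff N).2 (ha.summable_inv hF)).mul_left _
  refine Summable.of_nonneg_of_le (fun m => norm_nonneg _) (fun m => ?_) h1
  rw [add_comm m, ← div_eq_mul_inv]
  exact hb k M h _ (by omega) z

lemma ScaleSeq.mul_tsum_inv_le (hF : RegTail F α) (ha : ScaleSeq F α a) {δ : ℝ} (hδ : 0 < δ) :
    ∃ D > 0, ∀ᶠ x in atTop, x * rtail F x * ∑' m, (a (⌈δ / rtail F x⌉₊ + m))⁻¹ ≤ D := by
  have hapos : ∀ n, 0 < a n := fun n => lt_of_lt_of_le one_pos (ha.one_le n)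
  have h := ha.tendsto_mul_tsum hF (f := fun n _ => ((a n)⁻¹ : ℂ)) (K := 1) (Φ := fun _ => 1)
    (fun n _ _ => by
      rw [← Complex.ofReal_inv, Complex.norm_real, Real.norm_of_nonneg (inv_pos.2 (hapos n)).le,
        one_div])
    (fun v _ => tendsto_const_nhds.congr fun x => by
      have : (a ⌈v / rtail F x⌉₊ : ℂ) ≠ 0 := by exact_mod_cast (hapos _).ne'
      rw [mul_inv_cancel₀ this]) hδ
  set L := ∫ v in Ioi δ, ((v ^ (-α⁻¹) : ℝ) : ℂ) * 1
  refine ⟨‖L‖ + 1, by positivity, ?_⟩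
  filter_upwards [h.norm.eventually (gt_mem_nhds (lt_add_one ‖L‖))] with x hx
  refine le_trans ?_ hx.le
  have : ((x * rtail F x : ℝ) : ℂ) * ∑' m, ((a (⌈δ / rtail F x⌉₊ + m))⁻¹ : ℂ) =
      ((x * rtail F x * ∑' m, (a (⌈δ / rtail F x⌉₊ + m))⁻¹ : ℝ) : ℂ) := by
    push_cast
    rfl
  rw [this, Complex.norm_real]
  exact le_abs_self _

/-- Away from the zeros of `1 - φ`, the sum over `n ≥ N` telescopes and is `O(1 / a_N)`. -/
lemma ScaleSeq.norm_tsum_fcoef_le (hF : RegTail F α) (ha : ScaleSeq F α a) {k : ℝ → ℂ}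
    (hk : Measurable k) {M : ℝ} (hkM : ∀ t, ‖k t‖ ≤ M * weight t) {e : ℝ} (he : 0 < e)
    (hφ : ∀ t, k t ≠ 0 → e ≤ ‖1 - charFun F t‖) :
    ∃ C, ∀ N, 1 ≤ N → ∀ z, ‖∑' m, fcoef F k (N + m) z‖ ≤ C / a N := by
  obtain ⟨C, hC, hb⟩ := ha.norm_fcoef_le hF
  have hcont : Continuous (charFun F) := continuous_charFun
  set k' : ℝ → ℂ := fun t => k t / (1 - charFun F t) with hk'
  have hk'm : Measurable k' := hk.div (by fun_prop)
  have hk'M : ∀ t, ‖k' t‖ ≤ (M / e) * weight t := fun t => by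
    by_cases h0 : k t = 0
    · have h1 := hkM t
      rw [h0, norm_zero] at h1
      simp only [hk', h0, zero_div, norm_zero]
      rw [div_mul_eq_mul_div]
      positivity
    · rw [hk', norm_div, div_mul_eq_mul_div]
      exact div_le_div₀ ((norm_nonneg _).trans (hkM t)) (hkM t) he (hφ t h0)
  have hk'i := integrable_of_le_weight hk'm hk'M
  have htel : ∀ n z, fcoef F k n z = fcoef F k' n z - fcoef F k' (n + 1) z := fun n z => by
    unfold fcoef
    rw [← integral_sub (integrable_fcoef hk'i n z) (integrable_fcoef hk'i (n + 1) z)]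
    congr 1 with t
    by_cases h0 : k t = 0
    · simp [hk', h0]
    · have h1 : 1 - charFun F t ≠ 0 := norm_pos_iff.1 (he.trans_le (hφ t h0))
      have h2 : k t = k' t * (1 - charFun F t) := by rw [hk']; field_simp
      rw [h2]
      ring
  refine ⟨C * (M / e), fun N hN z => ?_⟩
  have hzero : Tendsto (fun m => fcoef F k' (N + m) z) atTop (𝓝 0) :=
    (ha.summable_norm_fcoef hF hk'M hN z).of_norm.tendsto_atTop_zero
  have hsum := (ha.summable_norm_fcoef hF hkM hN z).of_norm.hasSum.tendsto_sum_nat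
  have hlim : Tendsto (fun p => ∑ m ∈ Finset.range p, fcoef F k (N + m) z) atTop
      (𝓝 (fcoef F k' N z)) := by
    have h1 : ∀ p, ∑ m ∈ Finset.range p, fcoef F k (N + m) z =
        fcoef F k' N z - fcoef F k' (N + p) z := fun p => by
      rw [Finset.sum_congr rfl fun m _ => htel (N + m) z]
      exact Finset.sum_range_sub' (fun m => fcoef F k' (N + m) z) p
    simp only [h1]
    simpa using hzero.const_sub (fcoef F k' N z)
  rw [tendsto_nhds_unique hsum hlim]
  exact hb k' _ hk'M N hN z

/-- Asymptotics of `x F̄(x) ∑_{n ≥ δ / F̄(x)} ∫ k(t) e^{-ity} φ(t)^n dt` with `y ∼ x`. -/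
theorem ScaleSeq.tendsto_mul_tsum_fcoef (hF : RegTail F α) (ha : ScaleSeq F α a) {ψ : ℝ → ℂ}
    (hψ : ∀ w, Tendsto (fun n : ℕ => charFun F (w / a n) ^ n) atTop (𝓝 (ψ w)))
    {k : ℝ → ℂ} (hkm : Measurable k) {M : ℝ} (hkM : ∀ t, ‖k t‖ ≤ M / (1 + t ^ 2))
    (hk0 : ContinuousAt k 0) {S : Set ℝ} (hS : IsClosed S) (hkS : ∀ t, t ∉ S → k t = 0)
    (hφ : ∀ t ∈ S, t ≠ 0 → charFun F t ≠ 1) {y : ℝ → ℝ}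
    (hy : Tendsto (fun x => y x / x) atTop (𝓝 1)) {δ : ℝ} (hδ : 0 < δ) :
    Tendsto (fun x => ((x * rtail F x : ℝ) : ℂ) * ∑' m, fcoef F k (⌈δ / rtail F x⌉₊ + m) (y x))
      atTop (𝓝 (∫ v in Ioi δ, ((v ^ (-α⁻¹) : ℝ) : ℂ) *
        (k 0 * ∫ w, ψ w * Complex.exp (-(w * (v ^ (-α⁻¹) : ℝ) * Complex.I))))) := by
  have hapos : ∀ n, 0 < a n := fun n => lt_of_lt_of_le one_pos (ha.one_le n)
  have hcont : Continuous (charFun F) := continuous_charFun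
  have hM : 0 ≤ M := by simpa using (norm_nonneg (k 0)).trans (hkM 0)
  have hNpos : ∀ x, 1 ≤ ⌈δ / rtail F x⌉₊ := fun x => Nat.ceil_pos.2 (div_pos hδ (hF.pos x))
  obtain ⟨r, hr, hnear⟩ := ha.tendsto_fcoef hF
  obtain ⟨C, hC, hb⟩ := ha.norm_fcoef_le hF
  obtain ⟨D, hD, hDb⟩ := ha.mul_tsum_inv_le hF hδ
  have hsplit : ∀ t : ℝ, M / (1 + t ^ 2) = M * ((1 + t ^ 2) ^ (-(1 / 4) : ℝ) * weight t) := fun t => by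
    rw [weight, ← Real.rpow_add (by positivity), show (-(1 / 4) + -(3 / 4) : ℝ) = -1 by norm_num,
      Real.rpow_neg_one, div_eq_mul_inv]
  have hρ : ∀ B t : ℝ, |B| ≤ |t| → M / (1 + t ^ 2) ≤ M * (1 + B ^ 2) ^ (-(1 / 4) : ℝ) * weight t :=
    fun B t h => by
      rw [hsplit, mul_assoc]
      refine mul_le_mul_of_nonneg_left (mul_le_mul_of_nonneg_right ?_ (weight_pos t).le) hM
      refine Real.rpow_le_rpow_of_nonpos (by positivity) ?_ (by norm_num)
      have := sq_le_sq.2 h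
      linarith
  have hkw : ∀ t, ‖k t‖ ≤ M * weight t := fun t => by
    have := hρ 0 t (by simp)
    simp only [ne_eq, OfNat.ofNat_ne_zero, not_false_eq_true, zero_pow, add_zero, Real.one_rpow,
      mul_one] at this
    exact (hkM t).trans this
  set k₁ : ℝ → ℂ := {t : ℝ | |t| ≤ r}.indicator k with hk₁
  have hm₁ : MeasurableSet {t : ℝ | |t| ≤ r} := measurableSet_le (by fun_prop) measurable_const
  have hk₁w : ∀ t, ‖k₁ t‖ ≤ M * weight t := fun t => (norm_indicator_le_norm_self _ _).trans (hkw t)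
  have hk₁m : Measurable k₁ := hkm.indicator hm₁
  have hk₁0 : k₁ 0 = k 0 := indicator_of_mem (by simp [hr.le]) _
  have hlim₁ := ha.tendsto_mul_tsum hF (f := fun n x => fcoef F k₁ n (y x)) (K := C * M)
    (fun n hn x => hb k₁ M hk₁w n hn _)
    (hnear k₁ hk₁m (fun t ht => indicator_of_notMem (by simpa using ht) _) M
      (fun t => (norm_indicator_le_norm_self _ _).trans ((hkM t).trans
        (div_le_self hM (by nlinarith [sq_nonneg t]))))
      (hk0.congr (by
        have : {t : ℝ | |t| ≤ r} ∈ 𝓝 (0:ℝ) := by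
          filter_upwards [Metric.ball_mem_nhds (0:ℝ) hr] with t ht
          rw [Metric.mem_ball, dist_zero_right] at ht
          exact ht.le
        filter_upwards [this] with t ht
        exact (indicator_of_mem (s := {t : ℝ | |t| ≤ r}) ht k).symm)) ψ hψ y hy) hδ
  rw [hk₁0] at hlim₁
  refine Metric.tendsto_atTop.2 fun ε hε => ?_
  rw [← eventually_atTop]
  obtain ⟨B, hBr, hB⟩ : ∃ B : ℝ, r ≤ B ∧ C * (M * (1 + B ^ 2) ^ (-(1 / 4) : ℝ)) * D < ε / 3 := by
    have h1 : Tendsto (fun B : ℝ => (1 + B ^ 2) ^ (-(1 / 4) : ℝ)) atTop (𝓝 0) :=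
      (tendsto_rpow_neg_atTop (by norm_num)).comp
        (tendsto_atTop_add_const_left _ _ (tendsto_pow_atTop two_ne_zero))
    have h2 := ((h1.const_mul M).const_mul C).mul_const D
    simp only [mul_zero, zero_mul] at h2
    exact ((eventually_ge_atTop r).and (h2.eventually (gt_mem_nhds (by positivity)))).exists
  have hB0 : 0 < B := hr.trans_le hBr
  set k₂ : ℝ → ℂ := {t : ℝ | r < |t| ∧ |t| ≤ B}.indicator k with hk₂
  have hm₂ : MeasurableSet {t : ℝ | r < |t| ∧ |t| ≤ B} :=
    MeasurableSet.inter (s₁ := {t : ℝ | r < |t|}) (s₂ := {t : ℝ | |t| ≤ B})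
      (measurableSet_lt measurable_const (by fun_prop))
      (measurableSet_le (by fun_prop) measurable_const)
  have hk₂w : ∀ t, ‖k₂ t‖ ≤ M * weight t := fun t => (norm_indicator_le_norm_self _ _).trans (hkw t)
  set k₃ : ℝ → ℂ := {t : ℝ | B < |t|}.indicator k with hk₃
  have hm₃ : MeasurableSet {t : ℝ | B < |t|} := measurableSet_lt measurable_const (by fun_prop)
  have hk₃w : ∀ t, ‖k₃ t‖ ≤ M * (1 + B ^ 2) ^ (-(1 / 4) : ℝ) * weight t := fun t => by
    by_cases ht : B < |t|
    · exact (norm_indicator_le_norm_self _ _).trans ((hkM t).trans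
        (hρ B t (by rw [abs_of_pos hB0]; exact ht.le)))
    · have := weight_pos t
      rw [hk₃, indicator_of_notMem (s := {t : ℝ | B < |t|}) ht, norm_zero]
      positivity
  have hdec : k = fun t => (k₁ t + k₂ t) + k₃ t := by
    funext t
    rcases le_or_gt |t| r with h1 | h1
    · rw [hk₁, hk₂, hk₃, indicator_of_mem (s := {t : ℝ | |t| ≤ r}) h1,
        indicator_of_notMem (fun h => absurd h.1 (not_lt.2 h1)),
        indicator_of_notMem (s := {t : ℝ | B < |t|}) (fun h => absurd h (not_lt.2 (h1.trans hBr)))]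
      simp
    · rcases le_or_gt |t| B with h2 | h2
      · rw [hk₁, hk₂, hk₃, indicator_of_notMem (s := {t : ℝ | |t| ≤ r}) (not_le.2 h1),
          indicator_of_mem (s := {t : ℝ | r < |t| ∧ |t| ≤ B}) ⟨h1, h2⟩,
          indicator_of_notMem (s := {t : ℝ | B < |t|}) (not_lt.2 h2)]
        simp
      · rw [hk₁, hk₂, hk₃, indicator_of_notMem (s := {t : ℝ | |t| ≤ r}) (not_le.2 h1),
          indicator_of_notMem (fun h => absurd h.2 (not_le.2 h2)),
          indicator_of_mem (s := {t : ℝ | B < |t|}) h2]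
        simp
  obtain ⟨e, he, hφe⟩ : ∃ e > 0, ∀ t, k₂ t ≠ 0 → e ≤ ‖1 - charFun F t‖ := by
    have hc : IsCompact (S ∩ (Icc (-B) B ∩ {t : ℝ | r ≤ |t|})) :=
      (isCompact_Icc.inter_right (isClosed_le continuous_const (by fun_prop))).inter_left hS
    have hmem : ∀ t, k₂ t ≠ 0 → t ∈ S ∩ (Icc (-B) B ∩ {t : ℝ | r ≤ |t|}) := fun t ht => by
      have h1 : t ∈ {t : ℝ | r < |t| ∧ |t| ≤ B} := by
        by_contra h; exact ht (indicator_of_notMem h _)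
      have h2 : t ∈ S := by
        by_contra h
        exact ht (by rw [hk₂, indicator_of_mem h1, hkS t h])
      exact ⟨h2, abs_le.1 h1.2, h1.1.le⟩
    rcases (S ∩ (Icc (-B) B ∩ {t : ℝ | r ≤ |t|})).eq_empty_or_nonempty with h0 | h0
    · refine ⟨1, one_pos, fun t ht => ?_⟩
      have := hmem t ht
      rw [h0] at this
      exact absurd this (notMem_empty t)
    · obtain ⟨u, hu, hmin⟩ := hc.exists_isMinOn h0
        (f := fun t => ‖1 - charFun F t‖) (by fun_prop)
      refine ⟨‖1 - charFun F u‖, norm_pos_iff.2 (sub_ne_zero.2 (Ne.symm ?_)),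
        fun t ht => hmin (hmem t ht)⟩
      refine hφ u hu.1 fun h => ?_
      have := hu.2.2
      simp only [h, mem_ofPred_eq, abs_zero] at this
      linarith
  obtain ⟨E, hE⟩ := ha.norm_tsum_fcoef_le hF (hkm.indicator hm₂) hk₂w he hφe
  have hmid : Tendsto (fun x => x / a ⌈δ / rtail F x⌉₊ * rtail F x * E) atTop (𝓝 0) := by
    simpa using ((ha.tendsto_div_ceil hF hδ).mul (tendsto_rtail F)).mul_const E
  have hi₁ := integrable_of_le_weight hk₁m hk₁w
  have hi₂ := integrable_of_le_weight (hkm.indicator hm₂) hk₂w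
  have hi₃ := integrable_of_le_weight (hkm.indicator hm₃) hk₃w
  filter_upwards [Metric.tendsto_nhds.1 hlim₁ (ε / 3) (by positivity),
    hmid.eventually (gt_mem_nhds (by positivity : (0:ℝ) < ε / 3)), hDb, eventually_gt_atTop 0]
    with x h1 h2 h3 hx
  set N := ⌈δ / rtail F x⌉₊
  have hN : 1 ≤ N := hNpos x
  have hG := hF.pos x
  have hxG : 0 < x * rtail F x := by positivity
  have s₁ := (ha.summable_norm_fcoef hF hk₁w hN (y x)).of_norm
  have s₂ := (ha.summable_norm_fcoef hF hk₂w hN (y x)).of_norm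
  have s₃ := ha.summable_norm_fcoef hF hk₃w hN (y x)
  have hts : ∑' m, fcoef F k (N + m) (y x) = ∑' m, fcoef F k₁ (N + m) (y x) +
      ∑' m, fcoef F k₂ (N + m) (y x) + ∑' m, fcoef F k₃ (N + m) (y x) := by
    rw [← s₁.tsum_add s₂, ← (s₁.add s₂).tsum_add s₃.of_norm]
    congr 1 with m
    rw [← fcoef_add (k₂ := k₂) hi₁ hi₂,
      ← fcoef_add (k₁ := fun t => k₁ t + k₂ t) (k₂ := k₃) (hi₁.add hi₂) hi₃, ← hdec]
  have b₂ : ‖((x * rtail F x : ℝ) : ℂ) * ∑' m, fcoef F k₂ (N + m) (y x)‖ < ε / 3 := by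
    rw [norm_mul, Complex.norm_real, Real.norm_of_nonneg hxG.le]
    refine lt_of_le_of_lt (mul_le_mul_of_nonneg_left (hE N hN (y x)) hxG.le) (lt_of_eq_of_lt ?_ h2)
    ring
  have b₃ : ‖((x * rtail F x : ℝ) : ℂ) * ∑' m, fcoef F k₃ (N + m) (y x)‖ < ε / 3 := by
    rw [norm_mul, Complex.norm_real, Real.norm_of_nonneg hxG.le]
    have hs : Summable fun m => C * (M * (1 + B ^ 2) ^ (-(1 / 4) : ℝ)) * (a (N + m))⁻¹ := by
      have := (summable_nat_add_iff N).2 (ha.summable_inv hF)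
      simp only [add_comm _ N] at this
      exact this.mul_left _
    have h4 : ‖∑' m, fcoef F k₃ (N + m) (y x)‖ ≤
        C * (M * (1 + B ^ 2) ^ (-(1 / 4) : ℝ)) * ∑' m, (a (N + m))⁻¹ := by
      refine (norm_tsum_le_tsum_norm s₃).trans ?_
      rw [← tsum_mul_left]
      exact s₃.tsum_le_tsum (fun m => hb k₃ _ hk₃w _ (by omega) _) hs
    calc x * rtail F x * ‖∑' m, fcoef F k₃ (N + m) (y x)‖
        ≤ x * rtail F x * (C * (M * (1 + B ^ 2) ^ (-(1 / 4) : ℝ)) * ∑' m, (a (N + m))⁻¹) := by gcongr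
      _ = C * (M * (1 + B ^ 2) ^ (-(1 / 4) : ℝ)) * (x * rtail F x * ∑' m, (a (N + m))⁻¹) := by ring
      _ ≤ C * (M * (1 + B ^ 2) ^ (-(1 / 4) : ℝ)) * D := by gcongr
      _ < _ := hB
  rw [hts, mul_add, mul_add, dist_eq_norm]
  rw [dist_eq_norm] at h1
  set X := ((x * rtail F x : ℝ) : ℂ) * ∑' m, fcoef F k₁ (N + m) (y x)
  set Y := ((x * rtail F x : ℝ) : ℂ) * ∑' m, fcoef F k₂ (N + m) (y x)
  set Z := ((x * rtail F x : ℝ) : ℂ) * ∑' m, fcoef F k₃ (N + m) (y x)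
  generalize (∫ v in Ioi δ, ((v ^ (-α⁻¹) : ℝ) : ℂ) * (k 0 * ∫ w, ψ w *
    Complex.exp (-(w * (v ^ (-α⁻¹) : ℝ) * Complex.I)))) = L at h1 ⊢
  calc ‖X + Y + Z - L‖ = ‖(X - L) + Y + Z‖ := by ring_nf
    _ ≤ ‖X - L‖ + ‖Y‖ + ‖Z‖ := norm_add₃_le
    _ < ε := by linarith

end FourierSum

section Inversion

open scoped FourierTransform ContDiff SchwartzMap

lemma integral_fourier_mul_eq {f g : ℝ → ℂ} (hf : Integrable f) (hg : Integrable g) :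
    ∫ w, 𝓕 f w * g w = ∫ w, f w * 𝓕 g w := by
  simpa using! VectorFourier.integral_fourierIntegral_smul_eq_flip (L := innerₗ ℝ)
      Real.continuous_fourierChar continuous_inner hf hg

/-- Fourier inversion almost everywhere. -/
lemma fourier_fourierInv_ae_eq {g : ℝ → ℂ} (hg : Integrable g) (h : Integrable (𝓕⁻ g)) :
    ∀ᵐ y, g y = 𝓕 (𝓕⁻ g) y := by
  have hcont : Continuous (𝓕 (𝓕⁻ g)) := VectorFourier.fourierIntegral_continuous
    Real.continuous_fourierChar (by exact continuous_inner) h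
  refine ae_eq_of_integral_contDiff_smul_eq hg.locallyIntegrable hcont.locallyIntegrable
    fun f hf hfs => ?_
  set F : 𝓢(ℝ, ℂ) := HasCompactSupport.toSchwartzMap (f := fun x => (f x : ℂ))
    (hfs.comp_left (g := ((↑) : ℝ → ℂ)) Complex.ofReal_zero)
    (Complex.ofRealCLM.contDiff.comp hf) with hF
  have hFf : ∀ x, F x = f x := fun x => rfl
  have hi : Integrable (F : ℝ → ℂ) := F.integrable
  have hi' : Integrable (𝓕 (F : ℝ → ℂ)) := (𝓕 F).integrable
  have hneg : Integrable fun x => g (-x) := hg.comp_neg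
  simp only [Complex.real_smul, ← hFf]
  rw [← integral_fourier_mul_eq hi h, Real.fourierInv_eq_fourier_comp_neg,
    ← integral_fourier_mul_eq hi' hneg, ← integral_neg_eq_self]
  congr 1 with x
  have := congrFun (F.continuous.fourierInv_fourier_eq hi hi') (-x)
  rw [Real.fourierInv_eq_fourier_neg, neg_neg] at this
  rw [this]

lemma fourierInv_eq_kern (g : ℝ → ℂ) (w : ℝ) : 𝓕⁻ g w = kern g (2 * π * w) := by
  rw [Real.fourierInv_eq', kern]
  congr 1 with v
  simp only [Real.inner_apply, smul_eq_mul]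
  rw [mul_comm]
  push_cast
  ring_nf

lemma fourier_fourierInv_eq_kern (g : ℝ → ℂ) (y : ℝ) :
    𝓕 (𝓕⁻ g) y = (2 * π)⁻¹ * ∫ w, kern g w * Complex.exp (-(w * y * Complex.I)) := by
  have h := Measure.integral_comp_mul_left (fun w : ℝ => kern g w * Complex.exp (-(w * y * Complex.I)))
    (2 * π)
  rw [abs_of_pos (by positivity), Complex.real_smul] at h
  rw [← h, Real.fourier_real_eq_integral_exp_smul]
  congr 1 with v
  rw [fourierInv_eq_kern, smul_eq_mul, mul_comm]
  push_cast
  ring_nf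

lemma integrable_fourierInv {g : ℝ → ℂ} (h : Integrable (kern g)) : Integrable (𝓕⁻ g) := by
  have : 𝓕⁻ g = fun w => kern g (2 * π * w) := funext (fourierInv_eq_kern g)
  rw [this]
  exact h.comp_mul_left' (by positivity)

lemma eq_integral_kern_ae {g : ℝ → ℂ} (hg : Integrable g) (h : Integrable (kern g)) :
    ∀ᵐ y, g y = (2 * π)⁻¹ * ∫ w, kern g w * Complex.exp (-(w * y * Complex.I)) := by
  filter_upwards [fourier_fourierInv_ae_eq hg (integrable_fourierInv h)] with y hy
  rw [hy, fourier_fourierInv_eq_kern]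

lemma eq_integral_kern {g : ℝ → ℂ} (hc : Continuous g) (hg : Integrable g)
    (h : Integrable (kern g)) (y : ℝ) :
    g y = (2 * π)⁻¹ * ∫ w, kern g w * Complex.exp (-(w * y * Complex.I)) := by
  have h' : Integrable (𝓕 g) := by
    convert (integrable_fourierInv h).comp_neg using 2 with w
    rw [Real.fourierInv_eq_fourier_neg, neg_neg]
  rw [← fourier_fourierInv_eq_kern, hc.fourier_fourierInv_eq hg h']

end Inversion

section LimitDensity

variable {F : Measure ℝ} [IsProbabilityMeasure F] {a : ℕ → ℝ} {g : ℝ → ℝ}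

/-- `Sₙ / aₙ` converges in distribution to a law with density `g`. -/
def LimitDensity (F : Measure ℝ) (a : ℕ → ℝ) (g : ℝ → ℝ) : Prop :=
  ∀ f : BoundedContinuousFunction ℝ ℝ,
    Tendsto (fun n : ℕ => ∫ x, f x ∂((convPow F n).map fun y => y / a n)) atTop
      (𝓝 (∫ x, f x * g x))

lemma LimitDensity.integral_eq_one (h : LimitDensity F a g) : ∫ x, g x = 1 := by
  have h1 := h (BoundedContinuousFunction.const ℝ 1)
  have h2 : ∀ n : ℕ, ∫ x, BoundedContinuousFunction.const ℝ (1 : ℝ) x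
      ∂((convPow F n).map fun y => y / a n) = 1 := fun n => by
    have : IsProbabilityMeasure ((convPow F n).map fun y => y / a n) :=
      Measure.isProbabilityMeasure_map (by fun_prop)
    simp
  simp only [h2] at h1
  simpa using tendsto_nhds_unique h1 tendsto_const_nhds

lemma LimitDensity.integrable (h : LimitDensity F a g) : Integrable g := by
  by_contra hg
  have := h.integral_eq_one
  rw [integral_undef hg] at this
  exact zero_ne_one this

lemma LimitDensity.tendsto_charFun (h : LimitDensity F a g) (w : ℝ) :
    Tendsto (fun n : ℕ => charFun F (w / a n) ^ n) atTop
      (𝓝 (kern (fun x => (g x : ℂ)) w)) := by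
  set fc : BoundedContinuousFunction ℝ ℝ := BoundedContinuousFunction.ofNormedAddCommGroup
    (fun x => cos (w * x)) (by fun_prop) 1 (fun x => abs_cos_le_one _) with hfc
  set fs : BoundedContinuousFunction ℝ ℝ := BoundedContinuousFunction.ofNormedAddCommGroup
    (fun x => sin (w * x)) (by fun_prop) 1 (fun x => abs_sin_le_one _) with hfs
  have hexp : ∀ x : ℝ, Complex.exp (w * x * Complex.I) = (fc x : ℂ) + fs x * Complex.I := by
    intro x
    rw [Complex.exp_mul_I]
    simp [hfc, hfs]
  have hL := ((Complex.continuous_ofReal.tendsto _).comp (h fc)).add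
    (((Complex.continuous_ofReal.tendsto _).comp (h fs)).mul_const Complex.I)
  have hgc : ∀ f : BoundedContinuousFunction ℝ ℝ, Integrable fun x => ((f x * g x : ℝ) : ℂ) :=
    fun f => (h.integrable.bdd_mul f.continuous.aestronglyMeasurable
      (ae_of_all _ f.norm_coe_le_norm)).ofReal
  convert hL using 1
  · ext n
    have hp : IsProbabilityMeasure ((convPow F n).map fun y => y / a n) :=
      Measure.isProbabilityMeasure_map (by fun_prop)
    have e1 : charFun F (w / a n) ^ n = charFun ((convPow F n).map fun y => y / a n) w := by
      rw [← charFun_convPow]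
      have : (fun y => y / a n) = fun y => (a n)⁻¹ * y := by
        ext y
        ring
      rw [this, charFun_map_mul, div_eq_inv_mul]
    rw [e1, charFun_apply_real]
    simp only [hexp]
    rw [integral_add (fc.integrable _).ofReal ((fs.integrable _).ofReal.mul_const _),
      integral_mul_const]
    simp only [Function.comp, integral_complex_ofReal]
  · rw [kern, ← integral_complex_ofReal, ← integral_complex_ofReal, ← integral_mul_const,
      ← integral_add (hgc fc) ((hgc fs).mul_const _)]
    congr 2 with x
    rw [mul_comm (x : ℂ), hexp]
    push_cast
    ring

end LimitDensity

section LimitDensity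

variable {F : Measure ℝ} [IsProbabilityMeasure F] {a : ℕ → ℝ} {g : ℝ → ℝ} {α : ℝ}

lemma continuous_kern {k : ℝ → ℂ} (hk : Integrable k) : Continuous (kern k) := by
  refine continuous_of_dominated (bound := fun t => ‖k t‖) (fun y => ?_) (fun y => ?_) hk.norm ?_
  · exact hk.aestronglyMeasurable.mul (by fun_prop)
  · refine ae_of_all _ fun t => ?_
    rw [norm_mul, ← Complex.ofReal_mul, Complex.norm_exp_ofReal_mul_I, mul_one]
  · exact ae_of_all _ fun t => by fun_prop

lemma LimitDensity.tendsto_atTop (h : LimitDensity F a g) (hF : RegTail F α) (hmono : Monotone a)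
    (h1 : ∀ n, 1 ≤ a n) : Tendsto a atTop atTop := by
  refine (tendsto_atTop_of_monotone hmono).resolve_right ?_
  rintro ⟨l, hl⟩
  have hal : ∀ n, a n ≤ l := fun n => hmono.ge_of_tendsto hl n
  obtain ⟨r, hr, hr1, c, hc, hφ⟩ := hF.le_one_sub_norm_charFun
  have hz : ∀ w : ℝ, w ≠ 0 → |w| ≤ r → kern (fun x => (g x : ℂ)) w = 0 := by
    intro w hw hwr
    refine tendsto_nhds_unique (h.tendsto_charFun w) ?_
    have hw' := abs_pos.2 hw
    have hG := hF.pos (l / |w|)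
    have hb : ∀ n, ‖charFun F (w / a n)‖ ≤ 1 - c * rtail F (l / |w|) := by
      intro n
      have ha := zero_lt_one.trans_le (h1 n)
      have hq : |w / a n| ≤ r := by
        rw [abs_div, abs_of_pos ha]
        exact (div_le_self hw'.le (h1 n)).trans hwr
      have e := hφ (w / a n) (div_ne_zero hw ha.ne') hq
      have : rtail F (l / |w|) ≤ rtail F (1 / |w / a n|) := by
        refine rtail_antitone F ?_
        rw [abs_div, abs_of_pos ha, one_div_div]
        gcongr
        exact hal n
      nlinarith
    refine squeeze_zero_norm (a := fun n : ℕ => (1 - c * rtail F (l / |w|)) ^ n) (fun n => ?_)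
      (tendsto_pow_atTop_nhds_zero_of_lt_one ((norm_nonneg _).trans (hb 0)) (by nlinarith))
    rw [norm_pow]
    gcongr
    exact hb n
  have hcont : Tendsto (kern fun x => (g x : ℂ)) (𝓝[≠] 0) (𝓝 (kern (fun x => (g x : ℂ)) 0)) :=
    (continuous_kern h.integrable.ofReal).continuousAt.tendsto.mono_left nhdsWithin_le_nhds
  have hzero : kern (fun x => (g x : ℂ)) 0 = 0 := by
    refine tendsto_nhds_unique hcont (tendsto_const_nhds.congr' ?_)
    have hball : Metric.closedBall (0 : ℝ) r ∈ 𝓝 (0 : ℝ) := Metric.closedBall_mem_nhds _ hr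
    filter_upwards [self_mem_nhdsWithin, nhdsWithin_le_nhds hball] with w hw hw'
    exact (hz w hw (by simpa using hw')).symm
  have hone : kern (fun x => (g x : ℂ)) 0 = 1 := by
    simp [kern, integral_complex_ofReal, h.integral_eq_one]
  exact one_ne_zero (hone.symm.trans hzero)

lemma LimitDensity.norm_kern_le (h : LimitDensity F a g) (hF : RegTail F α)
    (ha : ScaleSeq F α a) :
    ∃ K, ∃ κ > 0, ∀ w, ‖kern (fun x => (g x : ℂ)) w‖ ≤ K * exp (-κ * |w| ^ (α / 2)) := by
  obtain ⟨r, hr, -, K, -, κ, hκ, hφ⟩ := ha.norm_charFun_pow_le hF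
  refine ⟨K, κ, hκ, fun w => ?_⟩
  refine le_of_tendsto (h.tendsto_charFun w).norm ?_
  have hlim : Tendsto (fun n => |w| / a n) atTop (𝓝 0) :=
    (ha.tendsto_atTop hF).const_div_atTop _
  filter_upwards [hlim.eventually_le_const hr, eventually_ge_atTop 1] with n hn hn1
  have hpos : 0 < a n := zero_lt_one.trans_le (ha.one_le n)
  have e := hφ n hn1 (w / a n) 0 (by rwa [sub_zero, abs_div, abs_of_pos hpos])
    (by rw [charFun_zero]; simpa using norm_charFun_le_one (μ := F) (w / a n))
  rwa [sub_zero, mul_div_cancel₀ _ hpos.ne', ← norm_pow] at e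

lemma LimitDensity.integrable_kern (h : LimitDensity F a g) (hF : RegTail F α)
    (ha : ScaleSeq F α a) : Integrable (kern fun x => (g x : ℂ)) := by
  obtain ⟨K, κ, hκ, hb⟩ := h.norm_kern_le hF ha
  exact ((integrable_exp_neg_abs_rpow hκ (half_pos hF.α_pos)).const_mul K).mono'
    (continuous_kern h.integrable.ofReal).aestronglyMeasurable (ae_of_all _ hb)

lemma LimitDensity.eq_integral_kern_ae (h : LimitDensity F a g) (hF : RegTail F α)
    (ha : ScaleSeq F α a) : ∀ᵐ y, (g y : ℂ) = (2 * π)⁻¹ *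
      ∫ w, kern (fun x => (g x : ℂ)) w * Complex.exp (-(w * y * Complex.I)) :=
  SRT.eq_integral_kern_ae h.integrable.ofReal (h.integrable_kern hF ha)

lemma LimitDensity.ae_bounded (h : LimitDensity F a g) (hF : RegTail F α)
    (ha : ScaleSeq F α a) : ∃ M, ∀ᵐ y, |g y| ≤ M := by
  refine ⟨(2 * π)⁻¹ * ∫ w, ‖kern (fun x => (g x : ℂ)) w‖, ?_⟩
  filter_upwards [h.eq_integral_kern_ae hF ha] with y hy
  rw [← norm_eq_abs, ← Complex.norm_real, hy, norm_mul, Complex.norm_real, norm_of_nonneg (by positivity)]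
  gcongr
  refine (norm_integral_le_integral_norm _).trans_eq ?_
  congr 1 with w
  rw [norm_mul, norm_exp_neg_mul_I, mul_one]

lemma LimitDensity.integrableOn_rpow_mul (h : LimitDensity F a g) (hF : RegTail F α)
    (ha : ScaleSeq F α a) : IntegrableOn (fun t => t ^ (-α) * g t) (Ioi 0) := by
  obtain ⟨M, hM⟩ := h.ae_bounded hF ha
  have hα := hF.α_pos
  have hα' := hF.α_le
  rw [← Ioc_union_Ioi_eq_Ioi zero_le_one]
  refine IntegrableOn.union ?_ ?_
  · have hi : IntegrableOn (fun t : ℝ => t ^ (-α)) (Ioc 0 1) := by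
      rw [← intervalIntegrable_iff_integrableOn_Ioc_of_le zero_le_one]
      exact intervalIntegral.intervalIntegrable_rpow' (by linarith)
    refine Integrable.mono' (hi.mul_const M) ?_ ?_
    · exact hi.aestronglyMeasurable.mul h.integrable.aestronglyMeasurable.restrict
    · filter_upwards [ae_restrict_of_ae hM, ae_restrict_mem measurableSet_Ioc] with t ht ht0
      rw [norm_mul, norm_of_nonneg (rpow_nonneg ht0.1.le _)]
      have := rpow_nonneg ht0.1.le (-α)
      gcongr
      exact ht
  · refine Integrable.mono' h.integrable.norm.integrableOn ?_ ?_
    · exact AEStronglyMeasurable.mul (by fun_prop) h.integrable.aestronglyMeasurable.restrict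
    · filter_upwards [ae_restrict_mem measurableSet_Ioi] with t ht
      have ht0 : (0 : ℝ) < t := zero_lt_one.trans ht
      rw [norm_mul, norm_of_nonneg (rpow_nonneg ht0.le _)]
      refine mul_le_of_le_one_left (norm_nonneg _) ?_
      exact rpow_le_one_of_one_le_of_nonpos (le_of_lt ht) (by linarith)

/-- `α` times the integral of `t ^ (-α) g(t)` over `{t > 0 : t ^ (-α) > δ}`. -/
def truncInt (α : ℝ) (g : ℝ → ℝ) (δ : ℝ) : ℝ :=
  α * ∫ t in Ioi (0 : ℝ), if δ < t ^ (-α) then t ^ (-α) * g t else 0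

lemma LimitDensity.tendsto_truncInt (h : LimitDensity F a g) (hF : RegTail F α)
    (ha : ScaleSeq F α a) :
    Tendsto (truncInt α g) (𝓝[>] 0) (𝓝 (α * ∫ t in Ioi (0 : ℝ), t ^ (-α) * g t)) := by
  have hi := h.integrableOn_rpow_mul hF ha
  refine Tendsto.const_mul _ (tendsto_integral_filter_of_dominated_convergence
    (fun t => ‖t ^ (-α) * g t‖) (Eventually.of_forall fun δ => ?_)
    (Eventually.of_forall fun δ => ae_of_all _ fun t => ?_) hi.norm ?_)
  · refine AEStronglyMeasurable.congr (hi.aestronglyMeasurable.indicator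
      (measurableSet_lt (measurable_const (a := δ)) (by fun_prop : Measurable fun t : ℝ => t ^ (-α))))
      (ae_of_all _ fun t => ?_)
    simp [indicator]
  · split_ifs
    · exact le_rfl
    · simp only [norm_zero]
      positivity
  · filter_upwards [ae_restrict_mem measurableSet_Ioi] with t ht
    refine tendsto_const_nhds.congr' ?_
    filter_upwards [nhdsWithin_le_nhds (Iio_mem_nhds (rpow_pos_of_pos ht (-α)))] with δ hδ
    rw [if_pos (mem_Iio.1 hδ)]

lemma LimitDensity.integral_eq_truncInt (h : LimitDensity F a g) (hF : RegTail F α)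
    (ha : ScaleSeq F α a) {δ : ℝ} (hδ : 0 < δ) (k₀ : ℂ) :
    ∫ v in Ioi δ, ((v ^ (-α⁻¹) : ℝ) : ℂ) * (k₀ * ∫ w, kern (fun x => (g x : ℂ)) w *
      Complex.exp (-(w * (v ^ (-α⁻¹) : ℝ) * Complex.I))) = k₀ * (2 * π * truncInt α g δ : ℝ) := by
  have hα := hF.α_pos
  set G : ℝ → ℂ := fun y => ∫ w, kern (fun x => (g x : ℂ)) w *
    Complex.exp (-(w * y * Complex.I)) with hG
  have hinv := h.eq_integral_kern_ae hF ha
  have hπ : (π : ℂ) ≠ 0 := by exact_mod_cast pi_ne_zero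
  have hI : ∫ v in Ioi δ, ((v ^ (-α⁻¹) : ℝ) : ℂ) * (k₀ * G (v ^ (-α⁻¹))) =
      ∫ v in Ioi 0, (Ioi δ).indicator (fun v => ((v ^ (-α⁻¹) : ℝ) : ℂ) * (k₀ * G (v ^ (-α⁻¹)))) v := by
    rw [setIntegral_indicator measurableSet_Ioi, inter_eq_self_of_subset_right
      (Ioi_subset_Ioi hδ.le)]
  change ∫ v in Ioi δ, ((v ^ (-α⁻¹) : ℝ) : ℂ) * (k₀ * G (v ^ (-α⁻¹))) = _
  rw [hI, ← integral_comp_rpow_Ioi _ (neg_ne_zero.2 hα.ne'), truncInt]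
  push_cast
  rw [← integral_complex_ofReal, ← mul_assoc, ← mul_assoc, ← integral_const_mul]
  refine integral_congr_ae ?_
  filter_upwards [ae_restrict_mem measurableSet_Ioi, ae_restrict_of_ae hinv] with t ht hgt
  have ht : 0 < t := ht
  have e1 : (t ^ (-α)) ^ (-α⁻¹) = t := by
    rw [← rpow_mul ht.le, neg_mul_neg, mul_inv_cancel₀ hα.ne', rpow_one]
  have e2 : t ^ (-α - 1) * t = t ^ (-α) := by
    rw [rpow_sub_one ht.ne', div_mul_cancel₀ _ ht.ne']
  by_cases hd : δ < t ^ (-α)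
  · rw [if_pos hd, indicator_of_mem (show t ^ (-α) ∈ Ioi δ from hd), e1, abs_neg, abs_of_pos hα,
      ← e2, Complex.real_smul]
    push_cast
    rw [show (g t : ℂ) = ((2 * π)⁻¹ : ℝ) * G t from hgt]
    push_cast
    field_simp
  · rw [if_neg hd, indicator_of_notMem (show t ^ (-α) ∉ Ioi δ from hd)]
    simp

end LimitDensity

section Nonarithmetic

variable {F : Measure ℝ} [IsProbabilityMeasure F] {a : ℕ → ℝ} {g : ℝ → ℝ} {α : ℝ}

lemma concOn_of_charFun_eq_one {t : ℝ} (ht : t ≠ 0) (h : charFun F t = 1) :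
    ConcOn F (2 * π / |t|) := by
  have hcos : Integrable (fun x => cos (t * x)) F :=
    Integrable.of_bound (by fun_prop) 1 (ae_of_all _ fun x => abs_cos_le_one _)
  have hre : ∫ x, cos (t * x) ∂F = 1 := by
    have hi : Integrable (fun x : ℝ => Complex.exp (t * x * Complex.I)) F :=
      Integrable.of_bound (by fun_prop) 1 (ae_of_all _ fun x => by
        rw [← Complex.ofReal_mul, Complex.norm_exp_ofReal_mul_I])
    have := congrArg Complex.re h
    rw [charFun_apply_real, ← Complex.reCLM_apply, ← Complex.reCLM.integral_comp_comm hi] at this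
    rw [← Complex.one_re, ← this]
    congr 1 with x
    rw [Complex.reCLM_apply, ← Complex.ofReal_mul, Complex.exp_ofReal_mul_I_re]
  have hz : ∫ x, (1 - cos (t * x)) ∂F = 0 := by
    rw [integral_sub (integrable_const _) hcos, hre]
    simp
  have hae : ∀ᵐ x ∂F, cos (t * x) = 1 := by
    have := (integral_eq_zero_iff_of_nonneg (fun x => sub_nonneg.2 (cos_le_one (t * x)))
      ((integrable_const _).sub hcos)).1 hz
    filter_upwards [this] with x hx
    simp only [Pi.zero_apply] at hx
    linarith
  have hset : ∀ᵐ x ∂F, x ∈ {x : ℝ | ∃ k : ℤ, x = k * (2 * π / |t|)} := by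
    filter_upwards [hae] with x hx
    obtain ⟨k, hk⟩ := (cos_eq_one_iff _).1 hx
    have hx' : x = k * (2 * π / t) := by
      field_simp
      linarith
    rcases abs_choice t with h' | h'
    · exact ⟨k, by rw [h', hx']⟩
    · refine ⟨-k, ?_⟩
      rw [h', hx']
      push_cast
      rw [div_neg]
      ring
  exact (measure_congr (eventuallyEq_univ.2 hset)).trans measure_univ

lemma tri_neg (B t : ℝ) : tri B (-t) = tri B t := by simp [tri]

lemma integral_tri {B : ℝ} (hB : 0 < B) : ∫ t, tri B t = B := by
  have h1 : ∫ t, tri B t = 2 * ∫ t in Ioi (0 : ℝ), max (1 - t / B) 0 :=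
    integral_comp_abs (f := fun t => max (1 - t / B) 0)
  have h2 : ∫ t in Ioi (0 : ℝ), max (1 - t / B) 0 = ∫ t in Ioc 0 B, (1 - t / B) := by
    rw [setIntegral_eq_of_subset_of_forall_sdiff_eq_zero measurableSet_Ioi
      (fun t (ht : t ∈ Ioc 0 B) => ht.1)]
    · refine setIntegral_congr_fun measurableSet_Ioc fun t ht => ?_
      exact max_eq_left (sub_nonneg.2 ((div_le_one hB).2 ht.2))
    · rintro t ⟨ht, ht'⟩
      have : B < t := by
        by_contra hc
        exact ht' ⟨ht, not_lt.1 hc⟩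
      exact max_eq_right (sub_nonpos.2 ((one_le_div hB).2 this.le))
  rw [h1, h2, ← intervalIntegral.integral_of_le hB.le, intervalIntegral.integral_sub (by simp)
    (Continuous.intervalIntegrable (by fun_prop) _ _), intervalIntegral.integral_div, integral_id]
  simp
  field_simp
  ring

lemma fejer_zero {B : ℝ} (hB : 0 < B) : fejer B 0 = B := by
  simp [fejer, integral_tri hB]

lemma fejer_le {B : ℝ} (hB : 0 < B) (y : ℝ) : fejer B y ≤ (B + 4 / B) / (1 + y ^ 2) := by
  have h1 : fejer B y ≤ B := by
    rw [fejer]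
    conv_rhs => rw [← integral_tri hB]
    refine integral_mono ((integrable_tri hB).mul_bdd (c := 1) (by fun_prop)
      (ae_of_all _ fun t => abs_cos_le_one _)) (integrable_tri hB) fun t => ?_
    exact mul_le_of_le_one_right (tri_nonneg B t) (cos_le_one _)
  rw [le_div_iff₀ (by positivity)]
  have h2 : fejer B y * y ^ 2 ≤ 4 / B := by
    rcases eq_or_ne y 0 with rfl | hy
    · simp
      positivity
    · rw [fejer_eq hB hy]
      have := neg_one_le_cos (B * y)
      rw [div_mul_eq_mul_div, div_le_div_iff₀ (by positivity) hB]
      have : 0 ≤ (1 + cos (B * y)) * (B * y ^ 2) := by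
        have : 0 ≤ 1 + cos (B * y) := by linarith
        positivity
      nlinarith
  linarith

lemma integrable_fejer {B : ℝ} (hB : 0 < B) : Integrable (fejer B) := by
  refine (integrable_inv_one_add_sq.const_mul (B + 4 / B)).mono'
    (continuous_fejer hB).aestronglyMeasurable (ae_of_all _ fun y => ?_)
  rw [norm_of_nonneg (fejer_nonneg hB y)]
  exact fejer_le hB y

lemma kern_fejer {B : ℝ} (hB : 0 < B) (y : ℝ) :
    kern (fun t => ((2 * π)⁻¹ * fejer B t : ℝ)) y = tri B y := by
  have hk : kern (fun t => (tri B t : ℂ)) = fun w => (fejer B w : ℂ) := funext (kern_tri hB)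
  have h := eq_integral_kern (g := fun t => (tri B t : ℂ))
    (Complex.continuous_ofReal.comp (continuous_tri B)) (integrable_tri hB).ofReal
    (by rw [hk]; exact (integrable_fejer hB).ofReal) (-y)
  rw [hk, tri_neg, ← integral_const_mul] at h
  rw [h, kern]
  congr 1 with w
  push_cast
  ring_nf

lemma integral_tri_convPow_eq {B : ℝ} (hB : 0 < B) (n : ℕ) (z : ℝ) :
    ((∫ s, tri B (s - z) ∂(convPow F n) : ℝ) : ℂ) =
      fcoef F (fun t => ((2 * π)⁻¹ * fejer B t : ℝ)) n z := by
  have h := integral_kern (((integrable_fejer hB).const_mul (2 * π)⁻¹).ofReal (𝕜 := ℂ))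
    (convPow F n) z
  simp only [charFun_convPow] at h
  rw [fcoef]
  refine Eq.trans ?_ h
  rw [← integral_complex_ofReal]
  congr 1 with s
  exact (kern_fejer hB (s - z)).symm

lemma ScaleSeq.tendsto_tsum_tri (hF : RegTail F α) (ha : ScaleSeq F α a)
    (hg : LimitDensity F a g) (hφ : ∀ t : ℝ, t ≠ 0 → charFun F t ≠ 1) {B : ℝ} (hB : 0 < B)
    (z : ℝ) {δ : ℝ} (hδ : 0 < δ) :
    Tendsto (fun x => x * rtail F x *
      ∑' m, ∫ s, tri B (s - (x + z)) ∂(convPow F (⌈δ / rtail F x⌉₊ + m))) atTop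
      (𝓝 (B * truncInt α g δ)) := by
  have hy : Tendsto (fun x : ℝ => (x + z) / x) atTop (𝓝 1) := by
    have : Tendsto (fun x : ℝ => 1 + z / x) atTop (𝓝 (1 + 0)) :=
      tendsto_const_nhds.add (tendsto_id.const_div_atTop _)
    rw [add_zero] at this
    refine this.congr' ?_
    filter_upwards [eventually_ne_atTop 0] with x hx
    field_simp
  have hc : Continuous fun t => (((2 * π)⁻¹ * fejer B t : ℝ) : ℂ) :=
    Complex.continuous_ofReal.comp (continuous_const.mul (continuous_fejer hB))
  have h := ha.tendsto_mul_tsum_fcoef hF hg.tendsto_charFun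
    (k := fun t => ((2 * π)⁻¹ * fejer B t : ℝ)) (M := (2 * π)⁻¹ * (B + 4 / B))
    hc.measurable (fun t => ?_) hc.continuousAt isClosed_univ
    (fun t ht => absurd (mem_univ t) ht) (fun t _ => hφ t) hy hδ
  · rw [hg.integral_eq_truncInt hF ha hδ, fejer_zero hB] at h
    simp only [← integral_tri_convPow_eq hB, ← Complex.ofReal_tsum, ← Complex.ofReal_mul] at h
    have h' := (Complex.continuous_re.tendsto _).comp h
    simp only [Function.comp_def, Complex.ofReal_re] at h'
    convert h' using 2
    field_simp
  · rw [Complex.norm_real, norm_mul, norm_of_nonneg (by positivity),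
      norm_of_nonneg (fejer_nonneg hB t), mul_div_assoc]
    gcongr
    exact fejer_le hB t

end Nonarithmetic

section Nonarithmetic

variable {F : Measure ℝ} [IsProbabilityMeasure F] {a : ℕ → ℝ} {g : ℝ → ℝ} {α : ℝ}

lemma ScaleSeq.summable_convPow_Ioc (hF : RegTail F α) (ha : ScaleSeq F α a) {h : ℝ} (hh : 0 < h)
    (z : ℝ) : Summable fun n => (convPow F n).real (Ioc z (z + h)) := by
  obtain ⟨C, hC, hb⟩ := ha.convPow_Ioc_le hF hh
  refine Summable.of_nonneg_of_le (fun n => measureReal_nonneg) (fun n => ?_)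
    ((ha.summable_inv hF).mul_left C)
  have : 0 < a n := zero_lt_one.trans_le (ha.one_le n)
  exact ENNReal.toReal_le_of_le_ofReal (by positivity) (hb n z)

lemma mul_tri {B : ℝ} (hB : 0 < B) (t : ℝ) : B * tri B t = max (B - |t|) 0 := by
  rw [tri, mul_max_of_nonneg _ _ hB.le, mul_zero, mul_sub, mul_one, mul_div_cancel₀ _ hB.ne']

lemma integrable_tri_sub {B : ℝ} (hB : 0 < B) (z : ℝ) (μ : Measure ℝ) [IsFiniteMeasure μ] :
    Integrable (fun s => tri B (s - z)) μ := by
  have := continuous_tri B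
  refine Integrable.of_bound (by fun_prop) 1 (ae_of_all _ fun s => ?_)
  rw [norm_of_nonneg (tri_nonneg _ _)]
  exact tri_le_one hB _

lemma integral_tri_le {B : ℝ} (hB : 0 < B) (z : ℝ) (μ : Measure ℝ) [IsFiniteMeasure μ] :
    ∫ s, tri B (s - z) ∂μ ≤ μ.real (Ioc (z - B) (z - B + 2 * B)) := by
  rw [← integral_indicator_one measurableSet_Ioc]
  refine integral_mono (integrable_tri_sub hB z μ)
    ((integrable_const _).indicator measurableSet_Ioc) fun s => ?_
  by_cases hs : s ∈ Ioc (z - B) (z - B + 2 * B)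
  · rw [indicator_of_mem hs]
    exact tri_le_one hB _
  · rw [indicator_of_notMem hs]
    refine (tri_eq_zero hB ?_).le
    by_contra hc
    rw [not_le, abs_lt] at hc
    exact hs ⟨by linarith, by linarith⟩

lemma ScaleSeq.summable_integral_tri (hF : RegTail F α) (ha : ScaleSeq F α a) {B : ℝ} (hB : 0 < B)
    (z : ℝ) : Summable fun n => ∫ s, tri B (s - z) ∂(convPow F n) :=
  Summable.of_nonneg_of_le (fun _ => integral_nonneg fun _ => tri_nonneg _ _)
    (fun n => integral_tri_le hB z (convPow F n))
    (ha.summable_convPow_Ioc hF (mul_pos two_pos hB) (z - B))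

lemma measureReal_Ioc_le_tri {h ε : ℝ} (hh : 0 < h) (hε : 0 < ε) (x : ℝ) (μ : Measure ℝ)
    [IsFiniteMeasure μ] :
    ε * μ.real (Ioc x (x + h)) ≤ (h / 2 + ε) * ∫ s, tri (h / 2 + ε) (s - (x + h / 2)) ∂μ -
      h / 2 * ∫ s, tri (h / 2) (s - (x + h / 2)) ∂μ := by
  have h1 := integrable_tri_sub (B := h / 2 + ε) (by positivity) (x + h / 2) μ
  have h2 := integrable_tri_sub (B := h / 2) (by positivity) (x + h / 2) μ
  rw [← integral_indicator_one measurableSet_Ioc, ← integral_const_mul, ← integral_const_mul,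
    ← integral_const_mul, ← integral_sub (h1.const_mul _) (h2.const_mul _)]
  refine integral_mono (((integrable_const _).indicator measurableSet_Ioc).const_mul _)
    ((h1.const_mul _).sub (h2.const_mul _)) fun s => ?_
  dsimp only
  rw [mul_tri (by positivity), mul_tri (by positivity)]
  by_cases hs : s ∈ Ioc x (x + h)
  · have : |s - (x + h / 2)| ≤ h / 2 := abs_le.2 ⟨by linarith [hs.1], by linarith [hs.2]⟩
    rw [indicator_of_mem hs, Pi.one_apply, max_eq_left (by linarith), max_eq_left (by linarith)]
    linarith
  · rw [indicator_of_notMem hs, mul_zero, sub_nonneg]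
    exact max_le_max (by linarith) le_rfl

lemma tri_le_measureReal_Ioc {h ε : ℝ} (hε : 0 < ε) (hεh : ε < h / 2) (x : ℝ)
    (μ : Measure ℝ) [IsFiniteMeasure μ] :
    h / 2 * ∫ s, tri (h / 2) (s - (x + h / 2)) ∂μ -
      (h / 2 - ε) * ∫ s, tri (h / 2 - ε) (s - (x + h / 2)) ∂μ ≤ ε * μ.real (Ioc x (x + h)) := by
  have hh : 0 < h := by linarith
  have hB : 0 < h / 2 - ε := by linarith
  have h1 := integrable_tri_sub (B := h / 2 - ε) hB (x + h / 2) μ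
  have h2 := integrable_tri_sub (B := h / 2) (by positivity) (x + h / 2) μ
  rw [← integral_indicator_one measurableSet_Ioc, ← integral_const_mul, ← integral_const_mul,
    ← integral_const_mul, ← integral_sub (h2.const_mul _) (h1.const_mul _)]
  refine integral_mono ((h2.const_mul _).sub (h1.const_mul _))
    (((integrable_const _).indicator measurableSet_Ioc).const_mul _) fun s => ?_
  dsimp only
  rw [mul_tri hB, mul_tri (by positivity)]
  by_cases hs : s ∈ Ioc x (x + h)
  · rw [indicator_of_mem hs, Pi.one_apply, mul_one, sub_le_iff_le_add]
    refine max_le ?_ ?_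
    · linarith [le_max_left (h / 2 - ε - |s - (x + h / 2)|) 0]
    · linarith [le_max_right (h / 2 - ε - |s - (x + h / 2)|) 0]
  · have : h / 2 ≤ |s - (x + h / 2)| := by
      by_contra hc
      rw [not_le, abs_lt] at hc
      exact hs ⟨by linarith, by linarith⟩
    rw [indicator_of_notMem hs, max_eq_right (by linarith), max_eq_right (by linarith)]
    simp

/-- The contribution of large `n` to the renewal measure. -/
def largeSum (F : Measure ℝ) (h δ x : ℝ) : ℝ :=
  x * rtail F x * ∑' m, (convPow F (⌈δ / rtail F x⌉₊ + m)).real (Ioc x (x + h))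

lemma ScaleSeq.tendsto_largeSum_of_charFun_ne_one (hF : RegTail F α) (ha : ScaleSeq F α a)
    (hg : LimitDensity F a g) (hφ : ∀ t : ℝ, t ≠ 0 → charFun F t ≠ 1) {h : ℝ} (hh : 0 < h)
    {δ : ℝ} (hδ : 0 < δ) :
    Tendsto (largeSum F h δ) atTop (𝓝 (h * truncInt α g δ)) := by
  set J := truncInt α g δ with hJ
  set N : ℝ → ℕ := fun x => ⌈δ / rtail F x⌉₊ with hN
  set P : ℝ → ℝ → ℝ := fun B x => x * rtail F x *
    ∑' m, ∫ s, tri B (s - (x + h / 2)) ∂(convPow F (N x + m)) with hP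
  have hlim : ∀ B > 0, Tendsto (P B) atTop (𝓝 (B * J)) := fun B hB =>
    ha.tendsto_tsum_tri hF hg hφ hB (h / 2) hδ
  have hsI : ∀ x, Summable fun m => (convPow F (N x + m)).real (Ioc x (x + h)) := fun x => by
    simpa only [add_comm] using (summable_nat_add_iff (N x)).2 (ha.summable_convPow_Ioc hF hh x)
  have hsT : ∀ B > 0, ∀ x, Summable fun m =>
      ∫ s, tri B (s - (x + h / 2)) ∂(convPow F (N x + m)) := fun B hB x => by
    simpa only [add_comm] using
      (summable_nat_add_iff (N x)).2 (ha.summable_integral_tri hF hB (x + h / 2))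
  have hup : ∀ ε > 0, ∀ x ≥ 0,
      ε * largeSum F h δ x ≤ (h / 2 + ε) * P (h / 2 + ε) x - h / 2 * P (h / 2) x := by
    intro ε hε x hx
    have h1 := (hsT (h / 2 + ε) (by positivity) x).mul_left (h / 2 + ε)
    have h2 := (hsT (h / 2) (by positivity) x).mul_left (h / 2)
    have h3 := ((hsI x).mul_left ε).tsum_le_tsum
      (fun m => measureReal_Ioc_le_tri hh hε x (convPow F (N x + m))) (h1.sub h2)
    rw [h1.tsum_sub h2, tsum_mul_left, tsum_mul_left, tsum_mul_left] at h3
    have := mul_le_mul_of_nonneg_left h3 (mul_nonneg hx (rtail_nonneg F x))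
    simp only [largeSum, hP]
    linarith
  have hlo : ∀ ε > 0, ε < h / 2 → ∀ x ≥ 0,
      h / 2 * P (h / 2) x - (h / 2 - ε) * P (h / 2 - ε) x ≤ ε * largeSum F h δ x := by
    intro ε hε hεh x hx
    have h1 := (hsT (h / 2 - ε) (by linarith) x).mul_left (h / 2 - ε)
    have h2 := (hsT (h / 2) (by positivity) x).mul_left (h / 2)
    have h3 := (h2.sub h1).tsum_le_tsum
      (fun m => tri_le_measureReal_Ioc hε hεh x (convPow F (N x + m))) ((hsI x).mul_left ε)
    rw [h2.tsum_sub h1, tsum_mul_left, tsum_mul_left, tsum_mul_left] at h3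
    have := mul_le_mul_of_nonneg_left h3 (mul_nonneg hx (rtail_nonneg F x))
    simp only [largeSum, hP]
    linarith
  rw [Metric.tendsto_atTop']
  intro η hη
  obtain ⟨ε, hε, hεh, hεη⟩ : ∃ ε > 0, ε < h / 2 ∧ ε * (|J| + 1) < η := by
    refine ⟨min (h / 4) (η / (2 * (|J| + 1))), by positivity, ?_, ?_⟩
    · exact (min_le_left _ _).trans_lt (by linarith)
    · calc _ ≤ η / (2 * (|J| + 1)) * (|J| + 1) := by gcongr; exact min_le_right _ _
        _ = η / 2 := by field_simp
        _ < η := by linarith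
  have hU := ((hlim (h / 2 + ε) (by positivity)).const_mul (h / 2 + ε)).sub
    ((hlim (h / 2) (by positivity)).const_mul (h / 2))
  have hL := ((hlim (h / 2) (by positivity)).const_mul (h / 2)).sub
    ((hlim (h / 2 - ε) (by linarith)).const_mul (h / 2 - ε))
  have key := ((hU.eventually_lt_const (lt_add_of_pos_right _ (mul_pos hε hε))).and
    (hL.eventually_const_lt (sub_lt_self _ (mul_pos hε hε)))).and
    (eventually_ge_atTop (0 : ℝ))
  obtain ⟨X, hX⟩ := eventually_atTop.1 key
  refine ⟨X, fun x hx => ?_⟩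
  obtain ⟨⟨hU', hL'⟩, hx0⟩ := hX x hx.le
  have u := (hup ε hε x hx0).trans_lt hU'
  have l := hL'.trans_le (hlo ε hε hεh x hx0)
  have u' : largeSum F h δ x < (h + ε) * J + ε := by
    refine lt_of_mul_lt_mul_left ?_ hε.le
    nlinarith
  have l' : (h - ε) * J - ε < largeSum F h δ x := by
    refine lt_of_mul_lt_mul_left ?_ hε.le
    nlinarith
  rw [dist_eq, abs_lt]
  have j1 := mul_le_mul_of_nonneg_left (le_abs_self J) hε.le
  have j2 := mul_le_mul_of_nonneg_left (neg_abs_le J) hε.le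
  constructor <;> nlinarith

end Nonarithmetic

section Arithmetic

variable {F : Measure ℝ} [IsProbabilityMeasure F] {a : ℕ → ℝ} {g : ℝ → ℝ} {α h : ℝ}

lemma ConcOn.ae_mem (hc : ConcOn F h) : ∀ᵐ x ∂F, ∃ k : ℤ, x = k * h := by
  have hcount : {x : ℝ | ∃ k : ℤ, x = k * h}.Countable := by
    refine (countable_range fun k : ℤ => (k : ℝ) * h).mono ?_
    rintro x ⟨k, rfl⟩
    exact ⟨k, rfl⟩
  exact (prob_compl_eq_zero_iff hcount.measurableSet).2 hc

lemma ConcOn.convPow (hh : 0 < h) (hc : ConcOn F h) (n : ℕ) : ConcOn (convPow F n) h := by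
  have h1 : charFun F (2 * π / h) = 1 := by
    rw [charFun_apply_real]
    have : ∀ᵐ x : ℝ ∂F, Complex.exp ((2 * π / h : ℝ) * x * Complex.I) = 1 := by
      filter_upwards [hc.ae_mem] with x hx
      obtain ⟨k, rfl⟩ := hx
      rw [Complex.exp_eq_one_iff]
      refine ⟨k, ?_⟩
      have : (h : ℂ) ≠ 0 := by exact_mod_cast hh.ne'
      push_cast
      field_simp
    rw [integral_congr_ae this]
    simp
  have h2 : charFun (SRT.convPow F n) (2 * π / h) = 1 := by rw [charFun_convPow, h1, one_pow]
  have h3 := concOn_of_charFun_eq_one (by positivity) h2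
  rwa [abs_of_pos (by positivity), div_div_cancel₀ (by positivity)] at h3

/-- The Fourier coefficient kernel of the lattice `hℤ`. -/
def latticeKernel (h t : ℝ) : ℂ := (Icc (-(π / h)) (π / h)).indicator (fun _ => ((h / (2 * π) : ℝ) : ℂ)) t

lemma kern_latticeKernel (hh : 0 < h) (j : ℤ) :
    kern (latticeKernel h) (j * h) = if j = 0 then 1 else 0 := by
  have hh' : (h : ℂ) ≠ 0 := by exact_mod_cast hh.ne'
  have hπ : (π : ℂ) ≠ 0 := by exact_mod_cast pi_ne_zero
  have hle : -(π / h) ≤ π / h := by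
    have : 0 ≤ π / h := by positivity
    linarith
  have e1 : kern (latticeKernel h) (j * h) = (h / (2 * π) : ℝ) *
      ∫ t in (-(π / h))..(π / h), Complex.exp (j * h * Complex.I * t) := by
    rw [intervalIntegral.integral_of_le hle, ← integral_Icc_eq_integral_Ioc, kern,
      ← integral_const_mul, ← integral_indicator measurableSet_Icc]
    congr 1 with t
    by_cases ht : t ∈ Icc (-(π / h)) (π / h)
    · rw [latticeKernel, indicator_of_mem ht, indicator_of_mem ht]
      push_cast
      ring_nf
    · rw [latticeKernel, indicator_of_notMem ht, indicator_of_notMem ht, zero_mul]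
  rw [e1]
  split_ifs with hj
  · subst hj
    simp only [Int.cast_zero, zero_mul, Complex.exp_zero, intervalIntegral.integral_const,
      Complex.real_smul]
    push_cast
    field_simp
    ring
  · have hj' : (j : ℂ) ≠ 0 := by exact_mod_cast hj
    rw [integral_exp_mul_complex (by simp [hj', hh'])]
    have : Complex.exp (j * h * Complex.I * ((π / h : ℝ) : ℂ)) =
        Complex.exp (j * h * Complex.I * ((-(π / h) : ℝ) : ℂ)) := by
      rw [Complex.exp_eq_exp_iff_exists_int]
      refine ⟨j, ?_⟩
      push_cast
      field_simp
      ring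
    rw [this, sub_self, zero_div, mul_zero]

lemma norm_latticeKernel_le (hh : 0 < h) (t : ℝ) :
    ‖latticeKernel h t‖ ≤ (h / (2 * π) * (1 + (π / h) ^ 2)) / (1 + t ^ 2) := by
  by_cases ht : t ∈ Icc (-(π / h)) (π / h)
  · rw [latticeKernel, indicator_of_mem ht, Complex.norm_real, norm_of_nonneg (by positivity),
      le_div_iff₀ (by positivity)]
    have : t ^ 2 ≤ (π / h) ^ 2 := sq_le_sq' ht.1 ht.2
    gcongr
  · rw [latticeKernel, indicator_of_notMem ht, norm_zero]
    positivity

lemma measurable_latticeKernel : Measurable (latticeKernel h) :=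
  measurable_const.indicator measurableSet_Icc

lemma integrable_latticeKernel (hh : 0 < h) : Integrable (latticeKernel h) :=
  (integrable_inv_one_add_sq.const_mul _).mono' measurable_latticeKernel.aestronglyMeasurable
    (ae_of_all _ (norm_latticeKernel_le hh))

/-- The unique point of `hℤ` in `(x, x + h]`. -/
def latticePoint (h x : ℝ) : ℝ := ((⌊x / h⌋ + 1 : ℤ) : ℝ) * h

lemma mul_mem_Ioc_iff (hh : 0 < h) (x : ℝ) (j : ℤ) :
    (j : ℝ) * h ∈ Ioc x (x + h) ↔ j = ⌊x / h⌋ + 1 := by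
  have : x + h = (x / h + 1) * h := by field_simp
  rw [mem_Ioc, ← div_lt_iff₀ hh, this, mul_le_mul_iff_left₀ hh, ← Int.floor_lt,
    ← sub_le_iff_le_add, ← Int.cast_one, ← Int.cast_sub, ← Int.le_floor]
  omega

lemma measureReal_Ioc_eq_fcoef (hh : 0 < h) (hc : ConcOn F h) (n : ℕ) (x : ℝ) :
    (((convPow F n).real (Ioc x (x + h)) : ℝ) : ℂ) =
      fcoef F (latticeKernel h) n (latticePoint h x) := by
  have e := integral_kern (integrable_latticeKernel hh) (convPow F n) (latticePoint h x)
  simp only [charFun_convPow] at e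
  rw [fcoef, ← e, ← integral_indicator_one measurableSet_Ioc, ← integral_complex_ofReal]
  refine integral_congr_ae ?_
  filter_upwards [(hc.convPow hh n).ae_mem] with s hs
  obtain ⟨j, rfl⟩ := hs
  have : (j : ℝ) * h - latticePoint h x = ((j - (⌊x / h⌋ + 1) : ℤ) : ℝ) * h := by
    rw [latticePoint]
    push_cast
    ring
  rw [this, kern_latticeKernel hh, indicator]
  simp only [mul_mem_Ioc_iff hh, sub_eq_zero]
  split_ifs <;> simp

lemma tendsto_latticePoint_div (hh : 0 < h) :
    Tendsto (fun x => latticePoint h x / x) atTop (𝓝 1) := by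
  have h1 : Tendsto (fun x : ℝ => 1 + h / x) atTop (𝓝 (1 + 0)) :=
    tendsto_const_nhds.add (tendsto_id.const_div_atTop _)
  rw [add_zero] at h1
  refine tendsto_of_tendsto_of_tendsto_of_le_of_le' tendsto_const_nhds h1 ?_ ?_
  all_goals
    filter_upwards [eventually_gt_atTop 0] with x hx
    have hm := (mul_mem_Ioc_iff hh x (⌊x / h⌋ + 1)).2 rfl
  · rw [one_le_div hx]
    exact hm.1.le
  · rw [div_le_iff₀ hx, add_mul, div_mul_cancel₀ _ hx.ne', one_mul]
    exact hm.2

lemma ScaleSeq.tendsto_largeSum_of_concOn (hF : RegTail F α) (ha : ScaleSeq F α a)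
    (hg : LimitDensity F a g) (hh : 0 < h) (hc : ConcOn F h)
    (hspan : ∀ d > 0, ConcOn F d → d ≤ h) {δ : ℝ} (hδ : 0 < δ) :
    Tendsto (largeSum F h δ) atTop (𝓝 (h * truncInt α g δ)) := by
  have hq : 0 < π / h := by positivity
  have hnhds : Icc (-(π / h)) (π / h) ∈ 𝓝 (0 : ℝ) := Icc_mem_nhds (neg_neg_of_pos hq) hq
  have hcont : ContinuousAt (latticeKernel h) 0 := by
    refine ContinuousAt.congr (f := fun _ => ((h / (2 * π) : ℝ) : ℂ)) continuousAt_const ?_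
    filter_upwards [hnhds] with t ht
    rw [latticeKernel, indicator_of_mem ht]
  have hlim := ha.tendsto_mul_tsum_fcoef hF hg.tendsto_charFun (k := latticeKernel h)
    (S := Icc (-(π / h)) (π / h)) measurable_latticeKernel (norm_latticeKernel_le hh) hcont
    isClosed_Icc (fun t ht => indicator_of_notMem ht _) (fun t ht ht0 h1 => ?_)
    (tendsto_latticePoint_div hh) hδ
  · have h0 : latticeKernel h 0 = ((h / (2 * π) : ℝ) : ℂ) :=
      indicator_of_mem (mem_of_mem_nhds hnhds) _
    rw [hg.integral_eq_truncInt hF ha hδ, h0] at hlim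
    simp only [← measureReal_Ioc_eq_fcoef hh hc, ← Complex.ofReal_tsum, ← Complex.ofReal_mul]
      at hlim
    have h' := (Complex.continuous_re.tendsto _).comp hlim
    simp only [Function.comp_def, Complex.ofReal_re] at h'
    rwa [show h / (2 * π) * (2 * π * truncInt α g δ) = h * truncInt α g δ by field_simp] at h'
  · have hpos := abs_pos.2 ht0
    have hle := hspan _ (by positivity) (concOn_of_charFun_eq_one ht0 h1)
    have ht' : |t| ≤ π / h := abs_le.2 ht
    rw [div_le_iff₀ hpos] at hle
    rw [le_div_iff₀ hh] at ht'
    nlinarith [pi_pos]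

lemma ScaleSeq.tendsto_largeSum (hF : RegTail F α) (ha : ScaleSeq F α a)
    (hg : LimitDensity F a g) (hspan : SpanOK F h) {δ : ℝ} (hδ : 0 < δ) :
    Tendsto (largeSum F h δ) atTop (𝓝 (h * truncInt α g δ)) := by
  obtain ⟨hh, hn | ⟨hc, hmax⟩⟩ := hspan
  · refine ha.tendsto_largeSum_of_charFun_ne_one hF hg (fun t ht h1 => hn ?_) hh hδ
    have := abs_pos.2 ht
    exact ⟨_, by positivity, concOn_of_charFun_eq_one ht h1⟩
  · exact ha.tendsto_largeSum_of_concOn hF hg hh hc hmax hδ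

end Arithmetic

section Hypotheses

variable {F : Measure ℝ} [IsProbabilityMeasure F] {g ℓ : ℝ → ℝ} {α : ℝ}

lemma RightTail.pos (hRT : RightTail F ℓ) (x : ℝ) : 0 < rtail F x := by
  obtain ⟨y, hy, hxy⟩ := ((hRT.eventually_const_lt one_pos).and (eventually_ge_atTop x)).exists
  refine lt_of_lt_of_le (lt_of_le_of_ne (rtail_nonneg F y) fun h => ?_) (rtail_antitone F hxy)
  rw [← h, zero_mul] at hy
  exact lt_irrefl _ hy

lemma RightTail.tendsto_atTop (hRT : RightTail F ℓ) : Tendsto ℓ atTop atTop := by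
  have h0 : Tendsto (fun x => (rtail F x)⁻¹) atTop atTop :=
    (tendsto_nhdsWithin_iff.2 ⟨tendsto_rtail F, Eventually.of_forall hRT.pos⟩).inv_tendsto_nhdsGT_zero
  refine (h0.atTop_mul_pos one_pos hRT).congr fun x => ?_
  rw [inv_mul_cancel_left₀ (hRT.pos x).ne']

lemma RightTail.regTail (hα : α ∈ Ioc (0 : ℝ) (1 / 2)) (hℓ : RegVary ℓ α) (hRT : RightTail F ℓ)
    (hTR : TailRatio F) : RegTail F α where
  α_pos := hα.1
  α_le := hα.2
  pos := hRT.pos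
  rv l hl := by
    have h1 : Tendsto (fun x => rtail F (l * x) * ℓ (l * x)) atTop (𝓝 1) :=
      hRT.comp (tendsto_id.const_mul_atTop hl)
    have h2 := (h1.div hRT one_ne_zero).div (hℓ.2 l hl) (rpow_pos_of_pos hl α).ne'
    rw [div_one, one_div, ← rpow_neg hl.le] at h2
    refine h2.congr' ?_
    filter_upwards [eventually_gt_atTop 0] with x hx
    have e1 := (hℓ.1 x hx).ne'
    have e2 := (hℓ.1 (l * x) (mul_pos hl hx)).ne'
    have e3 := (hRT.pos x).ne'
    simp only [Pi.div_apply]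
    field_simp
  left := by
    obtain ⟨p, hp⟩ := hTR
    obtain ⟨X, hX⟩ := eventually_atTop.1 (hp.eventually_lt_const (lt_add_one p))
    refine ⟨max (p + 1) (1 / rtail F X), fun x _ => ?_⟩
    have hpos := hRT.pos x
    rcases le_total X x with h | h
    · refine ((div_lt_iff₀ hpos).1 (hX x h)).le.trans ?_
      gcongr
      exact le_max_left _ _
    · calc (F (Iic (-x))).toReal ≤ 1 := measureReal_le_one
        _ ≤ 1 / rtail F X * rtail F x := by
          rw [div_mul_eq_mul_div, one_mul, one_le_div (hRT.pos X)]
          exact rtail_antitone F h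
        _ ≤ _ := by
          gcongr
          exact le_max_right _ _

lemma RightTail.linv_nonempty (hRT : RightTail F ℓ) (x : ℝ) : {t : ℝ | 1 ≤ t ∧ x < ℓ t}.Nonempty :=
  ((eventually_ge_atTop 1).and (hRT.tendsto_atTop.eventually_gt_atTop x)).exists

lemma bddBelow_linv (ℓ : ℝ → ℝ) (x : ℝ) : BddBelow {t : ℝ | 1 ≤ t ∧ x < ℓ t} :=
  ⟨1, fun _ ht => ht.1⟩

lemma RightTail.one_le_linv (hRT : RightTail F ℓ) (x : ℝ) : 1 ≤ linv ℓ x :=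
  le_csInf (hRT.linv_nonempty x) fun _ ht => ht.1

lemma RightTail.linv_mono (hRT : RightTail F ℓ) : Monotone (linv ℓ) := fun x y hxy =>
  csInf_le_csInf (bddBelow_linv ℓ x) (hRT.linv_nonempty y) fun _ ht => ⟨ht.1, hxy.trans_lt ht.2⟩

lemma le_of_lt_linv {t x : ℝ} (ht : 1 ≤ t) (h : t < linv ℓ x) : ℓ t ≤ x := by
  by_contra hc
  exact h.not_ge (csInf_le (bddBelow_linv ℓ x) ⟨ht, not_le.1 hc⟩)

lemma RightTail.exists_lt_of_linv_lt (hRT : RightTail F ℓ) {u x : ℝ} (h : linv ℓ x < u) :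
    ∃ t, linv ℓ x ≤ t ∧ t < u ∧ x < ℓ t := by
  obtain ⟨t, ht, htu⟩ := exists_lt_of_csInf_lt (hRT.linv_nonempty x) h
  exact ⟨t, csInf_le (bddBelow_linv ℓ x) ht, htu, ht.2⟩

lemma RightTail.scaleSeq (hRT : RightTail F ℓ) (hF : RegTail F α)
    (hg : LimitDensity F (fun n => linv ℓ n) g) : ScaleSeq F α fun n : ℕ => linv ℓ n := by
  have hmono : Monotone fun n : ℕ => linv ℓ n := hRT.linv_mono.comp Nat.mono_cast
  have hinf := hg.tendsto_atTop hF hmono fun n => hRT.one_le_linv n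
  refine ⟨fun n => hRT.one_le_linv n, hmono, fun l hl => ?_⟩
  have hα := hF.α_pos
  rw [tendsto_order]
  constructor
  · intro b hb
    obtain ⟨q, hqb, hq⟩ : ∃ q : ℝ, b < (l * q) ^ (-α) ∧ 1 < q := by
      have hc : ContinuousAt (fun q : ℝ => (l * q) ^ (-α)) 1 :=
        ContinuousAt.rpow_const (by fun_prop) (Or.inl (by simpa using hl.ne'))
      have hc' : Tendsto (fun q : ℝ => (l * q) ^ (-α)) (𝓝[>] 1) (𝓝 (l ^ (-α))) := by
        simpa using hc.tendsto.mono_left nhdsWithin_le_nhds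
      exact ((hc'.eventually_const_lt hb).and self_mem_nhdsWithin).exists
    have hq0 : 0 < q := by linarith
    have hlim : Tendsto (fun y => rtail F y * ℓ y * (rtail F (l * q * y) / rtail F y)) atTop
        (𝓝 (1 * (l * q) ^ (-α))) := Tendsto.mul hRT (hF.rv (l * q) (by positivity))
    rw [one_mul] at hlim
    have hy : Tendsto (fun n : ℕ => linv ℓ n / q) atTop atTop := hinf.atTop_div_const hq0
    filter_upwards [(hlim.comp hy).eventually_const_lt hqb, hy.eventually_ge_atTop 1] with n hn hn1
    refine hn.trans_le ?_
    have hpos := zero_lt_one.trans_le (hRT.one_le_linv n)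
    have e : l * q * (linv ℓ n / q) = l * linv ℓ n := by field_simp
    simp only [Function.comp]
    rw [e]
    have hG := hF.pos (linv ℓ n / q)
    have hle := le_of_lt_linv hn1 (div_lt_self hpos hq)
    calc _ = ℓ (linv ℓ n / q) * rtail F (l * linv ℓ n) := by field_simp
      _ ≤ _ := by
        have := rtail_nonneg F (l * linv ℓ n)
        gcongr
  · intro b hb
    obtain ⟨q, hqb, hq⟩ : ∃ q : ℝ, q * (l / q) ^ (-α) < b ∧ 1 < q := by
      have hc : ContinuousAt (fun q : ℝ => q * (l / q) ^ (-α)) 1 := by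
        refine continuousAt_id.mul (ContinuousAt.rpow_const ?_ (Or.inl (by simpa using hl.ne')))
        exact continuousAt_const.div continuousAt_id one_ne_zero
      have hc' : Tendsto (fun q : ℝ => q * (l / q) ^ (-α)) (𝓝[>] 1) (𝓝 (l ^ (-α))) := by
        simpa using hc.tendsto.mono_left nhdsWithin_le_nhds
      exact ((hc'.eventually_lt_const hb).and self_mem_nhdsWithin).exists
    have hq0 : 0 < q := by linarith
    have hlim : Tendsto (fun y => q * (rtail F (l / q * y) / rtail F y)) atTop
        (𝓝 (q * (l / q) ^ (-α))) := (hF.rv (l / q) (by positivity)).const_mul q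
    have hy : Tendsto (fun n : ℕ => q * linv ℓ n) atTop atTop := hinf.const_mul_atTop hq0
    obtain ⟨X, hX⟩ := eventually_atTop.1 (hRT.eventually_lt_const hq)
    filter_upwards [(hlim.comp hy).eventually_lt_const hqb, hinf.eventually_ge_atTop X] with n hn hnX
    refine lt_of_le_of_lt ?_ hn
    have hpos := zero_lt_one.trans_le (hRT.one_le_linv n)
    obtain ⟨t, ht1, ht2, ht3⟩ := hRT.exists_lt_of_linv_lt (u := q * linv ℓ n) (x := n)
      (by nlinarith)
    have e : l / q * (q * linv ℓ n) = l * linv ℓ n := by field_simp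
    simp only [Function.comp]
    rw [e]
    have hGt := hX t (hnX.trans ht1)
    have hG := hF.pos (q * linv ℓ n)
    have hmon := rtail_antitone F ht2.le
    have hln : (n : ℝ) * rtail F (q * linv ℓ n) ≤ q := by
      have h0 : (0 : ℝ) ≤ n := n.cast_nonneg
      nlinarith [hF.pos t]
    rw [← mul_div_assoc, le_div_iff₀ hG]
    nlinarith [rtail_nonneg F (l * linv ℓ n)]

end Hypotheses

section Conclusion

variable {F : Measure ℝ} [IsProbabilityMeasure F] {a : ℕ → ℝ} {α h : ℝ}

lemma ScaleSeq.renewal_Ioc (hF : RegTail F α) (ha : ScaleSeq F α a) (hh : 0 < h) {x : ℝ}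
    (hx : 0 ≤ x) {N : ℕ} (hN : 1 ≤ N) :
    (renewal F (Ioc x (x + h))).toReal = ∑ n ∈ Finset.Ico 1 N, (convPow F n).real (Ioc x (x + h)) +
      ∑' m, (convPow F (N + m)).real (Ioc x (x + h)) := by
  have hs := ha.summable_convPow_Ioc hF hh x
  have h0 : (convPow F 0).real (Ioc x (x + h)) = 0 := by
    have : (0 : ℝ) ∉ Ioc x (x + h) := fun h' => hx.not_gt h'.1
    simp [convPow, Measure.real, this]
  rw [renewal, Measure.sum_apply _ measurableSet_Ioc, ENNReal.tsum_toReal_eq fun n =>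
    measure_ne_top _ _]
  change ∑' n, (convPow F n).real (Ioc x (x + h)) = _
  rw [← hs.sum_add_tsum_nat_add N, Finset.range_eq_Ico, Finset.sum_eq_sum_Ico_succ_bot hN, h0,
    zero_add]
  simp only [add_comm]

end Conclusion

end SRT

/-- Proposition 1.6 of the paper: if `ω(x) = O(x^c)` and the
set where `ω > T` has density `O(x^{-c})` at scale `x^s` with `c ≤ s < 2α`,
then the SRT holds. -/
theorem srt_density
    (F : Measure ℝ) [IsProbabilityMeasure F] (α h : ℝ) (ℓ : ℝ → ℝ)
    (hα : α ∈ Set.Ioc (0:ℝ) (1/2)) (hℓ : RegVary ℓ α)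
    (hRT : RightTail F ℓ) (hTR : TailRatio F) (hspan : SpanOK F h)
    (c : ℝ) (hc : c ∈ Set.Ioo (0:ℝ) (2 * α))
    (hω : (fun x => omegaFn F h x) =O[atTop] fun x => x ^ c)
    (T s : ℝ) (hT : 0 ≤ T) (hs : c ≤ s ∧ s < 2 * α)
    (hE : DensityAtScale {x : ℝ | 0 ≤ x ∧ T < omegaFn F h x} c s) :
    ∀ g : ℝ → ℝ, StableLimit F ℓ g → SRTholds F h α g := by
  intro g hlim
  have hg : LimitDensity F (fun n => linv ℓ n) g := hlim
  have hF := hRT.regTail hα hℓ hTR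
  have ha := hRT.scaleSeq hF hg
  have hh := hspan.1
  obtain ⟨C, hC, δ₀, hδ₀, hsmall⟩ := ha.sum_small_le hF hh hc.1 hs.1 hs.2 hT hω hE
  rw [SRTholds, mul_assoc, mul_left_comm, Metric.tendsto_nhds]
  intro η hη
  have hJ := Metric.tendsto_nhds.1 ((hg.tendsto_truncInt hF ha).const_mul h) (η / 3) (by positivity)
  have hδ' : ∀ᶠ δ in nhdsWithin (0 : ℝ) (Set.Ioi 0), δ < min δ₀ (η / (3 * C)) :=
    nhdsWithin_le_nhds (Iio_mem_nhds (by positivity))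
  obtain ⟨δ, ⟨hδJ, hδ⟩, hδ0⟩ := ((hJ.and hδ').and self_mem_nhdsWithin).exists
  replace hδ0 : 0 < δ := hδ0
  have hCδ : C * δ < η / 3 := by
    have := (lt_div_iff₀ (by positivity)).1 (hδ.trans_le (min_le_right _ _))
    linarith
  filter_upwards [hsmall δ hδ0 (hδ.le.trans (min_le_left _ _)), eventually_ge_atTop 0,
    Metric.tendsto_nhds.1 (ha.tendsto_largeSum hF hg hspan hδ0) (η / 3) (by positivity)]
    with x hx hx0 hxL
  have hN : 1 ≤ ⌈δ / rtail F x⌉₊ := Nat.one_le_ceil_iff.2 (div_pos hδ0 (hF.pos x))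
  rw [ha.renewal_Ioc hF hh hx0 hN, mul_add]
  have hnn : 0 ≤ x * rtail F x *
      ∑ n ∈ Finset.Ico 1 ⌈δ / rtail F x⌉₊, (convPow F n).real (Set.Ioc x (x + h)) :=
    mul_nonneg (mul_nonneg hx0 (rtail_nonneg F x))
      (Finset.sum_nonneg fun _ _ => measureReal_nonneg)
  rw [Real.dist_eq, abs_lt] at hδJ hxL ⊢
  rw [largeSum] at hxL
  constructor <;> linarith [hδJ.1, hδJ.2, hxL.1, hxL.2]
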